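/- Fix an integer d ≥ 2 and δ ∈ (0,1). Let a^{jk} : ℝ^{d+1} → ℝ (1 ≤ j,k ≤ d) be measurable with a^{jk} = a^{kj} and δ|θ|² ≤ Σ_{j,k=1}^d a^{jk}(t,x) θ^j θ^k ≤ δ⁻¹|θ|² for all (t,x) ∈ ℝ^{d+1} and θ ∈ ℝ^d. Set L₀u = u_t + Σ_{j,k} a^{jk} u_{x^j x^k}. Let μ, ν ∈ (1,∞) with 1/μ + 1/ν = 1, let R ∈ (0,∞), and set α = 1/(d+4) and β = (d+2)/(2d+8). Then there exists N = N(d,δ,μ) such that for every smooth u with compact support contained in Q_R = (0,R²) × B_R, every (t,x) ∈ ℝ^{d+1}, and for w = u_t and for each w = u_{x^j x^k} with 1 ≤ j ≤ d, 2 ≤ k ≤ d: w^#(t,x) ≤ N (a_R^#)^{α/ν} [M(|u_{xx}|^{2μ})(t,x)]^{1/(2μ)} + N [M(|L₀u|²)(t,x)]^α [M(|u_{xx}|²)(t,x)]^β + N [M(|L₀u|²)(t,x)]^{1/2}. -/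

import Mathlib

open MeasureTheory

/-- Partial derivative in `t`. -/
noncomputable def pdt {d : ℕ} (u : ℝ × (Fin d → ℝ) → ℝ) : ℝ × (Fin d → ℝ) → ℝ :=
  fun p => fderiv ℝ u p (1, 0)

/-- Partial derivative in `x^j`. -/
noncomputable def pdx {d : ℕ} (j : Fin d) (u : ℝ × (Fin d → ℝ) → ℝ) :
    ℝ × (Fin d → ℝ) → ℝ :=
  fun p => fderiv ℝ u p (0, Pi.single j 1)

/-- Second partial derivative in `x^j, x^k`. -/
noncomputable def pdxx {d : ℕ} (j k : Fin d) (u : ℝ × (Fin d → ℝ) → ℝ) :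
    ℝ × (Fin d → ℝ) → ℝ :=
  pdx j (pdx k u)

/-- Open Euclidean ball of radius `r` about `x` in `ℝ^d`. -/
def ballC {d : ℕ} (r : ℝ) (x : Fin d → ℝ) : Set (Fin d → ℝ) :=
  {y | ∑ j, (y j - x j) ^ 2 < r ^ 2}

/-- Parabolic cylinder `Q_r(t,x) = (t,t+r²) × B_r(x)`. -/
def Qcyl {d : ℕ} (r : ℝ) (z : ℝ × (Fin d → ℝ)) : Set (ℝ × (Fin d → ℝ)) :=
  Set.Ioo z.1 (z.1 + r ^ 2) ×ˢ ballC r z.2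

/-- Average of `f` over a set `s`. -/
noncomputable def avg {d : ℕ} (s : Set (ℝ × (Fin d → ℝ)))
    (f : ℝ × (Fin d → ℝ) → ℝ) : ℝ :=
  ((volume s).toReal)⁻¹ * ∫ p in s, f p

/-- Parabolic (Hardy–Littlewood) maximal function over the cylinders `Q_r(t,x)`. -/
noncomputable def maxFn {d : ℕ} (g : ℝ × (Fin d → ℝ) → ℝ) (p : ℝ × (Fin d → ℝ)) : ℝ :=
  ⨆ q : {q : ℝ × (ℝ × (Fin d → ℝ)) // 0 < q.1 ∧ p ∈ Qcyl q.1 q.2},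
    avg (Qcyl q.val.1 q.val.2) fun y => |g y|

/-- Parabolic sharp function over the cylinders `Q_r(t,x)`. -/
noncomputable def sharpFn {d : ℕ} (g : ℝ × (Fin d → ℝ) → ℝ) (p : ℝ × (Fin d → ℝ)) : ℝ :=
  ⨆ q : {q : ℝ × (ℝ × (Fin d → ℝ)) // 0 < q.1 ∧ p ∈ Qcyl q.1 q.2},
    avg (Qcyl q.val.1 q.val.2) fun y =>
      |g y - avg (Qcyl q.val.1 q.val.2) g|

/-- `Γ_r(t,x') = (t,t+r²) × B'_r(x') ⊂ ℝ × ℝ^{d-1}` (here `d-1 = n`). -/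
def GammaC {n : ℕ} (r : ℝ) (t : ℝ) (x' : Fin n → ℝ) : Set (ℝ × (Fin n → ℝ)) :=
  Set.Ioo t (t + r ^ 2) ×ˢ ballC r x'

/-- `osc_{(t,x')}(a, Λ_r(t,x))`, the mean oscillation of the matrix `a` in the
variables `(t,x')`, the matrix "absolute value" being the max of the absolute
values of the entries. -/
noncomputable def oscA {n : ℕ}
    (a : ℝ × (Fin (n + 1) → ℝ) → Fin (n + 1) → Fin (n + 1) → ℝ)
    (r : ℝ) (t : ℝ) (x : Fin (n + 1) → ℝ) : ℝ :=
  (r ^ 5)⁻¹ * (((volume (ballC r (0 : Fin n → ℝ))).toReal) ^ 2)⁻¹ *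
    ∫ τ in Set.Ioo (x 0 - r) (x 0 + r),
      ∫ s₁ in GammaC r t (fun j : Fin n => x j.succ),
        ∫ s₂ in GammaC r t (fun j : Fin n => x j.succ),
          ⨆ j, ⨆ k,
            |a (s₁.1, Fin.cons τ s₁.2) j k - a (s₂.1, Fin.cons τ s₂.2) j k|

/-- `a_R^# = sup_{(t,x)} sup_{0 < r ≤ R} osc_{(t,x')}(a, Λ_r(t,x))`. -/
noncomputable def aSharp {n : ℕ}
    (a : ℝ × (Fin (n + 1) → ℝ) → Fin (n + 1) → Fin (n + 1) → ℝ) (R : ℝ) : ℝ :=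
  ⨆ z : ℝ × (Fin (n + 1) → ℝ), ⨆ r : {r : ℝ // 0 < r ∧ r ≤ R},
    oscA a r.val z.1 z.2

open scoped ContDiff
set_option linter.unusedSectionVars false
set_option linter.unusedVariables false
local notation:max "Fi" x:max => Fin (x + 1)
local notation:max "Mx" x:max => Fin (x + 1) → Fin (x + 1) → ℝ
local notation:max "mll" => mul_le_mul_of_nonneg_left
local notation:max "mlr" => mul_le_mul_of_nonneg_right
local notation:max "evf" => Filter.Eventually.of_forall
local notation:max "SC" => Finset.sum_congr rfl
local notation:max "SN" => Finset.sum_nonneg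
namespace KK
noncomputable def Dd {E : Type*} [NormedAddCommGroup E] [NormedSpace ℝ E] (e : E) (u : E → ℝ) :
    E → ℝ := fun p => fderiv ℝ u p e
section basics
variable {E : Type*} [NormedAddCommGroup E] [NormedSpace ℝ E]
def Sm (u : E → ℝ) : Prop := ContDiff ℝ ∞ u
def Cc (u : E → ℝ) : Prop := ContDiff ℝ ∞ u ∧ HasCompactSupport u
theorem Cc.sm {u : E → ℝ} (h : Cc u) : Sm u := h.1
theorem Sm.diff {u : E → ℝ} (h : Sm u) : Differentiable ℝ u := ContDiff.differentiable h (by simp)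
theorem Sm.cont {u : E → ℝ} (h : Sm u) : Continuous u := ContDiff.continuous h
theorem Sm.dd {u : E → ℝ} (h : Sm u) (e : E) : Sm (Dd e u) := by
  have h1 : ContDiff ℝ ∞ (fderiv ℝ u) := ContDiff.fderiv_right (m := ∞) h (by simp)
  exact h1.clm_apply contDiff_const
theorem Cc.dd {u : E → ℝ} (h : Cc u) (e : E) : Cc (Dd e u) := by
  refine ⟨h.sm.dd e, ?_⟩
  exact (h.2.fderiv ℝ).comp_left (g := fun L : E →L[ℝ] ℝ => L e) (by simp)
theorem Sm.mul {u v : E → ℝ} (h : Sm u) (h' : Sm v) : Sm (fun p => u p * v p) := ContDiff.mul h h'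
theorem Sm.add {u v : E → ℝ} (h : Sm u) (h' : Sm v) : Sm (fun p => u p + v p) := ContDiff.add h h'
theorem Sm.cmul {u : E → ℝ} (h : Sm u) (c : ℝ) : Sm (fun p => c * u p) :=
  ContDiff.mul contDiff_const h
theorem Cc.mul_right {u v : E → ℝ} (h : Cc u) (h' : Sm v) : Cc (fun p => u p * v p) :=
  ⟨Sm.mul h.1 h', h.2.mul_right⟩
theorem Cc.add {u v : E → ℝ} (h : Cc u) (h' : Cc v) : Cc (fun p => u p + v p) :=
  ⟨Sm.add h.1 h'.1, HasCompactSupport.add h.2 h'.2⟩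
theorem Cc.cmul {u : E → ℝ} (h : Cc u) (c : ℝ) : Cc (fun p => c * u p) :=
  ⟨Sm.cmul h.1 c, h.2.mul_left⟩
theorem Cc.sub {u v : E → ℝ} (h : Cc u) (h' : Cc v) : Cc (fun p => u p - v p) := by
  have := h.add (h'.cmul (-1))
  simpa [sub_eq_add_neg] using this
theorem dd_mul {u v : E → ℝ} (h : Sm u) (h' : Sm v) (e : E) (p : E) :
    Dd e (fun p => u p * v p) p = u p * Dd e v p + Dd e u p * v p := by
  unfold Dd
  rw [fderiv_fun_mul (h.diff p) (h'.diff p)]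
  simp [mul_comm]
theorem dd_add {u v : E → ℝ} (h : Sm u) (h' : Sm v) (e : E) (p : E) :
    Dd e (fun p => u p + v p) p = Dd e u p + Dd e v p := by
  unfold Dd
  rw [fderiv_fun_add (h.diff p) (h'.diff p)]
  simp
theorem dd_sub {u v : E → ℝ} (h : Sm u) (h' : Sm v) (e : E) (p : E) :
    Dd e (fun p => u p - v p) p = Dd e u p - Dd e v p := by
  unfold Dd
  rw [fderiv_fun_sub (h.diff p) (h'.diff p)]
  simp
theorem dd_cmul {u : E → ℝ} (h : Sm u) (c : ℝ) (e : E) (p : E) :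
    Dd e (fun p => c * u p) p = c * Dd e u p := by
  unfold Dd
  rw [fderiv_const_mul (h.diff p)]
  simp
theorem dd_comm {u : E → ℝ} (h : Sm u) (e f : E) : Dd e (Dd f u) = Dd f (Dd e u) := by
  funext p
  have h1 : ContDiff ℝ ∞ (fderiv ℝ u) := ContDiff.fderiv_right (m := ∞) h (by simp)
  have h2 : DifferentiableAt ℝ (fderiv ℝ u) p := (h1.differentiable (by simp)) p
  have hs : IsSymmSndFDerivAt ℝ u p := by
    refine (ContDiff.contDiffAt h).isSymmSndFDerivAt ?_
    simp only [minSmoothness_of_isRCLikeNormedField]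
    exact WithTop.coe_le_coe.2 le_top
  have key : ∀ a b : E, Dd a (Dd b u) p = fderiv ℝ (fderiv ℝ u) p a b := by
    intro a b
    unfold Dd
    rw [fderiv_clm_apply h2 (differentiableAt_const _)]
    simp
  rw [key, key]
  exact hs e f
theorem Sm.hasLine {u : E → ℝ} (h : Sm u) (e p : E) : HasLineDerivAt ℝ u (Dd e u p) p e :=
  (h.diff p).hasFDerivAt.hasLineDerivAt e
theorem Sm.sq {u : E → ℝ} (h : Sm u) : Sm (fun p => u p ^ 2) := ContDiff.pow h 2
variable [MeasurableSpace E] [BorelSpace E] [FiniteDimensional ℝ E]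
  {m : Measure E} [m.IsAddHaarMeasure]
theorem Cc.integrable {u : E → ℝ} (h : Cc u) : Integrable u m :=
  h.sm.cont.integrable_of_hasCompactSupport h.2
theorem integrable_bdd_mul {c u : E → ℝ} (hu : Integrable u m) (hc : Measurable c) {C : ℝ}
    (hC : ∀ p, |c p| ≤ C) : Integrable (fun p => c p * u p) m :=
  hu.bdd_mul (c := C) hc.aestronglyMeasurable (evf hC)
theorem int_weight_dd {c F : E → ℝ} {e : E} (hc : Measurable c) {C : ℝ} (hC : ∀ p, |c p| ≤ C)
    (hinv : ∀ p (s : ℝ), c (p + s • e) = c p) (hF : Cc F) : ∫ p, c p * Dd e F p ∂m = 0 := by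
  have := integral_bilinear_hasLineDerivAt_right_eq_neg_left_of_integrable (μ := m)
    (f := c) (f' := fun _ => 0) (g := F) (g' := Dd e F) (v := e)
    (B := ContinuousLinearMap.mul ℝ ℝ) (by simp)
    (by simpa using integrable_bdd_mul (hF.dd e).integrable hc hC)
    (by simpa using integrable_bdd_mul hF.integrable hc hC)
    (by
      intro x _
      unfold HasLineDerivAt
      have : (fun t : ℝ => c (x + t • e)) = fun _ => c x := by funext t; exact hinv x t
      rw [this]; exact hasDerivAt_const _ _)
    (fun x _ => hF.sm.hasLine e x)
  simpa using this
theorem int_dd {F : E → ℝ} {e : E} (hF : Cc F) : ∫ p, Dd e F p ∂m = 0 := by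
  have := int_weight_dd (m := m) (c := fun _ => 1) (e := e) measurable_const (C := 1) (by simp)
    (by simp) hF
  simpa using this
end basics
end KK
namespace KK
section weights
variable {E : Type*} [NormedAddCommGroup E] [NormedSpace ℝ E]
variable [MeasurableSpace E] [BorelSpace E] [FiniteDimensional ℝ E]
  {m : Measure E} [m.IsAddHaarMeasure]
def BM (c : E → ℝ) : Prop := Measurable c ∧ ∃ C, ∀ p, |c p| ≤ C
def Inv (c : E → ℝ) (e : E) : Prop := ∀ p (s : ℝ), c (p + s • e) = c p
theorem BM.int {c u : E → ℝ} (hc : BM c) (hu : Cc u) : Integrable (fun p => c p * u p) m := by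
  obtain ⟨h, C, hC⟩ := hc
  exact integrable_bdd_mul hu.integrable h hC
theorem BM.int_dd {c F : E → ℝ} {e : E} (hc : BM c) (hi : Inv c e) (hF : Cc F) :
    ∫ p, c p * Dd e F p ∂m = 0 := by
  obtain ⟨h, C, hC⟩ := hc
  exact int_weight_dd h hC hi hF
theorem BM.int_div2 {c F H : E → ℝ} {e f : E} (hc : BM c) (hi : Inv c e) (hi' : Inv c f)
    (hF : Cc F) (hH : Cc H) (s : ℝ) :
    ∫ p, c p * (Dd e F p - s * Dd f H p) ∂m = 0 := by
  have h1 := hc.int_dd (m := m) hi hF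
  have h2 := hc.int_dd (m := m) hi' hH
  have e1 : ∀ p, c p * (Dd e F p - s * Dd f H p) = c p * Dd e F p - s * (c p * Dd f H p) := by
    intro p; ring
  simp_rw [e1]
  rw [integral_sub (hc.int (hF.dd e)) ((hc.int (hH.dd f)).const_mul s), integral_const_mul, h1, h2]
  simp
theorem quad {c u : E → ℝ} {ej ek el : E} (hc : BM c) (hk : Inv c ek) (hl : Inv c el) (hu : Cc u) :
    ∫ p, c p * (Dd ej (Dd ek u) p * Dd el (Dd el u) p - Dd ej (Dd el u) p * Dd ek (Dd el u) p) ∂m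
      = 0 := by
  have hjk := (hu.dd ek).dd ej
  have hjl := (hu.dd el).dd ej
  have hl' := hu.dd el
  have := hc.int_div2 (m := m) hl hk (hjk.mul_right hl'.sm) (hjl.mul_right hl'.sm) 1
  rw [← this]
  congr 1; funext p
  rw [dd_mul hjk.sm hl'.sm, dd_mul hjl.sm hl'.sm]
  have : Dd el (Dd ej (Dd ek u)) = Dd ek (Dd ej (Dd el u)) := by
    rw [dd_comm (hu.dd ek).sm el ej, dd_comm hu.sm el ek, dd_comm (hu.dd el).sm ej ek]
  rw [this]; ring
theorem quad_t {c u : E → ℝ} {et el : E} (hc : BM c) (hk : Inv c et) (hl : Inv c el) (hu : Cc u) :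
    ∫ p, c p * (Dd et u p * Dd el (Dd el u) p) ∂m = 0 := by
  have ht := hu.dd et
  have hl' := hu.dd el
  have := hc.int_div2 (m := m) hl hk (ht.mul_right hl'.sm) (hl'.mul_right hl'.sm) (1/2)
  rw [← this]
  congr 1; funext p
  rw [dd_mul ht.sm hl'.sm, dd_mul hl'.sm hl'.sm, dd_comm hu.sm el et]
  ring
end weights
abbrev G (n : ℕ) := ℝ × (Fi n → ℝ)
notation:max "Fu" x:max => KK.G x → ℝ
notation:max "Bl" x:max => Metric.ball (0 : KK.G x)
instance volHaar (m : ℕ) : (volume : Measure (ℝ × (Fin m → ℝ))).IsAddHaarMeasure :=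
  inferInstanceAs ((volume : Measure ℝ).prod (volume : Measure (Fin m → ℝ))).IsAddHaarMeasure
def et {n : ℕ} : G n := (1, 0)
def ex {n : ℕ} (j : Fi n) : G n := (0, Pi.single j 1)
structure Ell {n : ℕ} (δ : ℝ) (b : ℝ → Mx n) : Prop where
  meas : ∀ j k, Measurable fun s => b s j k
  symm : ∀ s j k, b s j k = b s k j
  low : ∀ s (θ : Fi n → ℝ), δ * ∑ j, (θ j) ^ 2 ≤ ∑ j, ∑ k, b s j k * θ j * θ k
  upp : ∀ s (θ : Fi n → ℝ), ∑ j, ∑ k, b s j k * θ j * θ k ≤ δ⁻¹ * ∑ j, (θ j) ^ 2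
noncomputable def Lb {n : ℕ} (σ : ℝ) (b : ℝ → Mx n) (u : Fu n) :
    Fu n := fun p => σ * pdt u p + ∑ j, ∑ k, b (p.2 0) j k * pdxx j k u p
theorem pdt_eq {n : ℕ} (u : Fu n) : pdt u = Dd et u := rfl
theorem pdxx_eq {n : ℕ} (j k : Fi n) (u : Fu n) : pdxx j k u = Dd (ex j) (Dd (ex k) u) := rfl
theorem mat_bounds {n : ℕ} {δ : ℝ} (hδ : 0 < δ) {A : Mx n}
    (hs : ∀ j k, A j k = A k j)
    (h : ∀ (θ : Fi n → ℝ), δ * ∑ j, (θ j) ^ 2 ≤ ∑ j, ∑ k, A j k * θ j * θ k ∧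
      ∑ j, ∑ k, A j k * θ j * θ k ≤ δ⁻¹ * ∑ j, (θ j) ^ 2) :
    (∀ j, δ ≤ A j j ∧ A j j ≤ δ⁻¹) ∧ ∀ j k, |A j k| ≤ δ⁻¹ := by
  have h1 : ∀ j, δ ≤ A j j ∧ A j j ≤ δ⁻¹ := by
    intro j
    have := h (Pi.single j 1)
    simpa [Pi.single_apply] using this
  refine ⟨h1, ?_⟩
  intro j k
  by_cases hjk : j = k
  · subst hjk
    rw [abs_of_pos (lt_of_lt_of_le hδ (h1 j).1)]; exact (h1 j).2
  have e : ∀ s : ℝ, ∑ j', ∑ k', A j' k' * (Pi.single j 1 + Pi.single k s : Fi n → ℝ) j' *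
      (Pi.single j 1 + Pi.single k s : Fi n → ℝ) k' =
      A j j + 2 * s * A j k + s ^ 2 * A k k := by
    intro s
    simp [Pi.single_apply, mul_add, add_mul, Finset.sum_add_distrib]
    rw [hs k j]; ring
  have e2 : ∀ s : ℝ, ∑ j', ((Pi.single j 1 + Pi.single k s : Fi n → ℝ) j') ^ 2 = 1 + s ^ 2 := by
    intro s
    simp [Pi.single_apply, add_sq, Finset.sum_add_distrib, Ne.symm hjk]
  have a := (h (Pi.single j 1 + Pi.single k 1)).2
  have b := (h (Pi.single j 1 + Pi.single k (-1))).2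
  rw [e, e2] at a b
  have := (h1 j).1
  have := (h1 k).1
  rw [abs_le]; constructor <;> nlinarith
section Ell
variable {n : ℕ} {δ : ℝ} {b : ℝ → Mx n}
theorem Ell.diag (hδ : 0 < δ) (hb : Ell δ b) (s : ℝ) (j : Fi n) : δ ≤ b s j j ∧ b s j j ≤ δ⁻¹ :=
  (mat_bounds hδ (hb.symm s) (fun θ => ⟨hb.low s θ, hb.upp s θ⟩)).1 j
theorem Ell.abs (hδ : 0 < δ) (hb : Ell δ b) (s : ℝ) (j k : Fi n) : |b s j k| ≤ δ⁻¹ :=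
  (mat_bounds hδ (hb.symm s) (fun θ => ⟨hb.low s θ, hb.upp s θ⟩)).2 j k
theorem meas_x0 : Measurable (fun p : G n => p.2 0) :=
  (measurable_pi_apply 0).comp measurable_snd
noncomputable def wt (b : ℝ → Mx n) (j k : Fi n) : Fu n :=
  fun p => b (p.2 0) j k / b (p.2 0) 0 0
noncomputable def wi (b : ℝ → Mx n) : Fu n :=
  fun p => 1 / b (p.2 0) 0 0
theorem wt_abs (hδ : 0 < δ) (hb : Ell δ b) (j k) (p : G n) : |wt b j k p| ≤ δ⁻¹ ^ 2 := by
  unfold wt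
  rw [abs_div, div_eq_mul_inv, sq]
  have h1 := hb.abs hδ (p.2 0) j k
  have h2 := (hb.diag hδ (p.2 0) 0).1
  have h3 : |b (p.2 0) 0 0|⁻¹ ≤ δ⁻¹ := by
    rw [abs_of_pos (lt_of_lt_of_le hδ h2)]
    exact inv_anti₀ hδ h2
  gcongr
theorem wi_bd (hδ : 0 < δ) (hb : Ell δ b) (p : G n) : δ ≤ wi b p ∧ wi b p ≤ δ⁻¹ := by
  unfold wi
  have h2 := (hb.diag hδ (p.2 0) 0)
  have h0 : 0 < b (p.2 0) 0 0 := lt_of_lt_of_le hδ h2.1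
  constructor
  · rw [le_div_iff₀ h0]
    calc δ * b (p.2 0) 0 0 ≤ δ * δ⁻¹ := by gcongr; exact h2.2
      _ = 1 := by field_simp
  · rw [one_div]; exact inv_anti₀ hδ h2.1
theorem wt_BM (hδ : 0 < δ) (hb : Ell δ b) (j k) : BM (wt b j k : Fu n) :=
  ⟨((hb.meas j k).comp meas_x0).div ((hb.meas 0 0).comp meas_x0), _, wt_abs hδ hb j k⟩
theorem wi_BM (hδ : 0 < δ) (hb : Ell δ b) : BM (wi b : Fu n) :=
  ⟨measurable_const.div ((hb.meas 0 0).comp meas_x0), δ⁻¹, fun p => by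
    have := wi_bd hδ hb p
    rw [abs_of_pos (lt_of_lt_of_le hδ this.1)]; exact this.2⟩
theorem inv_x0 (c : ℝ → ℝ) {e : G n} (he : e.2 0 = 0) : Inv (fun p : G n => c (p.2 0)) e := by
  intro p s; simp [he]
theorem wt_inv (j k) {e : G n} (he : e.2 0 = 0) : Inv (wt b j k) e :=
  inv_x0 (fun s => b s j k / b s 0 0) he
theorem wi_inv {e : G n} (he : e.2 0 = 0) : Inv (wi b) e := inv_x0 (fun s => 1 / b s 0 0) he
theorem wt_00 (hδ : 0 < δ) (hb : Ell δ b) : (wt b 0 0 : Fu n) = fun _ => 1 := by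
  funext p; unfold wt
  exact div_self (lt_of_lt_of_le hδ (hb.diag hδ (p.2 0) 0).1).ne'
@[simp] theorem et_0 : (et : G n).2 0 = 0 := by simp [et]
theorem ex_0 {j : Fi n} (hj : j ≠ 0) : (ex j : G n).2 0 = 0 := by simp [ex, hj.symm]
theorem inv_const (c : ℝ) (e : G n) : Inv (fun _ : G n => c) e := fun _ _ => rfl
theorem wt_inv_or (hδ : 0 < δ) (hb : Ell δ b) (j k : Fi n) :
    Inv (wt b j k) (ex k : G n) ∨ Inv (wt b j k) (ex j : G n) := by
  by_cases hk : k = 0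
  · by_cases hj : j = 0
    · subst hk; subst hj; left; rw [wt_00 hδ hb]; exact inv_const _ _
    · right; exact wt_inv _ _ (ex_0 hj)
  · left; exact wt_inv _ _ (ex_0 hk)
theorem wi_mul_Lb (σ : ℝ) (u : Fu n) (p : G n) :
    wi b p * Lb σ b u p = σ * (wi b p * pdt u p) + ∑ j, ∑ k, wt b j k p * pdxx j k u p := by
  unfold wi wt Lb
  rw [mul_add, Finset.mul_sum]
  congr 1
  · ring
  · refine SC fun j _ => ?_
    rw [Finset.mul_sum]
    refine SC fun k _ => ?_
    ring
theorem wt_low (hδ : 0 < δ) (hb : Ell δ b) (p : G n) (θ : Fi n → ℝ) :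
    δ ^ 2 * ∑ j, θ j ^ 2 ≤ ∑ j, ∑ k, wt b j k p * (θ j * θ k) := by
  have h1 := hb.low (p.2 0) θ
  have h2 := (wi_bd hδ hb p).1
  have e : ∑ j, ∑ k, wt b j k p * (θ j * θ k) = wi b p * ∑ j, ∑ k, b (p.2 0) j k * θ j * θ k := by
    simp_rw [Finset.mul_sum]
    refine SC fun j _ => SC fun k _ => ?_
    unfold wt wi; ring
  rw [e]
  have : 0 ≤ ∑ j, θ j ^ 2 := SN fun _ _ => sq_nonneg _
  calc δ ^ 2 * ∑ j, θ j ^ 2 = δ * (δ * ∑ j, θ j ^ 2) := by ring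
    _ ≤ wi b p * (δ * ∑ j, θ j ^ 2) := by gcongr
    _ ≤ _ := by
      have : 0 ≤ wi b p := hδ.le.trans h2
      gcongr
theorem quad_jk (hδ : 0 < δ) (hb : Ell δ b) (j k l : Fi n) (hl : l ≠ 0) {u : Fu n}
    (hu : Cc u) :
    ∫ p, wt b j k p * (pdxx j k u p * pdxx l l u p - pdxx j l u p * pdxx k l u p) = 0 := by
  simp only [pdxx_eq]
  rcases wt_inv_or hδ hb j k with h | h
  · exact quad (wt_BM hδ hb j k) h (wt_inv _ _ (ex_0 hl)) hu
  · have := quad (m := volume) (ej := ex k) (wt_BM hδ hb j k) h (wt_inv _ _ (ex_0 hl)) hu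
    rw [← this]
    congr 1; funext p
    rw [dd_comm hu.sm (ex j) (ex k)]
    ring
end Ell
end KK
namespace KK
section BC
variable {E : Type*} [NormedAddCommGroup E] [NormedSpace ℝ E]
variable [MeasurableSpace E] [BorelSpace E] [FiniteDimensional ℝ E]
  {m : Measure E} [m.IsAddHaarMeasure]
def BC (f : E → ℝ) : Prop := BM f ∧ HasCompactSupport f
theorem Cc.bc {u : E → ℝ} (h : Cc u) : BC u := by
  refine ⟨⟨h.sm.cont.measurable, ?_⟩, h.2⟩
  obtain ⟨C, hC⟩ := h.2.exists_bound_of_continuous h.sm.cont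
  exact ⟨C, hC⟩
theorem BM.add {f g : E → ℝ} (hf : BM f) (hg : BM g) : BM (fun p => f p + g p) := by
  obtain ⟨h1, C, hC⟩ := hf
  obtain ⟨h2, D, hD⟩ := hg
  exact ⟨h1.add h2, C + D, fun p => (abs_add_le _ _).trans (add_le_add (hC p) (hD p))⟩
theorem BM.mul {f g : E → ℝ} (hf : BM f) (hg : BM g) : BM (fun p => f p * g p) := by
  obtain ⟨h1, C, hC⟩ := hf
  obtain ⟨h2, D, hD⟩ := hg
  refine ⟨h1.mul h2, C * D, fun p => ?_⟩
  rw [abs_mul]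
  exact mul_le_mul (hC p) (hD p) (abs_nonneg _) ((abs_nonneg _).trans (hC p))
theorem BM.const (c : ℝ) : BM (fun _ : E => c) := ⟨measurable_const, |c|, fun _ => le_rfl⟩
theorem BC.add {f g : E → ℝ} (hf : BC f) (hg : BC g) : BC (fun p => f p + g p) :=
  ⟨hf.1.add hg.1, hf.2.add hg.2⟩
theorem BM.mulBC {f g : E → ℝ} (hf : BM f) (hg : BC g) : BC (fun p => f p * g p) :=
  ⟨hf.mul hg.1, hg.2.mul_left⟩
theorem BC.mul {f g : E → ℝ} (hf : BC f) (hg : BC g) : BC (fun p => f p * g p) := hf.1.mulBC hg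
theorem BC.cmul {g : E → ℝ} (hg : BC g) (c : ℝ) : BC (fun p => c * g p) := (BM.const c).mulBC hg
theorem BC.sub {f g : E → ℝ} (hf : BC f) (hg : BC g) : BC (fun p => f p - g p) := by
  have := hf.add (hg.cmul (-1))
  simpa [sub_eq_add_neg] using this
theorem BC.sq {f : E → ℝ} (hf : BC f) : BC (fun p => f p ^ 2) := by
  have := hf.mul hf
  simpa [_root_.sq] using this
theorem BC.abs {f : E → ℝ} (hf : BC f) : BC (fun p => |f p|) := by
  obtain ⟨⟨h1, C, hC⟩, h2⟩ := hf
  refine ⟨⟨?_, C, fun p => by rw [abs_abs]; exact hC p⟩, h2.comp_left (g := fun x : ℝ => |x|) (by simp)⟩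
  exact continuous_abs.measurable.comp h1
theorem BC.zero : BC (fun _ : E => (0:ℝ)) := ⟨BM.const 0, HasCompactSupport.zero⟩
theorem BC.sum {ι : Type*} (s : Finset ι) {f : ι → E → ℝ} (hf : ∀ i, BC (f i)) :
    BC (fun p => ∑ i ∈ s, f i p) := by
  classical
  induction s using Finset.induction_on with
  | empty => simpa using BC.zero
  | insert a s ha ih => simp_rw [Finset.sum_insert ha]; exact (hf a).add ih
theorem BC.integrable {f : E → ℝ} (hf : BC f) : Integrable f m := by
  obtain ⟨⟨h1, C, hC⟩, h2⟩ := hf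
  have hs : IntegrableOn f (tsupport f) m :=
    Measure.integrableOn_of_bounded (M := C) h2.isCompact.measure_lt_top.ne h1.aestronglyMeasurable
      (evf hC)
  exact (integrableOn_iff_integrable_of_support_subset (subset_tsupport f)).1 hs
end BC
section B1
variable {n : ℕ} {δ : ℝ} {b : ℝ → Mx n}
theorem coef_BM (hδ : 0 < δ) (hb : Ell δ b) (j k) : BM (fun p : G n => b (p.2 0) j k) :=
  ⟨(hb.meas j k).comp meas_x0, _, fun p => hb.abs hδ (p.2 0) j k⟩
theorem Cc.pdt {u : Fu n} (hu : Cc u) : Cc (pdt u) := hu.dd et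
theorem Cc.pdxx {u : Fu n} (hu : Cc u) (j k) : Cc (pdxx j k u) := (hu.dd (ex k)).dd (ex j)
theorem Sm.pdt {u : Fu n} (hu : Sm u) : Sm (pdt u) := hu.dd et
theorem Sm.pdxx {u : Fu n} (hu : Sm u) (j k) : Sm (pdxx j k u) := (hu.dd (ex k)).dd (ex j)
theorem Lb_BC (hδ : 0 < δ) (hb : Ell δ b) (σ : ℝ) {u : Fu n} (hu : Cc u) : BC (Lb σ b u) :=
  (hu.pdt.bc.cmul σ).add (BC.sum _ fun j => BC.sum _ fun k => (coef_BM hδ hb j k).mulBC (hu.pdxx j k).bc)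
theorem pdxx_comm {u : Fu n} (hu : Sm u) (j k) : pdxx j k u = pdxx k j u := dd_comm hu _ _
theorem B1_step1 (hδ : 0 < δ) (hb : Ell δ b) {u : Fu n} (hu : Cc u) (l : Fi n) (hl : l ≠ 0)
    (j : Fi n) :
    ∫ p, pdxx j l u p ^ 2 ≤ δ⁻¹ ^ 6 * ∫ p, Lb 1 b u p ^ 2 := by
  set f := Lb 1 b u with hf
  have hfB : BC f := Lb_BC hδ hb 1 hu
  have hX : ∀ j k, BC (pdxx j k u) := fun j k => (hu.pdxx j k).bc
  have hQ : BC (fun p => ∑ j, ∑ k, wt b j k p * (pdxx j l u p * pdxx k l u p)) :=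
    BC.sum _ fun j => BC.sum _ fun k => (wt_BM hδ hb j k).mulBC ((hX _ _).mul (hX _ _))
  have hR : BC (fun p => wi b p * (f p * pdxx l l u p)) := (wi_BM hδ hb).mulBC (hfB.mul (hX _ _))
  have key : ∫ p, (wi b p * (f p * pdxx l l u p) -
      ∑ j, ∑ k, wt b j k p * (pdxx j l u p * pdxx k l u p)) = 0 := by
    have e : ∀ p, wi b p * (f p * pdxx l l u p) -
      ∑ j, ∑ k, wt b j k p * (pdxx j l u p * pdxx k l u p) =
      wi b p * (pdt u p * pdxx l l u p) +
      ∑ j, ∑ k, wt b j k p * (pdxx j k u p * pdxx l l u p - pdxx j l u p * pdxx k l u p) := by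
      intro p
      have := wi_mul_Lb (b := b) 1 u p
      rw [← mul_assoc, hf, this, add_mul, Finset.sum_mul]
      simp_rw [Finset.sum_mul, mul_sub, Finset.sum_sub_distrib]
      ring_nf
    simp_rw [e]
    have hZ : ∀ j k, BC (fun p => wt b j k p * (pdxx j k u p * pdxx l l u p - pdxx j l u p * pdxx k l u p)) :=
      fun j k => (wt_BM hδ hb j k).mulBC (((hX _ _).mul (hX _ _)).sub ((hX _ _).mul (hX _ _)))
    rw [integral_add ((wi_BM hδ hb).mulBC (hu.pdt.bc.mul (hX _ _))).integrable
      (BC.sum _ fun j => BC.sum _ fun k => hZ j k).integrable]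
    rw [integral_finsetSum _ fun j _ => (BC.sum _ fun k => hZ j k).integrable]
    have h0 : ∫ p, wi b p * (pdt u p * pdxx l l u p) = 0 :=
      quad_t (wi_BM hδ hb) (wi_inv et_0) (wi_inv (ex_0 hl)) hu
    rw [h0, zero_add]
    refine Finset.sum_eq_zero fun j _ => ?_
    rw [integral_finsetSum _ fun k _ => (hZ j k).integrable]
    exact Finset.sum_eq_zero fun k _ => quad_jk hδ hb j k l hl hu
  have hpt : ∀ p, δ ^ 2 / 2 * pdxx j l u p ^ 2 - δ⁻¹ ^ 4 / 2 * f p ^ 2 ≤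
      - (wi b p * (f p * pdxx l l u p) -
      ∑ j, ∑ k, wt b j k p * (pdxx j l u p * pdxx k l u p)) := by
    intro p
    have h1 := wt_low hδ hb p (fun j => pdxx j l u p)
    have h2 := wi_bd hδ hb p
    set S := ∑ j, pdxx j l u p ^ 2 with hS
    have hj : pdxx j l u p ^ 2 ≤ S := Finset.single_le_sum (f := fun j => pdxx j l u p ^ 2)
      (fun _ _ => sq_nonneg _) (Finset.mem_univ j)
    have hl' : pdxx l l u p ^ 2 ≤ S := Finset.single_le_sum (f := fun j => pdxx j l u p ^ 2)
      (fun _ _ => sq_nonneg _) (Finset.mem_univ l)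
    have h3 : wi b p * (f p * pdxx l l u p) ≤ δ ^ 2 / 2 * pdxx l l u p ^ 2 + δ⁻¹ ^ 4 / 2 * f p ^ 2 := by
      have a1 : wi b p * (f p * pdxx l l u p) ≤ δ⁻¹ * |f p * pdxx l l u p| := by
        calc wi b p * (f p * pdxx l l u p) ≤ wi b p * |f p * pdxx l l u p| := by
              have : 0 ≤ wi b p := hδ.le.trans h2.1
              gcongr; exact le_abs_self _
          _ ≤ _ := by gcongr; exact h2.2
      have a2 : δ⁻¹ * |f p * pdxx l l u p| = (δ * |pdxx l l u p|) * (δ⁻¹ ^ 2 * |f p|) := by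
        rw [abs_mul]; field_simp
      have a3 : (δ * |pdxx l l u p|) ^ 2 = δ ^ 2 * pdxx l l u p ^ 2 := by rw [mul_pow, sq_abs]
      have a4 : (δ⁻¹ ^ 2 * |f p|) ^ 2 = δ⁻¹ ^ 4 * f p ^ 2 := by rw [mul_pow, sq_abs]; ring
      nlinarith [sq_nonneg (δ * |pdxx l l u p| - δ⁻¹ ^ 2 * |f p|)]
    have : 0 < δ ^ 2 := by positivity
    nlinarith
  have hI := integral_mono (μ := volume) (((hX j l).sq.cmul (δ ^ 2 / 2)).sub (hfB.sq.cmul (δ⁻¹ ^ 4 / 2))).integrable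
    ((hR.sub hQ).integrable.neg) hpt
  simp only [Pi.neg_apply] at hI
  rw [integral_neg, key, neg_zero, integral_sub ((hX j l).sq.cmul (δ ^ 2 / 2)).integrable
    (hfB.sq.cmul (δ⁻¹ ^ 4 / 2)).integrable, integral_const_mul, integral_const_mul] at hI
  set A := ∫ p, pdxx j l u p ^ 2
  set B := ∫ p, f p ^ 2
  have : A = 2 * δ⁻¹ ^ 2 * (δ ^ 2 / 2 * A) := by field_simp
  rw [this]
  calc 2 * δ⁻¹ ^ 2 * (δ ^ 2 / 2 * A) ≤ 2 * δ⁻¹ ^ 2 * (δ⁻¹ ^ 4 / 2 * B) := by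
        refine mll (by linarith) (by positivity)
    _ = _ := by ring
theorem B1_step1' (hδ : 0 < δ) (hb : Ell δ b) {u : Fu n} (hu : Cc u) (q : Fi n × Fi n)
    (hq : q ≠ (0, 0)) :
    ∫ p, pdxx q.1 q.2 u p ^ 2 ≤ δ⁻¹ ^ 6 * ∫ p, Lb 1 b u p ^ 2 := by
  by_cases h : q.2 = 0
  · have : q.1 ≠ 0 := fun h' => hq (Prod.ext h' h)
    rw [pdxx_comm hu.sm]; exact B1_step1 hδ hb hu _ this _
  · exact B1_step1 hδ hb hu _ h _
theorem B1 (n : ℕ) {δ : ℝ} (hδ : 0 < δ) : ∃ N : ℝ, 0 < N ∧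
    ∀ b : ℝ → Mx n, Ell δ b → ∀ u : Fu n, Cc u →
      (∫ p, pdt u p ^ 2 ≤ N * ∫ p, Lb 1 b u p ^ 2) ∧
      ∀ j k, ∫ p, pdxx j k u p ^ 2 ≤ N * ∫ p, Lb 1 b u p ^ 2 := by
  classical
  set I := (Finset.univ : Finset (Fi n × Fi n)).erase (0,0) with hI
  set K : ℝ := (I.card : ℝ) * δ⁻¹ ^ 4 * (I.card * δ⁻¹ ^ 6) with hK
  have hK0 : 0 ≤ K := by positivity
  set N1 : ℝ := 2 * δ⁻¹ * (δ⁻¹ ^ 3 + δ⁻¹ * K) with hN1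
  set N2 : ℝ := 3 * (δ⁻¹ ^ 2 + δ⁻¹ ^ 2 * N1 + K) with hN2
  have hδi : 0 < δ⁻¹ := inv_pos.2 hδ
  refine ⟨N1 + N2 + δ⁻¹ ^ 6, by positivity, ?_⟩
  intro b hb u hu
  set f := Lb 1 b u with hf
  have hfB : BC f := Lb_BC hδ hb 1 hu
  have hX : ∀ j k, BC (pdxx j k u) := fun j k => (hu.pdxx j k).bc
  set rest : Fu n := fun p => ∑ q ∈ I, wt b q.1 q.2 p * pdxx q.1 q.2 u p with hrest
  have hrB : BC rest := BC.sum _ fun q => (wt_BM hδ hb q.1 q.2).mulBC (hX _ _)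
  have hF0 : 0 ≤ ∫ p, f p ^ 2 := integral_nonneg fun _ => sq_nonneg _
  have heq : ∀ p, wi b p * f p = wi b p * pdt u p + pdxx 0 0 u p + rest p := by
    intro p
    have h1 := wi_mul_Lb (b := b) 1 u p
    rw [hf, h1, one_mul, add_assoc]
    congr 1
    rw [← Finset.sum_product', Finset.univ_product_univ, ← Finset.add_sum_erase _ _ (Finset.mem_univ (0,0))]
    rw [wt_00 hδ hb, one_mul]
  have hrI : ∫ p, rest p ^ 2 ≤ K * ∫ p, f p ^ 2 := by
    have hpt : ∀ p, rest p ^ 2 ≤ (I.card : ℝ) * δ⁻¹ ^ 4 * ∑ q ∈ I, pdxx q.1 q.2 u p ^ 2 := by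
      intro p
      refine (Finset.sum_mul_sq_le_sq_mul_sq I _ _).trans ?_
      have : ∑ q ∈ I, wt b q.1 q.2 p ^ 2 ≤ (I.card : ℝ) * δ⁻¹ ^ 4 := by
        rw [← nsmul_eq_mul]
        refine Finset.sum_le_card_nsmul _ _ _ fun q _ => ?_
        have := wt_abs hδ hb q.1 q.2 p
        rw [← sq_abs]
        calc |wt b q.1 q.2 p| ^ 2 ≤ (δ⁻¹ ^ 2) ^ 2 := by gcongr
          _ = _ := by ring
      have h0 : 0 ≤ ∑ q ∈ I, pdxx q.1 q.2 u p ^ 2 := SN fun _ _ => sq_nonneg _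
      exact mlr this h0
    have := integral_mono (μ := volume) hrB.sq.integrable
      ((BC.sum I fun q => (hX q.1 q.2).sq).cmul _).integrable hpt
    refine this.trans ?_
    rw [integral_const_mul, integral_finsetSum _ fun q _ => (hX q.1 q.2).sq.integrable, hK, mul_assoc (_ * _)]
    gcongr
    rw [mul_assoc, ← nsmul_eq_mul]
    refine Finset.sum_le_card_nsmul _ _ _ fun q hq => ?_
    exact B1_step1' hδ hb hu q (Finset.ne_of_mem_erase hq)
  have hz : ∫ p, pdxx 0 0 u p * pdt u p = 0 := by
    have := quad_t (m := volume) (c := fun _ : G n => 1) (et := et) (el := ex 0) (BM.const 1) (inv_const _ _) (inv_const _ _) hu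
    rw [← this]; congr 1; funext p; simp only [pdxx_eq, pdt_eq]; ring
  have hT : ∫ p, pdt u p ^ 2 ≤ N1 * ∫ p, f p ^ 2 := by
    have hpt : ∀ p, δ / 2 * pdt u p ^ 2 ≤ (δ⁻¹ ^ 3 * f p ^ 2 + δ⁻¹ * rest p ^ 2) - pdxx 0 0 u p * pdt u p := by
      intro p
      have h1 := heq p
      have h2 := wi_bd hδ hb p
      have h3 : δ * pdt u p ^ 2 ≤ wi b p * f p * pdt u p - rest p * pdt u p - pdxx 0 0 u p * pdt u p := by
        have : wi b p * f p * pdt u p - rest p * pdt u p - pdxx 0 0 u p * pdt u p = wi b p * pdt u p ^ 2 := by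
          rw [h1]; ring
        rw [this]; nlinarith [sq_nonneg (pdt u p)]
      have key : ∀ X Y : ℝ, X * Y ≤ δ / 4 * Y ^ 2 + δ⁻¹ * X ^ 2 := by
        intro X Y
        have e1 : (δ / 4 * Y ^ 2 + δ⁻¹ * X ^ 2) - X * Y = δ⁻¹ * (δ / 2 * Y - X) ^ 2 := by
          field_simp; ring
        have : 0 ≤ δ⁻¹ * (δ / 2 * Y - X) ^ 2 := by positivity
        linarith
      have k1 := key (wi b p * f p) (pdt u p)
      have k2 := key (-rest p) (pdt u p)
      have k3 : (wi b p * f p) ^ 2 ≤ δ⁻¹ ^ 2 * f p ^ 2 := by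
        rw [mul_pow]; gcongr
        · exact hδ.le.trans h2.1
        · exact h2.2
      have k4 : δ⁻¹ * (wi b p * f p) ^ 2 ≤ δ⁻¹ ^ 3 * f p ^ 2 := by
        calc δ⁻¹ * (wi b p * f p) ^ 2 ≤ δ⁻¹ * (δ⁻¹ ^ 2 * f p ^ 2) := by gcongr
          _ = _ := by ring
      have k5 : (-rest p) ^ 2 = rest p ^ 2 := by ring
      rw [k5] at k2
      linarith
    have i1 := (hfB.sq.cmul (δ⁻¹ ^ 3)).integrable (m := volume)
    have i2 := (hrB.sq.cmul (δ⁻¹)).integrable (m := volume)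
    have hI := integral_mono (μ := volume) (hu.pdt.bc.sq.cmul (δ / 2)).integrable
      ((i1.add i2).sub ((hX 0 0).mul hu.pdt.bc).integrable) hpt
    simp only [Pi.add_apply, Pi.sub_apply] at hI
    have e1 := integral_sub (i1.add i2) ((hX 0 0).mul hu.pdt.bc).integrable
    simp only [Pi.add_apply] at e1
    rw [e1, hz, sub_zero, integral_add i1 i2, integral_const_mul, integral_const_mul, integral_const_mul] at hI
    set A := ∫ p, pdt u p ^ 2
    have : A = 2 * δ⁻¹ * (δ / 2 * A) := by field_simp
    rw [this]
    calc 2 * δ⁻¹ * (δ / 2 * A) ≤ 2 * δ⁻¹ * (δ⁻¹ ^ 3 * (∫ p, f p ^ 2) + δ⁻¹ * (K * ∫ p, f p ^ 2)) := by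
          refine mll (hI.trans ?_) (by positivity)
          gcongr
      _ = _ := by rw [hN1]; ring
  have hS : ∫ p, pdxx 0 0 u p ^ 2 ≤ N2 * ∫ p, f p ^ 2 := by
    have hpt : ∀ p, pdxx 0 0 u p ^ 2 ≤ (3 * δ⁻¹ ^ 2 * f p ^ 2 + 3 * δ⁻¹ ^ 2 * pdt u p ^ 2) + 3 * rest p ^ 2 := by
      intro p
      have h1 := heq p
      have h2 := wi_bd hδ hb p
      have e : pdxx 0 0 u p = wi b p * f p - wi b p * pdt u p - rest p := by linarith
      have k3 : ∀ X : ℝ, (wi b p * X) ^ 2 ≤ δ⁻¹ ^ 2 * X ^ 2 := by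
        intro X
        rw [mul_pow]; gcongr
        · exact hδ.le.trans h2.1
        · exact h2.2
      have a := k3 (f p)
      have c := k3 (pdt u p)
      rw [e]
      nlinarith [sq_nonneg (wi b p * f p + wi b p * pdt u p), sq_nonneg (wi b p * f p + rest p),
        sq_nonneg (wi b p * pdt u p - rest p)]
    have i1 := (hfB.sq.cmul (3 * δ⁻¹ ^ 2)).integrable (m := volume)
    have i2 := (hu.pdt.bc.sq.cmul (3 * δ⁻¹ ^ 2)).integrable (m := volume)
    have i3 := (hrB.sq.cmul 3).integrable (m := volume)
    have hI := integral_mono (μ := volume) (hX 0 0).sq.integrable ((i1.add i2).add i3) hpt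
    simp only [Pi.add_apply] at hI
    have e1 := integral_add (i1.add i2) i3
    simp only [Pi.add_apply] at e1
    rw [e1, integral_add i1 i2, integral_const_mul, integral_const_mul, integral_const_mul] at hI
    refine hI.trans ?_
    rw [hN2]
    have : 3 * δ⁻¹ ^ 2 * ∫ p, pdt u p ^ 2 ≤ 3 * δ⁻¹ ^ 2 * (N1 * ∫ p, f p ^ 2) := by gcongr
    linarith
  have hN1p : 0 ≤ N1 := by positivity
  have hN2p : 0 ≤ N2 := by positivity
  refine ⟨hT.trans ?_, fun j k => ?_⟩
  · gcongr
    have : 0 ≤ δ⁻¹ ^ 6 := by positivity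
    linarith
  · by_cases hq : (j, k) = (0, 0)
    · have h1 : j = 0 := congrArg Prod.fst hq
      have h2 : k = 0 := congrArg Prod.snd hq
      subst h1; subst h2
      refine hS.trans ?_
      gcongr
      have : 0 ≤ δ⁻¹ ^ 6 := by positivity
      linarith
    · refine (B1_step1' hδ hb hu (j, k) hq).trans ?_
      gcongr
      linarith
end B1
end KK
namespace KK
section LM
variable {E : Type*} [NormedAddCommGroup E] [NormedSpace ℝ E]
variable [MeasurableSpace E] [BorelSpace E] [FiniteDimensional ℝ E]
  {m : Measure E} [m.IsAddHaarMeasure]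
theorem BC.mono {f g : E → ℝ} (hf : BC f) (hg : BC g) (h : ∀ p, f p ≤ g p) :
    ∫ p, f p ∂m ≤ ∫ p, g p ∂m := integral_mono hf.integrable hg.integrable h
theorem BC.int_add {f g : E → ℝ} (hf : BC f) (hg : BC g) :
    ∫ p, (f p + g p) ∂m = ∫ p, f p ∂m + ∫ p, g p ∂m := integral_add hf.integrable hg.integrable
theorem BC.int_sum {ι : Type*} (s : Finset ι) {f : ι → E → ℝ} (hf : ∀ i, BC (f i)) :
    ∫ p, ∑ i ∈ s, f i p ∂m = ∑ i ∈ s, ∫ p, f i p ∂m :=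
  integral_finsetSum _ fun i _ => (hf i).integrable
def LM (f : E → ℝ) : Prop := Measurable f ∧ ∀ r : ℝ, ∃ C : ℝ, ∀ p ∈ Metric.ball (0:E) r, |f p| ≤ C
theorem BM.lm {f : E → ℝ} (hf : BM f) : LM f := ⟨hf.1, fun _ => hf.2.imp fun C h p _ => h p⟩
theorem BC.lm {f : E → ℝ} (hf : BC f) : LM f := hf.1.lm
theorem cont_lm {f : E → ℝ} (hf : Continuous f) : LM f := by
  refine ⟨hf.measurable, fun r => ?_⟩
  obtain ⟨C, hC⟩ := (isCompact_closedBall (0:E) r).exists_bound_of_continuousOn hf.continuousOn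
  exact ⟨C, fun p hp => hC p (Metric.ball_subset_closedBall hp)⟩
theorem Sm.lm {f : E → ℝ} (hf : Sm f) : LM f := cont_lm hf.cont
theorem LM.add {f g : E → ℝ} (hf : LM f) (hg : LM g) : LM (fun p => f p + g p) := by
  refine ⟨hf.1.add hg.1, fun r => ?_⟩
  obtain ⟨C, hC⟩ := hf.2 r
  obtain ⟨D, hD⟩ := hg.2 r
  exact ⟨C + D, fun p hp => (abs_add_le _ _).trans (add_le_add (hC p hp) (hD p hp))⟩
theorem LM.mul {f g : E → ℝ} (hf : LM f) (hg : LM g) : LM (fun p => f p * g p) := by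
  refine ⟨hf.1.mul hg.1, fun r => ?_⟩
  obtain ⟨C, hC⟩ := hf.2 r
  obtain ⟨D, hD⟩ := hg.2 r
  refine ⟨C * D, fun p hp => ?_⟩
  rw [abs_mul]
  exact mul_le_mul (hC p hp) (hD p hp) (abs_nonneg _) ((abs_nonneg _).trans (hC p hp))
theorem LM.cmul {f : E → ℝ} (hf : LM f) (c : ℝ) : LM (fun p => c * f p) := (BM.const c).lm.mul hf
theorem LM.sub {f g : E → ℝ} (hf : LM f) (hg : LM g) : LM (fun p => f p - g p) := by
  have := hf.add (hg.cmul (-1))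
  simpa [sub_eq_add_neg] using this
theorem LM.sq {f : E → ℝ} (hf : LM f) : LM (fun p => f p ^ 2) := by
  have := hf.mul hf
  simpa [_root_.sq] using this
theorem LM.abs {f : E → ℝ} (hf : LM f) : LM (fun p => |f p|) := by
  refine ⟨continuous_abs.measurable.comp hf.1, fun r => (hf.2 r).imp fun C h p hp => ?_⟩
  rw [abs_abs]; exact h p hp
theorem LM.sum {ι : Type*} (s : Finset ι) {f : ι → E → ℝ} (hf : ∀ i, LM (f i)) :
    LM (fun p => ∑ i ∈ s, f i p) := by
  classical
  induction s using Finset.induction_on with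
  | empty => simpa using (BM.const (0:ℝ)).lm
  | insert a s ha ih => simp_rw [Finset.sum_insert ha]; exact (hf a).add ih
theorem BC.mulLM {f g : E → ℝ} (hf : BC f) (hg : LM g) : BC (fun p => f p * g p) := by
  obtain ⟨r, hr⟩ := hf.2.isCompact.isBounded.subset_ball (0:E)
  obtain ⟨⟨h1, C, hC⟩, h2⟩ := hf
  obtain ⟨D, hD⟩ := hg.2 r
  refine ⟨⟨h1.mul hg.1, |C| * |D|, fun p => ?_⟩, h2.mul_right⟩
  by_cases hp : p ∈ tsupport f
  · rw [abs_mul]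
    exact mul_le_mul ((hC p).trans (le_abs_self _)) ((hD p (hr hp)).trans (le_abs_self _)) (abs_nonneg _) (abs_nonneg _)
  · simp only [image_eq_zero_of_notMem_tsupport hp, zero_mul, abs_zero]; positivity
theorem LM.intOn {f : E → ℝ} (hf : LM f) (r : ℝ) : IntegrableOn f (Metric.ball 0 r) m := by
  obtain ⟨C, hC⟩ := hf.2 r
  refine Measure.integrableOn_of_bounded (M := C) measure_ball_lt_top.ne hf.1.aestronglyMeasurable ?_
  exact (ae_restrict_iff' measurableSet_ball).2 (evf hC)
end LM
section EE
variable {n : ℕ}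
noncomputable def EE (θ : ℝ) (f : Fu n) : ℝ := ∫ p in Bl n θ, f p ^ 2
theorem EE_nonneg (θ : ℝ) (f : Fu n) : 0 ≤ EE θ f := integral_nonneg fun _ => sq_nonneg _
theorem EE_mono {θ θ' : ℝ} (h : θ ≤ θ') {f : Fu n} (hf : LM f) : EE θ f ≤ EE θ' f :=
  setIntegral_mono_set (hf.sq.intOn _) (evf fun _ => sq_nonneg _)
    (evf (Metric.ball_subset_ball h))
theorem EE_le {θ : ℝ} {f g : Fu n} (hf : LM f) (hg : LM g)
    (h : ∀ p ∈ Bl n θ, f p ^ 2 ≤ g p) : EE θ f ≤ ∫ p in Bl n θ, g p :=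
  setIntegral_mono_on (hf.sq.intOn _) (hg.intOn _) measurableSet_ball h
theorem EE_congr {θ : ℝ} {f g : Fu n}
    (h : ∀ p ∈ Bl n θ, f p = g p) : EE θ f = EE θ g :=
  setIntegral_congr_fun measurableSet_ball fun p hp => by simp only [h p hp]
theorem EE_le_int {θ : ℝ} {f : Fu n} (hf : BC f) : EE θ f ≤ ∫ p, f p ^ 2 :=
  setIntegral_le_integral hf.sq.integrable (evf fun _ => sq_nonneg _)
theorem EE_cmul (θ c : ℝ) (f : Fu n) : EE θ (fun p => c * f p) = c ^ 2 * EE θ f := by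
  unfold EE; rw [← integral_const_mul]; congr 1; funext p; ring
theorem EE_add {θ : ℝ} {f g : Fu n} (hf : LM f) (hg : LM g) :
    EE θ (fun p => f p + g p) ≤ 2 * EE θ f + 2 * EE θ g := by
  unfold EE
  rw [← integral_const_mul, ← integral_const_mul, ← integral_add ((hf.sq.cmul 2).intOn _) ((hg.sq.cmul 2).intOn _)]
  refine setIntegral_mono_on ((hf.add hg).sq.intOn _) (((hf.sq.cmul 2).add (hg.sq.cmul 2)).intOn _) measurableSet_ball fun p _ => ?_
  nlinarith [sq_nonneg (f p - g p)]
theorem cutoff (n : ℕ) {θ1 θ2 : ℝ} (h1 : 0 < θ1) (h2 : θ1 < θ2) : ∃ χ : Fu n, Cc χ ∧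
    (∀ p ∈ Bl n θ1, χ p = 1) ∧ (∀ p, 0 ≤ χ p ∧ χ p ≤ 1) ∧
    tsupport χ ⊆ Metric.ball 0 θ2 := by
  let B : ContDiffBump (0 : G n) := ⟨θ1, (θ1 + θ2) / 2, h1, by linarith⟩
  refine ⟨B, ⟨B.contDiff, B.hasCompactSupport⟩, ?_, fun p => ⟨B.nonneg, B.le_one⟩, ?_⟩
  · intro p hp
    exact B.one_of_mem_closedBall (Metric.ball_subset_closedBall hp)
  · rw [B.tsupport_eq]
    exact Metric.closedBall_subset_ball (by show (θ1 + θ2) / 2 < θ2; linarith)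
theorem dd_tsupport {χ : Fu n} (e : G n) : tsupport (Dd e χ) ⊆ tsupport χ := by
  refine closure_minimal ?_ isClosed_closure
  intro p hp
  by_contra h
  apply hp
  have : fderiv ℝ χ p = 0 := by
    have := support_fderiv_subset ℝ (f := χ)
    by_contra h'
    exact h (this h')
  simp [Dd, this]
theorem dd_zero {χ : Fu n} {θ : ℝ} (h : tsupport χ ⊆ Metric.ball 0 θ) (e : G n) :
    tsupport (Dd e χ) ⊆ Metric.ball 0 θ := (dd_tsupport e).trans h
theorem zero_out {χ : Fu n} {θ : ℝ} (h : tsupport χ ⊆ Metric.ball 0 θ) (p : G n)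
    (hp : p ∉ Bl n θ) : χ p = 0 := image_eq_zero_of_notMem_tsupport fun h' => hp (h h')
theorem dd_congr {θ : ℝ} {f g : Fu n} (h : ∀ p ∈ Bl n θ, f p = g p) (e : G n) :
    ∀ p ∈ Bl n θ, Dd e f p = Dd e g p := by
  intro p hp
  unfold Dd
  have : f =ᶠ[nhds p] g := Filter.eventually_of_mem (Metric.isOpen_ball.mem_nhds hp) h
  rw [this.fderiv_eq]
theorem Lb_LM {δ : ℝ} {b : ℝ → Mx n} (hδ : 0 < δ) (hb : Ell δ b) (σ : ℝ) {u : Fu n} (hu : Sm u) : LM (Lb σ b u) :=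
  (hu.pdt.lm.cmul σ).add (LM.sum _ fun j => LM.sum _ fun k => (coef_BM hδ hb j k).lm.mul (hu.pdxx j k).lm)
end EE
section C1
variable {n : ℕ} {δ : ℝ} {b : ℝ → Mx n}
theorem C1_aux {w z χ : Fu n} (ej ek : G n) (hw : BM w) (hi : Inv w ek) (hz : Sm z) (hχ : Cc χ) :
    ∃ F : Fu n, BC F ∧ ∫ p, F p = 0 ∧ ∀ p, F p = w p * (Dd ej (Dd ek z) p * (χ p ^ 2 * z p))
      + w p * (χ p ^ 2 * (Dd ej z p * Dd ek z p)) + w p * (2 * χ p * z p * (Dd ej z p * Dd ek χ p)) := by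
  have hc : Cc (fun p => χ p * (χ p * z p * Dd ej z p)) := hχ.mul_right ((hχ.sm.mul hz).mul (hz.dd ej))
  refine ⟨fun p => w p * Dd ek (fun p => χ p * (χ p * z p * Dd ej z p)) p, hw.mulBC (hc.dd ek).bc,
    hw.int_dd hi hc, fun p => ?_⟩
  simp only
  rw [dd_mul hχ.sm ((hχ.sm.mul hz).mul (hz.dd ej)), dd_mul (hχ.sm.mul hz) (hz.dd ej), dd_mul hχ.sm hz,
    dd_comm hz ej ek]
  ring
set_option maxHeartbeats 1000000 in
theorem C1 (n : ℕ) {δ : ℝ} (hδ : 0 < δ) : ∃ N : ℝ, 0 < N ∧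
    ∀ b : ℝ → Mx n, Ell δ b → ∀ σ : ℝ, |σ| ≤ 1 →
    ∀ z : Fu n, Sm z → ∀ χ : Fu n, Cc χ →
      ∫ p, χ p ^ 2 * ∑ j, Dd (ex j) z p ^ 2 ≤ N * ∫ p, (χ p ^ 2 * (|Lb σ b z p| * |z p|) +
        z p ^ 2 * (∑ j, Dd (ex j) χ p ^ 2 + |χ p| * |Dd et χ p|)) := by
  have hδi : 0 < δ⁻¹ := inv_pos.2 hδ
  set c : ℝ := (n + 1) ^ 2 with hc
  have hcp : 0 < c := by positivity
  set C1 : ℝ := δ⁻¹ + 2 * c * δ⁻¹ ^ 6 * c with hC1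
  have hC1p : 0 < C1 := by positivity
  refine ⟨2 * δ⁻¹ ^ 2 * C1, by positivity, ?_⟩
  intro b hb σ hσ z hz χ hχ
  set S : Fu n := fun p => ∑ j, Dd (ex j) z p ^ 2 with hS
  set X : Fu n := fun p => ∑ j, Dd (ex j) χ p ^ 2 with hX
  have hSp : ∀ j p, Dd (ex j) z p ^ 2 ≤ S p := fun j p =>
    Finset.single_le_sum (f := fun j => Dd (ex j) z p ^ 2) (fun _ _ => sq_nonneg _) (Finset.mem_univ j)
  have hXp : ∀ j p, Dd (ex j) χ p ^ 2 ≤ X p := fun j p =>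
    Finset.single_le_sum (f := fun j => Dd (ex j) χ p ^ 2) (fun _ _ => sq_nonneg _) (Finset.mem_univ j)
  have hSB : LM S := LM.sum _ fun j => (hz.dd _).lm.sq
  have hXB : BC X := BC.sum _ fun j => (hχ.dd _).bc.sq
  have hcross : ∀ (w y x zz : ℝ) (ss xx : ℝ), |w| ≤ δ⁻¹ ^ 2 → y ^ 2 ≤ ss → x ^ 2 ≤ xx → ∀ q : ℝ,
      -(w * (2 * q * zz * (y * x))) ≤ δ ^ 2 / (2 * c) * (q ^ 2 * ss) + 2 * c * δ⁻¹ ^ 6 * (zz ^ 2 * xx) := by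
    intro w y x zz ss xx hw hy hx q
    have e1 : -(w * (2 * q * zz * (y * x))) ≤ δ⁻¹ ^ 2 * (2 * (|q| * |y|) * (|zz| * |x|)) := by
      calc _ ≤ |-(w * (2 * q * zz * (y * x)))| := le_abs_self _
        _ = |w| * (2 * (|q| * |y|) * (|zz| * |x|)) := by simp only [abs_neg, abs_mul, abs_two]; ring
        _ ≤ _ := by gcongr
    have e2 : (δ ^ 2 / (2 * c) * (|q| * |y|) ^ 2 + 2 * c * δ⁻¹ ^ 6 * (|zz| * |x|) ^ 2) -
        δ⁻¹ ^ 2 * (2 * (|q| * |y|) * (|zz| * |x|)) =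
        δ ^ 2 / (2 * c) * ((|q| * |y|) - 2 * c * δ⁻¹ ^ 4 * (|zz| * |x|)) ^ 2 := by
      field_simp; ring
    have e3 : 0 ≤ δ ^ 2 / (2 * c) * ((|q| * |y|) - 2 * c * δ⁻¹ ^ 4 * (|zz| * |x|)) ^ 2 := by positivity
    have e4 : (|q| * |y|) ^ 2 ≤ q ^ 2 * ss := by rw [mul_pow, sq_abs, sq_abs]; gcongr
    have e5 : (|zz| * |x|) ^ 2 ≤ zz ^ 2 * xx := by rw [mul_pow, sq_abs, sq_abs]; gcongr
    have e6 : δ ^ 2 / (2 * c) * (|q| * |y|) ^ 2 ≤ δ ^ 2 / (2 * c) * (q ^ 2 * ss) := by gcongr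
    have e7 : 2 * c * δ⁻¹ ^ 6 * (|zz| * |x|) ^ 2 ≤ 2 * c * δ⁻¹ ^ 6 * (zz ^ 2 * xx) := by gcongr
    linarith
  have hF : ∀ j k, ∃ F : Fu n, BC F ∧ ∫ p, F p = 0 ∧ ∀ p,
      wt b j k p * (χ p ^ 2 * (Dd (ex j) z p * Dd (ex k) z p)) ≤ F p - wt b j k p * (pdxx j k z p * (χ p ^ 2 * z p))
      + (δ ^ 2 / (2 * c) * (χ p ^ 2 * S p) + 2 * c * δ⁻¹ ^ 6 * (z p ^ 2 * X p)) := by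
    intro j k
    rcases wt_inv_or hδ hb j k with h | h
    · obtain ⟨F, h1, h2, h3⟩ := C1_aux (ex j) (ex k) (wt_BM hδ hb j k) h hz hχ
      refine ⟨F, h1, h2, fun p => ?_⟩
      have := hcross _ _ _ (z p) _ _ (wt_abs hδ hb j k p) (hSp j p) (hXp k p) (χ p)
      rw [h3, pdxx_eq]; linarith
    · obtain ⟨F, h1, h2, h3⟩ := C1_aux (ex k) (ex j) (wt_BM hδ hb j k) h hz hχ
      refine ⟨F, h1, h2, fun p => ?_⟩
      have := hcross _ _ _ (z p) _ _ (wt_abs hδ hb j k p) (hSp k p) (hXp j p) (χ p)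
      rw [h3, pdxx_eq, dd_comm hz (ex j) (ex k), mul_comm (Dd (ex j) z p)]; linarith
  choose F hF1 hF2 hF3 using hF
  have hT : Cc (fun p => χ p * (χ p * (z p * z p))) := hχ.mul_right (hχ.sm.mul (hz.mul hz))
  set T : Fu n := fun p => wi b p * Dd et (fun p => χ p * (χ p * (z p * z p))) p with hTdef
  have hTB : BC T := (wi_BM hδ hb).mulBC (hT.dd et).bc
  have hT0 : ∫ p, T p = 0 := (wi_BM hδ hb).int_dd (wi_inv et_0) hT
  have hTe : ∀ p, T p = wi b p * (2 * (pdt z p * χ p ^ 2 * z p) + 2 * (χ p * Dd et χ p * z p ^ 2)) := by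
    intro p
    rw [hTdef]; simp only
    rw [dd_mul hχ.sm (hχ.sm.mul (hz.mul hz)), dd_mul hχ.sm (hz.mul hz), dd_mul hz hz, pdt_eq]
    ring
  set R : Fu n := fun p => χ p ^ 2 * (|Lb σ b z p| * |z p|) + z p ^ 2 * (X p + |χ p| * |Dd et χ p|) with hR
  have hRB : BC R := by
    refine (hχ.bc.sq.mulLM ((Lb_LM hδ hb σ hz).abs.mul hz.lm.abs)).add ?_
    have := (hXB.add (hχ.bc.abs.mul (hχ.dd et).bc.abs)).mulLM hz.lm.sq
    simpa only [mul_comm] using this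
  have hpt : ∀ p, δ ^ 2 / 2 * (χ p ^ 2 * S p) ≤ (∑ j, ∑ k, F j k p + σ / 2 * T p) + C1 * R p := by
    intro p
    have h1 := wt_low hδ hb p (fun j => Dd (ex j) z p)
    have h2 : ∑ j, ∑ k, wt b j k p * (χ p ^ 2 * (Dd (ex j) z p * Dd (ex k) z p)) ≤
        ∑ j : Fi n, ∑ k : Fi n, (F j k p - wt b j k p * (pdxx j k z p * (χ p ^ 2 * z p))
        + (δ ^ 2 / (2 * c) * (χ p ^ 2 * S p) + 2 * c * δ⁻¹ ^ 6 * (z p ^ 2 * X p))) :=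
      Finset.sum_le_sum fun j _ => Finset.sum_le_sum fun k _ => hF3 j k p
    have h3 : ∑ j, ∑ k, wt b j k p * (χ p ^ 2 * (Dd (ex j) z p * Dd (ex k) z p)) =
        χ p ^ 2 * ∑ j, ∑ k, wt b j k p * (Dd (ex j) z p * Dd (ex k) z p) := by
      simp_rw [Finset.mul_sum]
      exact SC fun j _ => SC fun k _ => by ring
    have h4 : ∑ j, ∑ k, wt b j k p * (pdxx j k z p * (χ p ^ 2 * z p)) =
        (wi b p * Lb σ b z p - σ * (wi b p * pdt z p)) * (χ p ^ 2 * z p) := by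
      rw [wi_mul_Lb, add_sub_cancel_left, Finset.sum_mul]
      refine SC fun j _ => ?_
      rw [Finset.sum_mul]
      exact SC fun k _ => by ring
    simp_rw [Finset.sum_add_distrib, Finset.sum_sub_distrib, Finset.sum_const, Finset.card_univ, Fintype.card_fin] at h2
    rw [h3, h4] at h2
    simp only [nsmul_eq_mul] at h2
    have h5 : χ p ^ 2 * (δ ^ 2 * S p) ≤ χ p ^ 2 * ∑ j, ∑ k, wt b j k p * (Dd (ex j) z p * Dd (ex k) z p) := by
      gcongr
    have hwi := wi_bd hδ hb p
    have hw0 : 0 ≤ wi b p := hδ.le.trans hwi.1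
    have h6 : -(wi b p * Lb σ b z p * (χ p ^ 2 * z p)) ≤ δ⁻¹ * (χ p ^ 2 * (|Lb σ b z p| * |z p|)) := by
      calc _ ≤ |-(wi b p * Lb σ b z p * (χ p ^ 2 * z p))| := le_abs_self _
        _ = wi b p * (χ p ^ 2 * (|Lb σ b z p| * |z p|)) := by
          simp [abs_mul, abs_of_nonneg hw0]; ring
        _ ≤ _ := by gcongr; exact hwi.2
    have h7 : -(σ * (wi b p * (χ p * Dd et χ p * z p ^ 2))) ≤ δ⁻¹ * (z p ^ 2 * (|χ p| * |Dd et χ p|)) := by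
      calc _ ≤ |-(σ * (wi b p * (χ p * Dd et χ p * z p ^ 2)))| := le_abs_self _
        _ = |σ| * (wi b p * (z p ^ 2 * (|χ p| * |Dd et χ p|))) := by
          simp only [abs_neg, abs_mul, abs_of_nonneg hw0, abs_pow, sq_abs]; ring
        _ ≤ 1 * (δ⁻¹ * (z p ^ 2 * (|χ p| * |Dd et χ p|))) := by gcongr; exact hwi.2
        _ = _ := one_mul _
    have hXn : 0 ≤ X p := SN fun _ _ => sq_nonneg _
    have h8 : δ⁻¹ * (χ p ^ 2 * (|Lb σ b z p| * |z p|)) ≤ C1 * (χ p ^ 2 * (|Lb σ b z p| * |z p|)) := by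
      gcongr; rw [hC1]; have : 0 ≤ 2 * c * δ⁻¹ ^ 6 * c := by positivity
      linarith
    have h9 : δ⁻¹ * (z p ^ 2 * (|χ p| * |Dd et χ p|)) ≤ C1 * (z p ^ 2 * (|χ p| * |Dd et χ p|)) := by
      gcongr; rw [hC1]; have : 0 ≤ 2 * c * δ⁻¹ ^ 6 * c := by positivity
      linarith
    have h10 : c * (2 * c * δ⁻¹ ^ 6 * (z p ^ 2 * X p)) ≤ C1 * (z p ^ 2 * X p) := by
      have : C1 * (z p ^ 2 * X p) = δ⁻¹ * (z p ^ 2 * X p) + c * (2 * c * δ⁻¹ ^ 6 * (z p ^ 2 * X p)) := by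
        rw [hC1]; ring
      rw [this]
      have : 0 ≤ δ⁻¹ * (z p ^ 2 * X p) := by positivity
      linarith
    have h11 : c * (δ ^ 2 / (2 * c) * (χ p ^ 2 * S p)) = δ ^ 2 / 2 * (χ p ^ 2 * S p) := by
      field_simp
    have h12 : ((n + 1 : ℕ) : ℝ) * (((n + 1 : ℕ) : ℝ) * (δ ^ 2 / (2 * c) * (χ p ^ 2 * S p))) +
      ((n + 1 : ℕ) : ℝ) * (((n + 1 : ℕ) : ℝ) * (2 * c * δ⁻¹ ^ 6 * (z p ^ 2 * X p))) =
      δ ^ 2 / 2 * (χ p ^ 2 * S p) + c * (2 * c * δ⁻¹ ^ 6 * (z p ^ 2 * X p)) := by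
      rw [← h11]; push_cast; rw [hc]; ring
    rw [hTe p, hR]
    simp only
    have h13 : (∑ j, ∑ k, F j k p) - (wi b p * Lb σ b z p - σ * (wi b p * pdt z p)) * (χ p ^ 2 * z p) +
        (δ ^ 2 / 2 * (χ p ^ 2 * S p) + c * (2 * c * δ⁻¹ ^ 6 * (z p ^ 2 * X p))) ≥ χ p ^ 2 * (δ ^ 2 * S p) := by
      rw [← h12]; linarith
    linarith only [h13, h6, h7, h8, h9, h10]
  have hFB : BC (fun p => ∑ j, ∑ k, F j k p) := BC.sum _ fun j => BC.sum _ fun k => hF1 j k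
  have hI := BC.mono (m := volume) ((hχ.bc.sq.mulLM hSB).cmul (δ ^ 2 / 2)) ((hFB.add (hTB.cmul (σ / 2))).add (hRB.cmul C1)) hpt
  rw [BC.int_add (hFB.add (hTB.cmul (σ / 2))) (hRB.cmul C1), BC.int_add hFB (hTB.cmul (σ / 2)),
    integral_const_mul, integral_const_mul, integral_const_mul, hT0,
    BC.int_sum _ fun j => BC.sum _ fun k => hF1 j k] at hI
  have h0 : ∑ j, ∫ p, ∑ k, F j k p = 0 := Finset.sum_eq_zero fun j _ => by
    rw [BC.int_sum _ fun k => hF1 j k]; exact Finset.sum_eq_zero fun k _ => hF2 j k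
  rw [h0] at hI
  have hfin : ∫ p, χ p ^ 2 * S p = 2 * δ⁻¹ ^ 2 * (δ ^ 2 / 2 * ∫ p, χ p ^ 2 * S p) := by field_simp
  rw [hfin, mul_assoc (2 * δ⁻¹ ^ 2)]
  exact mll (by linarith) (by positivity)
end C1
end KK
namespace KK
section C2
variable {n : ℕ}
theorem int_le_set {θ : ℝ} {f g : Fu n} (hf : BC f) (hg : LM g)
    (hs : ∀ p, p ∉ Bl n θ → f p = 0) (h : ∀ p, f p ≤ g p) :
    ∫ p, f p ≤ ∫ p in Bl n θ, g p := by
  rw [← setIntegral_eq_integral_of_forall_compl_eq_zero (s := Bl n θ) hs]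
  exact setIntegral_mono_on hf.integrable.integrableOn (hg.intOn _) measurableSet_ball fun p _ => h p
theorem bd_one {χ : Fu n} (h : Cc χ) : ∃ C : ℝ, 0 < C ∧ ∀ p, |χ p| ≤ C := by
  obtain ⟨C, hC⟩ := h.bc.1.2
  exact ⟨|C| + 1, by positivity, fun p => (hC p).trans ((le_abs_self _).trans (by linarith))⟩
theorem bd_fin {ι : Type*} [Fintype ι] {χ : ι → Fu n} (h : ∀ i, Cc (χ i)) :
    ∃ C : ℝ, 0 < C ∧ ∀ i p, |χ i p| ≤ C := by
  choose C hC0 hC using fun i => bd_one (h i)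
  refine ⟨1 + ∑ i, C i, ?_, fun i p => (hC i p).trans ?_⟩
  · have : 0 ≤ ∑ i, C i := SN fun i _ => (hC0 i).le
    linarith
  · have := Finset.single_le_sum (f := C) (fun i _ => (hC0 i).le) (Finset.mem_univ i)
    linarith
theorem C2a (n : ℕ) {δ : ℝ} (hδ : 0 < δ) {θ1 θ2 : ℝ} (h1 : 0 < θ1) (h2 : θ1 < θ2) : ∃ N : ℝ, 0 < N ∧
    ∀ b : ℝ → Mx n, Ell δ b →
    ∀ z : Fu n, Sm z → ∀ j, EE θ1 (Dd (ex j) z) ≤ N * (EE θ2 z + EE θ2 (Lb 1 b z)) := by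
  obtain ⟨N, hN, HN⟩ := C1 n hδ
  obtain ⟨χ, hχ, hχ1, hχ2, hχ3⟩ := cutoff n h1 h2
  obtain ⟨C, hC, hCb⟩ := bd_fin fun j => hχ.dd (ex j)
  obtain ⟨D, hD, hDb⟩ := bd_one (hχ.dd et)
  set M : ℝ := 1 + (n + 1) * C ^ 2 + D with hM
  refine ⟨N * M, by positivity, fun b hb z hz j => ?_⟩
  have hL := Lb_LM hδ hb 1 hz
  have e1 := HN b hb 1 (by simp) z hz χ hχ
  have e0 : EE θ1 (Dd (ex j) z) ≤ ∫ p, χ p ^ 2 * ∑ j, Dd (ex j) z p ^ 2 := by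
    have hB : BC (fun p => χ p ^ 2 * ∑ j, Dd (ex j) z p ^ 2) :=
      hχ.bc.sq.mulLM (LM.sum _ fun j => (hz.dd _).lm.sq)
    refine le_trans (EE_le (hz.dd _).lm hB.lm fun p hp => ?_) (setIntegral_le_integral hB.integrable
      (evf fun p => mul_nonneg (sq_nonneg _) (SN fun _ _ => sq_nonneg _)))
    rw [hχ1 p hp, one_pow, one_mul]
    exact Finset.single_le_sum (f := fun j => Dd (ex j) z p ^ 2) (fun _ _ => sq_nonneg _) (Finset.mem_univ j)
  refine e0.trans (e1.trans ?_)
  rw [mul_assoc]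
  refine mll ?_ hN.le
  have hB : BC (fun p => χ p ^ 2 * (|Lb 1 b z p| * |z p|) +
        z p ^ 2 * (∑ j, Dd (ex j) χ p ^ 2 + |χ p| * |Dd et χ p|)) := by
    refine (hχ.bc.sq.mulLM (hL.abs.mul hz.lm.abs)).add ?_
    have := ((BC.sum Finset.univ fun j => (hχ.dd (ex j)).bc.sq).add (hχ.bc.abs.mul (hχ.dd et).bc.abs)).mulLM hz.lm.sq
    simpa only [mul_comm] using this
  refine (int_le_set (g := fun p => M * z p ^ 2 + M * Lb 1 b z p ^ 2) (θ := θ2) hB ((hz.lm.sq.cmul M).add (hL.sq.cmul M)) ?_ ?_).trans (le_of_eq ?_)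
  · intro p hp
    have a := zero_out hχ3 p hp
    have c : ∀ j, Dd (ex j) χ p = 0 := fun j => zero_out (dd_zero hχ3 _) p hp
    simp [a, c]
  · intro p
    have a1 : χ p ^ 2 * (|Lb 1 b z p| * |z p|) ≤ 1 * (Lb 1 b z p ^ 2 + z p ^ 2) := by
      have : χ p ^ 2 ≤ 1 := by have := hχ2 p; nlinarith
      have h3 : |Lb 1 b z p| * |z p| ≤ Lb 1 b z p ^ 2 + z p ^ 2 := by
        rw [← sq_abs (Lb 1 b z p), ← sq_abs (z p)]
        nlinarith [sq_nonneg (|Lb 1 b z p| - |z p|), sq_nonneg (|Lb 1 b z p| + |z p|)]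
      exact mul_le_mul this h3 (by positivity) zero_le_one
    have a2 : ∑ j, Dd (ex j) χ p ^ 2 ≤ (n + 1) * C ^ 2 := by
      have : ∑ j, Dd (ex j) χ p ^ 2 ≤ (Finset.univ : Finset (Fi n)).card • C ^ 2 := by
        refine Finset.sum_le_card_nsmul _ _ _ fun j _ => ?_
        rw [← sq_abs]
        exact pow_le_pow_left₀ (abs_nonneg _) (hCb j p) 2
      simpa using this
    have a3 : |χ p| * |Dd et χ p| ≤ D := by
      have : |χ p| ≤ 1 := by rw [abs_of_nonneg (hχ2 p).1]; exact (hχ2 p).2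
      calc _ ≤ 1 * D := mul_le_mul this (hDb p) (abs_nonneg _) zero_le_one
        _ = D := one_mul _
    have a4 : z p ^ 2 * (∑ j, Dd (ex j) χ p ^ 2 + |χ p| * |Dd et χ p|) ≤ z p ^ 2 * ((n + 1) * C ^ 2 + D) := by
      gcongr
    have a5 : Lb 1 b z p ^ 2 ≤ M * Lb 1 b z p ^ 2 := by
      refine le_mul_of_one_le_left (sq_nonneg _) ?_
      have : 0 ≤ (n + 1) * C ^ 2 := by positivity
      linarith
    rw [hM] at *
    nlinarith
  · rw [integral_add ((hz.lm.sq.cmul M).intOn _) ((hL.sq.cmul M).intOn _), integral_const_mul, integral_const_mul]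
    unfold EE; ring
theorem pdxx_mul {f g : Fu n} (hf : Sm f) (hg : Sm g) (j k) (p : G n) :
    pdxx j k (fun p => f p * g p) p = f p * pdxx j k g p + pdxx j k f p * g p +
      (Dd (ex j) f p * Dd (ex k) g p + Dd (ex k) f p * Dd (ex j) g p) := by
  rw [pdxx_eq, pdxx_eq, pdxx_eq]
  have : Dd (ex k) (fun p => f p * g p) = fun p => f p * Dd (ex k) g p + Dd (ex k) f p * g p := by
    funext q; exact dd_mul hf hg _ _
  rw [this, dd_add (hf.mul (hg.dd _)) ((hf.dd _).mul hg), dd_mul hf (hg.dd _), dd_mul (hf.dd _) hg]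
  ring
theorem Lb_mul {b : ℝ → Mx n} {f g : Fu n} (hf : Sm f) (hg : Sm g) (p : G n) :
    Lb 1 b (fun p => f p * g p) p = f p * Lb 1 b g p + Lb 1 b f p * g p +
      ∑ j, ∑ k, b (p.2 0) j k * (Dd (ex j) f p * Dd (ex k) g p + Dd (ex k) f p * Dd (ex j) g p) := by
  unfold Lb
  simp_rw [pdxx_mul hf hg, pdt_eq, dd_mul hf hg, mul_add, Finset.sum_add_distrib, add_mul, Finset.mul_sum, Finset.sum_mul]
  have e1 : ∀ x y, b (p.2 0) x y * (f p * pdxx x y g p) = f p * (b (p.2 0) x y * pdxx x y g p) := by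
    intros; ring
  have e2 : ∀ x y, b (p.2 0) x y * (pdxx x y f p * g p) = b (p.2 0) x y * pdxx x y f p * g p := by
    intros; ring
  simp_rw [e1, e2]
  ring
theorem C2 (n : ℕ) {δ : ℝ} (hδ : 0 < δ) {θ1 θ2 : ℝ} (h1 : 0 < θ1) (h2 : θ1 < θ2) : ∃ N : ℝ, 0 < N ∧
    ∀ b : ℝ → Mx n, Ell δ b →
    ∀ z : Fu n, Sm z → (∀ j, EE θ1 (Dd (ex j) z) ≤ N * (EE θ2 z + EE θ2 (Lb 1 b z))) ∧
      (EE θ1 (pdt z) ≤ N * (EE θ2 z + EE θ2 (Lb 1 b z))) ∧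
      (∀ j k, EE θ1 (pdxx j k z) ≤ N * (EE θ2 z + EE θ2 (Lb 1 b z))) := by
  set θm := (θ1 + θ2) / 2 with hθm
  have hm1 : θ1 < θm := by rw [hθm]; linarith
  have hm2 : θm < θ2 := by rw [hθm]; linarith
  obtain ⟨N1, hN1, HN1⟩ := C2a n hδ (h1.trans hm1) hm2
  obtain ⟨N2, hN2, HN2⟩ := B1 n hδ
  obtain ⟨χ, hχ, hχ1, hχ2, hχ3⟩ := cutoff n h1 hm1
  obtain ⟨C, hC, hCb⟩ := bd_fin fun j => hχ.dd (ex j)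
  obtain ⟨D, hD, hDb⟩ := bd_fin fun jk : Fi n × Fi n => hχ.pdxx jk.1 jk.2
  obtain ⟨F, hF, hFb⟩ := bd_one (hχ.dd et)
  have hδi : 0 < δ⁻¹ := inv_pos.2 hδ
  set m : ℝ := n + 1 with hm
  have hmp : 0 < m := by positivity
  set P : ℝ := F + m * (m * (δ⁻¹ * D)) with hP
  set Q : ℝ := m * (m * (δ⁻¹ * (2 * C))) with hQ
  set W : ℝ := 3 * 1 + 3 * P ^ 2 + 3 * Q ^ 2 * (m * N1) with hW
  have hWp : 0 < W := by positivity
  refine ⟨N1 + N2 * W, by positivity, fun b hb z hz => ?_⟩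
  have hL := Lb_LM hδ hb 1 hz
  set A := EE θ2 z + EE θ2 (Lb 1 b z) with hA
  have hA0 : 0 ≤ A := add_nonneg (EE_nonneg _ _) (EE_nonneg _ _)
  have hgrad := HN1 b hb z hz
  have hcz : Cc (fun p => χ p * z p) := hχ.mul_right hz
  have hkey : ∫ p, Lb 1 b (fun p => χ p * z p) p ^ 2 ≤ W * A := by
    have hg : LM (fun p => 3 * Lb 1 b z p ^ 2 + 3 * P ^ 2 * z p ^ 2 + 3 * Q ^ 2 * ∑ k, Dd (ex k) z p ^ 2) :=
      ((hL.sq.cmul 3).add (hz.lm.sq.cmul _)).add ((LM.sum _ fun k => (hz.dd _).lm.sq).cmul _)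
    refine (int_le_set (θ := θm) (Lb_BC hδ hb 1 hcz).sq hg ?_ ?_).trans ?_
    · intro p hp
      rw [Lb_mul hχ.sm hz]
      have a := zero_out hχ3 p hp
      have c : ∀ j, Dd (ex j) χ p = 0 := fun j => zero_out (dd_zero hχ3 _) p hp
      have d : ∀ j k, pdxx j k χ p = 0 := fun j k => zero_out (dd_zero (dd_zero hχ3 _) _) p hp
      have e : pdt χ p = 0 := zero_out (dd_zero hχ3 _) p hp
      have f : Lb 1 b χ p = 0 := by simp [Lb, d, e]
      simp [a, c, f]
    · intro p
      rw [Lb_mul hχ.sm hz]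
      have a1 : |Lb 1 b χ p| ≤ P := by
        unfold Lb
        rw [one_mul]
        refine (abs_add_le _ _).trans (add_le_add (hFb p) ?_)
        refine (Finset.abs_sum_le_sum_abs _ _).trans ?_
        have : ∀ j : Fi n, |∑ k, b (p.2 0) j k * pdxx j k χ p| ≤ m * (δ⁻¹ * D) := by
          intro j
          refine (Finset.abs_sum_le_sum_abs _ _).trans ?_
          refine (Finset.sum_le_card_nsmul _ _ (δ⁻¹ * D) fun k _ => ?_).trans (by simp [hm])
          rw [abs_mul]
          exact mul_le_mul (hb.abs hδ _ j k) (hDb (j, k) p) (abs_nonneg _) hδi.le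
        refine (Finset.sum_le_card_nsmul _ _ (m * (δ⁻¹ * D)) fun k _ => this k).trans (by simp [hm])
      set S := ∑ k, Dd (ex k) z p ^ 2 with hS
      have hSp : ∀ k, |Dd (ex k) z p| ≤ Real.sqrt S := fun k => Real.abs_le_sqrt
        (Finset.single_le_sum (f := fun j => Dd (ex j) z p ^ 2) (fun _ _ => sq_nonneg _) (Finset.mem_univ k))
      have hS0 : 0 ≤ S := SN fun _ _ => sq_nonneg _
      have a2 : |∑ j, ∑ k, b (p.2 0) j k * (Dd (ex j) χ p * Dd (ex k) z p + Dd (ex k) χ p * Dd (ex j) z p)|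
          ≤ Q * Real.sqrt S := by
        refine (Finset.abs_sum_le_sum_abs _ _).trans ?_
        have : ∀ j : Fi n, |∑ k, b (p.2 0) j k * (Dd (ex j) χ p * Dd (ex k) z p + Dd (ex k) χ p * Dd (ex j) z p)| ≤ m * (δ⁻¹ * (2 * C * Real.sqrt S)) := by
          intro j
          refine (Finset.abs_sum_le_sum_abs _ _).trans ?_
          refine (Finset.sum_le_card_nsmul _ _ (δ⁻¹ * (2 * C * Real.sqrt S)) fun k _ => ?_).trans (by simp [hm])
          rw [abs_mul]
          refine mul_le_mul (hb.abs hδ _ j k) ?_ (abs_nonneg _) hδi.le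
          refine (abs_add_le _ _).trans ?_
          rw [abs_mul, abs_mul]
          have q1 := mul_le_mul (hCb j p) (hSp k) (abs_nonneg _) hC.le
          have q2 := mul_le_mul (hCb k p) (hSp j) (abs_nonneg _) hC.le
          linarith
        refine (Finset.sum_le_card_nsmul _ _ _ fun k _ => this k).trans (le_of_eq ?_)
        simp [hm, hQ]; ring
      have a3 : |χ p * Lb 1 b z p| ≤ |Lb 1 b z p| := by
        rw [abs_mul, abs_of_nonneg (hχ2 p).1]
        exact mul_le_of_le_one_left (abs_nonneg _) (hχ2 p).2
      have a4 : |Lb 1 b χ p * z p| ≤ P * |z p| := by rw [abs_mul]; gcongr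
      have a5 : (χ p * Lb 1 b z p) ^ 2 ≤ Lb 1 b z p ^ 2 := sq_le_sq.2 a3
      have a6 : (Lb 1 b χ p * z p) ^ 2 ≤ P ^ 2 * z p ^ 2 := by
        have := pow_le_pow_left₀ (abs_nonneg _) a4 2
        rwa [sq_abs, mul_pow P, sq_abs] at this
      have a7 := pow_le_pow_left₀ (abs_nonneg _) a2 2
      rw [sq_abs, mul_pow, Real.sq_sqrt hS0] at a7
      set x := χ p * Lb 1 b z p
      set y := Lb 1 b χ p * z p
      set w := ∑ j, ∑ k, b (p.2 0) j k * (Dd (ex j) χ p * Dd (ex k) z p + Dd (ex k) χ p * Dd (ex j) z p)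
      have a8 : (x + y + w) ^ 2 ≤ 3 * x ^ 2 + 3 * y ^ 2 + 3 * w ^ 2 := by
        nlinarith [sq_nonneg (x - y), sq_nonneg (x - w), sq_nonneg (y - w)]
      linarith
    · rw [integral_add (((hL.sq.cmul 3).add (hz.lm.sq.cmul _)).intOn _) (((LM.sum _ fun k => (hz.dd _).lm.sq).cmul _).intOn _),
        integral_add ((hL.sq.cmul 3).intOn _) ((hz.lm.sq.cmul _).intOn _), integral_const_mul, integral_const_mul, integral_const_mul,
        integral_finsetSum _ fun k _ => (hz.dd (ex k)).lm.sq.intOn _]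
      have b1 : EE θm (Lb 1 b z) ≤ A := (EE_mono hm2.le hL).trans (by rw [hA]; linarith [EE_nonneg θ2 z])
      have b2 : EE θm z ≤ A := (EE_mono hm2.le hz.lm).trans (by rw [hA]; linarith [EE_nonneg θ2 (Lb 1 b z)])
      have b3 : ∑ k, ∫ p in Bl n θm, Dd (ex k) z p ^ 2 ≤ m * (N1 * A) :=
        (Finset.sum_le_card_nsmul _ _ _ fun k _ => hgrad k).trans (by simp [hm, hA])
      unfold EE at b1 b2
      have c2 : 3 * P ^ 2 * (∫ p in Bl n θm, z p ^ 2) ≤ 3 * P ^ 2 * A := by gcongr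
      have c3 : 3 * Q ^ 2 * (∑ k, ∫ p in Bl n θm, Dd (ex k) z p ^ 2) ≤ 3 * Q ^ 2 * (m * (N1 * A)) := by gcongr
      rw [hW]
      linarith
  have hB := HN2 b hb _ hcz
  have hcong : ∀ p ∈ Bl n θ1, χ p * z p = z p := fun p hp => by rw [hχ1 p hp, one_mul]
  have hfin : ∀ {f g : Fu n}, BC f → (∀ p ∈ Bl n θ1, f p = g p) →
      ∫ p, f p ^ 2 ≤ N2 * ∫ p, Lb 1 b (fun p => χ p * z p) p ^ 2 → EE θ1 g ≤ (N1 + N2 * W) * A := by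
    intro f g hf hfg h
    rw [← EE_congr hfg]
    refine (EE_le_int hf).trans (h.trans ?_)
    have c1 : N2 * ∫ p, Lb 1 b (fun p => χ p * z p) p ^ 2 ≤ N2 * (W * A) := by gcongr
    have c2 : 0 ≤ N1 * A := by positivity
    linarith
  refine ⟨fun j => ?_, ?_, fun j k => ?_⟩
  · refine (EE_mono hm1.le (hz.dd _).lm).trans ((hgrad j).trans ?_)
    have : 0 ≤ N2 * W * A := by positivity
    linarith
  · exact hfin hcz.pdt.bc (dd_congr hcong et) hB.1
  · exact hfin (hcz.pdxx j k).bc (dd_congr (dd_congr hcong (ex k)) (ex j)) (hB.2 j k)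
end C2
end KK
namespace KK
section conv
variable {E : Type*} [NormedAddCommGroup E] [NormedSpace ℝ E] [FiniteDimensional ℝ E]
  [MeasurableSpace E] [BorelSpace E]
noncomputable def cv (m : Measure E) (f g : E → ℝ) : E → ℝ := fun p => ∫ t, f t * g (p - t) ∂m
theorem cv_eq (m : Measure E) (f g : E → ℝ) :
    cv m f g = convolution f g (ContinuousLinearMap.mul ℝ ℝ) m := by
  funext p; simp [cv, convolution_def]
theorem cv_sm {m : Measure E} {f g : E → ℝ} (hf : LocallyIntegrable f m) (hg : Cc g) :
    Sm (cv m f g) := by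
  rw [cv_eq]
  exact hg.2.contDiff_convolution_right _ hf hg.1
theorem cv_dd {m : Measure E} [SFinite m] [m.IsAddLeftInvariant] {f g : E → ℝ} (hf : LocallyIntegrable f m) (hg : Cc g) (e : E) :
    Dd e (cv m f g) = cv m f (Dd e g) := by
  funext p
  have h := hg.2.hasFDerivAt_convolution_right (ContinuousLinearMap.mul ℝ ℝ) hf
    (hg.1.of_le (by simp)) p
  have h2 := convolution_precompR_apply (L := ContinuousLinearMap.mul ℝ ℝ) hf (hg.2.fderiv ℝ)
    (hg.1.continuous_fderiv (by simp)) p e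
  rw [cv_eq, cv_eq]
  unfold Dd
  rw [h.fderiv, h2]
theorem cv_integrand {m : Measure E} {f g : E → ℝ} (hf : LocallyIntegrable f m) (hg : Continuous g)
    (hgc : HasCompactSupport g) (p : E) :
    Integrable (fun t => f t * g (p - t)) m := by
  have := hgc.convolutionExists_right (ContinuousLinearMap.mul ℝ ℝ) hf hg p
  simpa [ConvolutionExistsAt] using this
end conv
section liou
variable {n : ℕ}
theorem Cc.refl {g : Fu n} (hg : Cc g) (p : G n) : Cc (fun q => g (p - q)) := by
  refine ⟨hg.1.comp (contDiff_const.sub contDiff_id), ?_⟩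
  exact hg.2.comp_homeomorph (Homeomorph.subLeft p)
theorem dd_refl {g : Fu n} (hg : Sm g) (p e : G n) :
    Dd e (fun q => g (p - q)) = fun q => - Dd e g (p - q) := by
  funext q
  unfold Dd
  have h1 : HasFDerivAt (fun q => p - q) (-(ContinuousLinearMap.id ℝ (G n))) q := by
    simpa using (hasFDerivAt_id q).const_sub p
  have := (hg.diff (p - q)).hasFDerivAt.comp q h1
  have h2 := this.fderiv
  simp only [Function.comp_def] at h2
  rw [h2]; simp
theorem dd_neg {g : Fu n} (e : G n) : Dd e (fun q => - g q) = fun q => - Dd e g q := by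
  funext q; simp [Dd, fderiv_fun_neg]
theorem dd_refl2 {g : Fu n} (hg : Sm g) (p e f : G n) :
    Dd f (Dd e (fun q => g (p - q))) = fun q => Dd f (Dd e g) (p - q) := by
  rw [dd_refl hg, dd_neg, dd_refl (hg.dd e)]; simp
def bI (n : ℕ) : ℝ → Mx n := fun _ j k => if j = k then 1 else 0
theorem ell_bI {δ : ℝ} (hδ : 0 < δ) (h1 : δ ≤ 1) : Ell δ (bI n) := by
  have h2 : 1 ≤ δ⁻¹ := (one_le_inv₀ hδ).2 h1
  have key : ∀ θ : Fi n → ℝ, ∑ j, ∑ k, (bI n 0 j k) * θ j * θ k = ∑ j, θ j ^ 2 := by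
    intro θ
    refine SC fun j _ => ?_
    simp [bI]; ring
  have hs : ∀ θ : Fi n → ℝ, 0 ≤ ∑ j, θ j ^ 2 := fun θ => SN fun _ _ => sq_nonneg _
  constructor
  · intro j k; exact measurable_const
  · intro s j k; simp [bI, eq_comm]
  · intro s θ; rw [show bI n s = bI n 0 from rfl, key]; nlinarith [hs θ]
  · intro s θ; rw [show bI n s = bI n 0 from rfl, key]; nlinarith [hs θ]
theorem Lb_bI (σ : ℝ) (u : Fu n) (p : G n) :
    Lb σ (bI n) u p = σ * pdt u p + ∑ j, pdxx j j u p := by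
  simp [Lb, bI]
theorem dd_comp_affine {E F : Type*} [NormedAddCommGroup E] [NormedSpace ℝ E] [NormedAddCommGroup F]
    [NormedSpace ℝ F] {u : F → ℝ} (hu : Sm u) (A : E →L[ℝ] F) (q : F) (e : E) :
    Dd e (fun p => u (A p + q)) = fun p => Dd (A e) u (A p + q) := by
  funext p
  have h1 : HasFDerivAt (fun p => A p + q) A p := A.hasFDerivAt.add_const q
  have := (hu.diff (A p + q)).hasFDerivAt.comp p h1
  have h2 := this.fderiv
  simp only [Function.comp_def] at h2
  unfold Dd
  rw [h2]; simp
theorem dd_smul_dir {E : Type*} [NormedAddCommGroup E] [NormedSpace ℝ E] {u : E → ℝ} (c : ℝ) (e : E) (p : E) :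
    Dd (c • e) u p = c * Dd e u p := by simp [Dd]
theorem int_zero_cont {F : Fu n} (hF : Continuous F) (hc : HasCompactSupport F) (h0 : ∀ p, 0 ≤ F p)
    (hi : ∫ p, F p ≤ 0) (p : G n) : F p = 0 := by
  by_contra hne
  have := hF.integral_pos_of_hasCompactSupport_nonneg_nonzero (μ := volume) hc h0 hne
  linarith
theorem cut_scale (n : ℕ) : ∃ C : ℝ, 0 < C ∧ ∀ R : ℝ, 1 ≤ R → ∃ χ : Fu n, Cc χ ∧
    (∀ p, 0 ≤ χ p ∧ χ p ≤ 1) ∧ (∀ p ∈ Bl n R, χ p = 1) ∧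
    ∀ p, (∑ j, Dd (ex j) χ p ^ 2 + |χ p| * |Dd et χ p|) ≤ C / R := by
  obtain ⟨χ, hχ, h1, h01, -⟩ := cutoff n one_pos one_lt_two
  have hb : ∀ e : G n, ∃ C, 0 < C ∧ ∀ p, |Dd e χ p| ≤ C := fun e => by
    obtain ⟨C, hC⟩ := (hχ.dd e).2.exists_bound_of_continuous (hχ.dd e).sm.cont
    exact ⟨|C| + 1, by positivity, fun p => (hC p).trans (by linarith [le_abs_self C])⟩
  choose B hB0 hB using hb
  refine ⟨(∑ j : Fi n, B (ex j) ^ 2) + B et, add_pos_of_nonneg_of_pos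
    (SN fun _ _ => sq_nonneg _) (hB0 _), fun R hR => ?_⟩
  have hR0 : 0 < R := by linarith
  set A : G n →L[ℝ] G n := R⁻¹ • ContinuousLinearMap.id ℝ (G n) with hA
  have hdd : ∀ e p, Dd e (fun p => χ (A p + 0)) p = R⁻¹ * Dd e χ (A p + 0) := by
    intro e p
    rw [dd_comp_affine hχ.sm]
    simp only [hA, _root_.smul_apply, ContinuousLinearMap.id_apply]
    rw [dd_smul_dir]
  refine ⟨fun p => χ (A p + 0), ⟨?_, ?_⟩, fun p => h01 _, ?_, ?_⟩
  · exact hχ.1.comp (A.contDiff.add contDiff_const)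
  · have := hχ.2.comp_homeomorph (Homeomorph.smulOfNeZero (α := G n) R⁻¹ (by positivity))
    simpa [hA, Function.comp_def] using this
  · intro p hp
    apply h1
    simp only [hA, Metric.mem_ball, dist_zero_right] at hp ⊢
    simp only [_root_.smul_apply, ContinuousLinearMap.id_apply, add_zero, norm_smul,
      norm_inv, Real.norm_eq_abs, abs_of_pos hR0]
    rw [inv_mul_lt_iff₀ hR0]; linarith
  · intro p
    simp only [hdd]
    have hRi : R⁻¹ ≤ 1 := inv_le_one_of_one_le₀ hR
    have hRp : 0 < R⁻¹ := by positivity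
    rw [add_div, Finset.sum_div]
    refine add_le_add (Finset.sum_le_sum fun j _ => ?_) ?_
    · rw [mul_pow, div_eq_inv_mul]
      have : Dd (ex j) χ (A p + 0) ^ 2 ≤ B (ex j) ^ 2 := sq_le_sq' (by linarith [neg_le_of_abs_le (hB (ex j) (A p + 0))]) (le_of_abs_le (hB _ _))
      have h3 : R⁻¹ ^ 2 ≤ R⁻¹ := by nlinarith
      exact mul_le_mul h3 this (sq_nonneg _) hRp.le
    · rw [abs_mul, abs_of_pos hRp, abs_of_nonneg (h01 _).1, div_eq_inv_mul]
      calc χ (A p + 0) * (R⁻¹ * |Dd et χ (A p + 0)|) ≤ 1 * (R⁻¹ * |Dd et χ (A p + 0)|) :=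
            mlr (h01 _).2 (by positivity)
        _ ≤ R⁻¹ * B et := by rw [one_mul]; exact mll (hB _ _) hRp.le
theorem liou1 {H g : Fu n} (hH : Sm H) (hL : ∀ p, Lb (-1) (bI n) H p = 0) (hg : Integrable g)
    (hle : ∀ p, H p ^ 2 ≤ g p) (j : Fi n) (p : G n) : Dd (ex j) H p = 0 := by
  obtain ⟨N, hN, hC1⟩ := C1 n (δ := 1) one_pos
  obtain ⟨C, hC, hcut⟩ := cut_scale n
  set I := ∫ q, g q with hI
  have hg0 : ∀ q, 0 ≤ g q := fun q => (sq_nonneg _).trans (hle q)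
  have hI0 : 0 ≤ I := integral_nonneg hg0
  obtain ⟨χ, hχ, h01, h1, -⟩ := hcut (‖p‖ + 1) (by linarith [norm_nonneg p])
  obtain ⟨r, hr⟩ := hχ.2.isCompact.isBounded.subset_ball (0 : G n)
  have hF : Cc (fun q => χ q ^ 2 * Dd (ex j) H q ^ 2) := by
    have := (hχ.mul_right hχ.sm).mul_right (hH.dd (ex j)).sq
    simpa [pow_two, mul_assoc] using this
  have key : ∀ R, 1 ≤ R → r ≤ R → ∫ q, χ q ^ 2 * Dd (ex j) H q ^ 2 ≤ N * (C * I) / R := by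
    intro R hR hrR
    obtain ⟨ψ, hψ, hψ01, hψ1, hψd⟩ := hcut R hR
    have hR0 : 0 < R := by linarith
    have h2 := hC1 (bI n) (ell_bI one_pos le_rfl) (-1) (by simp) H hH ψ hψ
    have hsum : Sm (fun q => ∑ j, Dd (ex j) H q ^ 2) :=
      ContDiff.sum fun j _ => (hH.dd (ex j)).sq
    have hi1 : Integrable (fun q => ψ q ^ 2 * ∑ j, Dd (ex j) H q ^ 2) := by
      have := ((hψ.mul_right hψ.sm).mul_right hsum).integrable (m := volume)
      simpa [pow_two, mul_assoc] using this
    have h3 : ∫ q, χ q ^ 2 * Dd (ex j) H q ^ 2 ≤ ∫ q, ψ q ^ 2 * ∑ j, Dd (ex j) H q ^ 2 := by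
      refine integral_mono hF.integrable hi1 fun q => ?_
      simp only
      have hs : Dd (ex j) H q ^ 2 ≤ ∑ j, Dd (ex j) H q ^ 2 :=
        Finset.single_le_sum (f := fun j => Dd (ex j) H q ^ 2) (fun _ _ => sq_nonneg _) (Finset.mem_univ j)
      by_cases hq : q ∈ Bl n R
      · rw [hψ1 q hq, one_pow, one_mul]
        have := h01 q
        have : χ q ^ 2 ≤ 1 := by nlinarith
        nlinarith [sq_nonneg (Dd (ex j) H q)]
      · have : χ q = 0 := by
          by_contra hne
          exact hq (Metric.ball_subset_ball hrR (hr (subset_tsupport _ hne)))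
        rw [this]
        have : 0 ≤ ∑ j, Dd (ex j) H q ^ 2 := SN fun _ _ => sq_nonneg _
        have h6 := mul_nonneg (sq_nonneg (ψ q)) this
        simpa using h6
    have h4 : ∫ q, (ψ q ^ 2 * (|Lb (-1) (bI n) H q| * |H q|) +
        H q ^ 2 * (∑ j, Dd (ex j) ψ q ^ 2 + |ψ q| * |Dd et ψ q|)) ≤ ∫ q, C / R * g q := by
      refine integral_mono_of_nonneg (evf fun q => ?_) (hg.const_mul _)
        (evf fun q => ?_)
      · have : 0 ≤ ∑ j, Dd (ex j) ψ q ^ 2 := SN fun _ _ => sq_nonneg _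
        simp only [Pi.zero_apply]; positivity
      · simp only [hL, abs_zero, zero_mul, mul_zero, zero_add]
        have h5 := hψd q
        have : 0 < C / R := by positivity
        nlinarith [hle q, sq_nonneg (H q)]
    rw [integral_const_mul] at h4
    calc _ ≤ _ := h3
      _ ≤ _ := h2
      _ ≤ N * (C / R * I) := mll h4 hN.le
      _ = _ := by ring
  have hlim : ∫ q, χ q ^ 2 * Dd (ex j) H q ^ 2 ≤ 0 := by
    have ht : Filter.Tendsto (fun R : ℝ => N * (C * I) / R) Filter.atTop (nhds 0) :=
      tendsto_const_nhds.div_atTop Filter.tendsto_id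
    refine ge_of_tendsto ht ?_
    filter_upwards [Filter.eventually_ge_atTop 1, Filter.eventually_ge_atTop r] with R h h'
    exact key R h h'
  have := int_zero_cont hF.sm.cont hF.2 (fun q => by positivity) hlim p
  rw [h1 p (by simp)] at this
  simpa using this
theorem liou2 {H : Fu n} (hH : Sm H) (e : G n) (h : ∀ p, Dd e H p = 0) (p : G n) (s : ℝ) :
    H (p + s • e) = H p := by
  have hd : ∀ s : ℝ, HasDerivAt (fun s : ℝ => H (p + s • e)) 0 s := by
    intro s
    have h1 : HasDerivAt (fun s : ℝ => p + s • e) e s := by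
      simpa using ((hasDerivAt_id s).smul_const e).const_add p
    have := (hH.diff (p + s • e)).hasFDerivAt.comp_hasDerivAt s h1
    have h2 := h (p + s • e)
    unfold Dd at h2
    rw [h2] at this
    exact this
  have := is_const_of_deriv_eq_zero (fun s => (hd s).differentiableAt) (fun s => (hd s).deriv) s 0
  simpa using this
theorem cv_Lb {h g : Fu n} (hh : LocallyIntegrable h volume) (hg : Cc g) (p : G n) :
    Lb (-1) (bI n) (cv volume h g) p = ∫ t, h t * Lb 1 (bI n) (fun q => g (p - q)) t := by
  have e1 : ∀ j, Integrable (fun t => h t * Dd (ex j) (Dd (ex j) g) (p - t)) volume := fun j =>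
    cv_integrand hh ((hg.dd (ex j)).dd (ex j)).sm.cont ((hg.dd (ex j)).dd (ex j)).2 p
  have e2 : Integrable (fun t => h t * Dd et g (p - t)) volume :=
    cv_integrand hh (hg.dd et).sm.cont (hg.dd et).2 p
  simp only [Lb_bI, pdt_eq, pdxx_eq, dd_refl2 hg.sm]
  simp only [dd_refl hg.sm]
  rw [cv_dd hh hg]
  simp only [fun j => cv_dd (m := volume) hh hg (ex j), fun j => cv_dd (m := volume) hh (hg.dd (ex j)) (ex j)]
  unfold cv
  rw [← integral_const_mul, ← integral_finsetSum _ (fun j _ => e1 j),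
    ← integral_add (e2.const_mul _) (integrable_finsetSum _ fun j _ => e1 j)]
  congr 1; funext t
  rw [← Finset.mul_sum]; ring
theorem jensen {h ρ : Fu n} (hm : MemLp h 2 volume) (hρ : Cc ρ) (h0 : ∀ p, 0 ≤ ρ p)
    (h1 : ∫ p, ρ p = 1) (p : G n) : cv volume h ρ p ^ 2 ≤ cv volume (fun q => h q ^ 2) ρ p := by
  have i1 := cv_integrand (hm.locallyIntegrable (by norm_num)) hρ.sm.cont hρ.2 p
  have i2 := cv_integrand hm.integrable_sq.locallyIntegrable hρ.sm.cont hρ.2 p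
  have i3 := (hρ.refl p).integrable (m := volume)
  set c := cv volume h ρ p with hc
  have hI : ∫ t, (h t ^ 2 * ρ (p - t) + (-2 * c) * (h t * ρ (p - t)) + c ^ 2 * ρ (p - t))
      = cv volume (fun q => h q ^ 2) ρ p + (-2 * c) * c + c ^ 2 * 1 := by
    rw [integral_add, integral_add, integral_const_mul, integral_const_mul,
      integral_sub_left_eq_self (fun t => ρ t), h1]
    · rfl
    · exact i2
    · exact i1.const_mul _
    · exact i2.add (i1.const_mul _)
    · exact i3.const_mul _
  have : 0 ≤ ∫ t, (h t ^ 2 * ρ (p - t) + (-2 * c) * (h t * ρ (p - t)) + c ^ 2 * ρ (p - t)) := by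
    refine integral_nonneg fun t => ?_
    have : h t ^ 2 * ρ (p - t) + (-2 * c) * (h t * ρ (p - t)) + c ^ 2 * ρ (p - t)
      = (h t - c) ^ 2 * ρ (p - t) := by ring
    simp only [Pi.zero_apply]
    rw [this]; exact mul_nonneg (sq_nonneg _) (h0 _)
  rw [hI] at this
  nlinarith
theorem liou3 {g ρ : Fu n} (hg : Integrable g) (hρ : Cc ρ) (p : G n) :
    Filter.Tendsto (fun k : ℕ => cv volume g ρ (p + (k : ℝ) • ex 0)) Filter.atTop (nhds 0) := by
  obtain ⟨C, hC⟩ := hρ.2.exists_bound_of_continuous hρ.sm.cont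
  have : (0 : ℝ) = ∫ t : G n, (0 : ℝ) := by simp
  rw [this]
  unfold cv
  refine tendsto_integral_of_dominated_convergence (fun t => C * ‖g t‖) (fun k => ?_) (hg.norm.const_mul C)
    (fun k => ?_) ?_
  · exact (cv_integrand hg.locallyIntegrable hρ.sm.cont hρ.2 _).1
  · refine evf fun t => ?_
    rw [norm_mul, mul_comm]
    exact mlr (hC _) (norm_nonneg _)
  · refine evf fun t => ?_
    obtain ⟨r, hr⟩ := hρ.2.isCompact.isBounded.subset_ball (0 : G n)
    refine tendsto_const_nhds.congr' ?_
    filter_upwards [Filter.eventually_ge_atTop (Nat.ceil (r + ‖p - t‖))] with k hk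
    have hk' : r + ‖p - t‖ ≤ k := (Nat.le_ceil _).trans (by exact_mod_cast hk)
    have : ρ (p + (k : ℝ) • ex 0 - t) = 0 := by
      by_contra hne
      have h1 := hr (subset_tsupport _ hne)
      rw [Metric.mem_ball, dist_zero_right] at h1
      have h2 : ‖(k : ℝ) • (ex 0 : G n)‖ ≤ ‖p + (k : ℝ) • ex 0 - t‖ + ‖p - t‖ := by
        have := norm_sub_le (p + (k : ℝ) • ex 0 - t) (p - t)
        rwa [show p + (k : ℝ) • ex 0 - t - (p - t) = (k : ℝ) • (ex 0 : G n) by abel] at this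
      have h3 : ‖(ex 0 : G n)‖ = 1 := by
        have : ‖(Pi.single 0 1 : Fi n → ℝ)‖ = ‖(1:ℝ)‖ := Pi.norm_single (G := fun _ => ℝ) (1:ℝ)
        simp [ex, Prod.norm_def, this]
      rw [norm_smul, h3] at h2
      simp at h2
      linarith
    rw [this, mul_zero]
theorem liouville {h : Fu n} (hm : MemLp h 2 volume)
    (ho : ∀ φ, Cc φ → ∫ t, h t * Lb 1 (bI n) φ t = 0) : h =ᵐ[volume] 0 := by
  have hloc : LocallyIntegrable h volume := hm.locallyIntegrable (by norm_num)
  have hz : ∀ (B : ContDiffBump (0 : G n)) p, cv volume h (B.normed volume) p = 0 := by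
    intro B p
    set ρ := B.normed volume with hρd
    have hρ : Cc ρ := ⟨B.contDiff_normed, B.hasCompactSupport_normed⟩
    have hH := cv_sm hloc hρ
    have hgi : Integrable (cv volume (fun q => h q ^ 2) ρ) volume := by
      rw [cv_eq]; exact hm.integrable_sq.integrable_convolution _ hρ.integrable
    have hJ := jensen hm hρ B.nonneg_normed B.integral_normed
    have hd := liou1 hH (fun p => by rw [cv_Lb hloc hρ]; exact ho _ (hρ.refl p)) hgi hJ 0
    have ht := liou3 (ρ := ρ) hm.integrable_sq hρ p
    have : cv volume h ρ p ^ 2 ≤ 0 := by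
      refine ge_of_tendsto ht (evf fun k => ?_)
      rw [← liou2 hH (ex 0) hd p k]
      exact hJ _
    nlinarith [sq_nonneg (cv volume h ρ p)]
  set B : ℕ → ContDiffBump (0 : G n) := fun k => ⟨1 / (k + 1 : ℝ), 2 / (k + 1 : ℝ), by positivity,
    by gcongr; norm_num⟩ with hB
  have := ContDiffBump.ae_convolution_tendsto_right_of_locallyIntegrable (μ := (volume : Measure (G n))) (φ := B)
    (l := Filter.atTop) (K := 2) (g := h) ?_ (evf fun k => ?_) hloc
  · filter_upwards [this] with x hx
    have h0 : ∀ k, convolution ((B k).normed volume) h (ContinuousLinearMap.lsmul ℝ ℝ) volume x = 0 := by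
      intro k
      have := hz (B k) x
      rw [convolution_eq_swap]
      rw [← this]; unfold cv
      congr 1; funext t; simp [mul_comm]
    simp only [h0] at hx
    exact tendsto_nhds_unique hx tendsto_const_nhds |>.trans rfl
  · simp only [hB]
    exact tendsto_const_nhds.div_atTop
      (Filter.tendsto_atTop_add_const_right _ _ tendsto_natCast_atTop_atTop)
  · simp only [hB]; apply le_of_eq; ring
end liou
end KK
namespace KK
section cm
variable {V H : Type*} [AddCommGroup V] [Module ℝ V] [NormedAddCommGroup H] [InnerProductSpace ℝ H]
  [CompleteSpace H]
theorem cm1 (T T' : V →ₗ[ℝ] H) {θ : ℝ} (h0 : 0 ≤ θ) (h1 : θ < 1) (hθ : ∀ φ, ‖T φ - T' φ‖ ≤ θ * ‖T φ‖)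
    (hd : (LinearMap.range T).topologicalClosure = ⊤) : (LinearMap.range T').topologicalClosure = ⊤ := by
  rw [Submodule.topologicalClosure_eq_top_iff, Submodule.eq_bot_iff]
  intro h hh
  rw [Submodule.mem_orthogonal] at hh
  have key : ∀ ε : ℝ, 0 < ε → ‖h‖ ^ 2 ≤ ‖h‖ * (ε + θ * (‖h‖ + ε)) := by
    intro ε hε
    have hcl : h ∈ closure (LinearMap.range T : Set H) := by
      have : h ∈ (LinearMap.range T).topologicalClosure := by rw [hd]; trivial
      exact this
    obtain ⟨y, ⟨φ, rfl⟩, hy⟩ := Metric.mem_closure_iff.1 hcl ε hε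
    rw [dist_eq_norm] at hy
    have e1 : ‖h‖ ^ 2 = inner ℝ (h - T' φ) h := by
      rw [inner_sub_left, hh _ ⟨φ, rfl⟩, real_inner_self_eq_norm_sq, sub_zero]
    have e2 : ‖h - T' φ‖ ≤ ε + θ * (‖h‖ + ε) := by
      have a1 : ‖h - T' φ‖ ≤ ‖h - T φ‖ + ‖T φ - T' φ‖ := by
        simpa using norm_add_le (h - T φ) (T φ - T' φ)
      have a2 : ‖T φ‖ ≤ ‖h‖ + ‖h - T φ‖ := by
        have := norm_sub_le h (h - T φ); simpa using this
      have a3 := hθ φ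
      nlinarith
    rw [e1]
    refine (real_inner_le_norm _ _).trans ?_
    rw [mul_comm]
    exact mll e2 (norm_nonneg _)
  have hlim : ‖h‖ ^ 2 ≤ ‖h‖ * (0 + θ * (‖h‖ + 0)) := by
    have ht : Filter.Tendsto (fun ε : ℝ => ‖h‖ * (ε + θ * (‖h‖ + ε))) (nhdsWithin 0 (Set.Ioi 0))
        (nhds (‖h‖ * (0 + θ * (‖h‖ + 0)))) := by
      have : Continuous (fun ε : ℝ => ‖h‖ * (ε + θ * (‖h‖ + ε))) := by fun_prop
      exact (this.tendsto 0).mono_left nhdsWithin_le_nhds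
    refine ge_of_tendsto ht ?_
    filter_upwards [self_mem_nhdsWithin] with ε hε using key ε hε
  have : ‖h‖ ^ 2 ≤ 0 := by nlinarith [sq_nonneg ‖h‖]
  have : ‖h‖ = 0 := by nlinarith [norm_nonneg h]
  exact norm_eq_zero.1 this
theorem cm2 (T0 T1 : V →ₗ[ℝ] H) {C : ℝ} (hC : 0 ≤ C)
    (hs : ∀ s : ℝ, 0 ≤ s → s ≤ 1 → ∀ φ, ‖T1 φ - T0 φ‖ ≤ C * ‖(1 - s) • T0 φ + s • T1 φ‖)
    (hd : (LinearMap.range T0).topologicalClosure = ⊤) :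
    (LinearMap.range T1).topologicalClosure = ⊤ := by
  obtain ⟨m, hm⟩ := exists_nat_gt C
  have hm0 : (0 : ℝ) < m := lt_of_le_of_lt hC hm
  set S : ℝ → (V →ₗ[ℝ] H) := fun s => (1 - s) • T0 + s • T1 with hS
  have hk : ∀ k : ℕ, k ≤ m → (LinearMap.range (S (k / m))).topologicalClosure = ⊤ := by
    intro k
    induction k with
    | zero => intro _; simpa [hS] using hd
    | succ k ih =>
      intro hkm
      have hkm' : (k : ℝ) ≤ m := by exact_mod_cast (Nat.le_of_succ_le hkm)
      refine cm1 (S (k / m)) _ (θ := C / m) (by positivity) ((div_lt_one hm0).2 hm) (fun φ => ?_)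
        (ih (Nat.le_of_succ_le hkm))
      have e1 : S (k / m) φ - S ((k + 1 : ℕ) / m) φ = (-(1 / (m : ℝ))) • (T1 φ - T0 φ) := by
        simp only [hS, LinearMap.add_apply, LinearMap.smul_apply]
        push_cast
        rw [add_div]
        module
      rw [e1, norm_smul, norm_neg, Real.norm_eq_abs, abs_of_pos (by positivity)]
      have := hs (k / m) (by positivity) ((div_le_one hm0).2 hkm') φ
      calc 1 / (m : ℝ) * ‖T1 φ - T0 φ‖ ≤ 1 / m * (C * ‖S (k / m) φ‖) :=
            mll this (by positivity)
        _ = _ := by ring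
  have := hk m le_rfl
  rw [div_self hm0.ne'] at this
  simpa [hS] using this
end cm
section appr
variable {n : ℕ}
theorem Lb_add (σ : ℝ) (b : ℝ → Mx n) {u v : Fu n} (hu : Sm u) (hv : Sm v) (p : G n) :
    Lb σ b (fun p => u p + v p) p = Lb σ b u p + Lb σ b v p := by
  have h2 : ∀ e f : G n, Dd e (Dd f (fun p => u p + v p)) p = Dd e (Dd f u) p + Dd e (Dd f v) p := by
    intro e f
    rw [show Dd f (fun p => u p + v p) = fun p => Dd f u p + Dd f v p from funext fun p => dd_add hu hv f p,
      dd_add (hu.dd f) (hv.dd f)]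
  simp only [Lb, pdt_eq, pdxx_eq, h2, dd_add hu hv, mul_add, Finset.sum_add_distrib]
  ring
theorem Lb_cmul (σ : ℝ) (b : ℝ → Mx n) {u : Fu n} (hu : Sm u) (c : ℝ) (p : G n) :
    Lb σ b (fun p => c * u p) p = c * Lb σ b u p := by
  have h2 : ∀ e f : G n, Dd e (Dd f (fun p => c * u p)) p = c * Dd e (Dd f u) p := by
    intro e f
    rw [show Dd f (fun p => c * u p) = fun p => c * Dd f u p from funext fun p => dd_cmul hu c f p,
      dd_cmul (hu.dd f)]
  simp only [Lb, pdt_eq, pdxx_eq, h2, dd_cmul hu, mul_add, Finset.mul_sum]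
  congr 1
  · ring
  · refine SC fun j _ => SC fun k _ => ?_
    ring
theorem Lb_sub (σ : ℝ) (b : ℝ → Mx n) {u v : Fu n} (hu : Sm u) (hv : Sm v) (p : G n) :
    Lb σ b (fun p => u p - v p) p = Lb σ b u p - Lb σ b v p := by
  have : (fun p => u p - v p) = fun p => u p + (-1) * v p := by funext p; ring
  rw [this, Lb_add σ b hu (hv.cmul (-1)), Lb_cmul σ b hv]; ring
theorem BC.memLp {f : Fu n} (hf : BC f) : MemLp f 2 volume := by
  rw [memLp_two_iff_integrable_sq hf.1.1.aestronglyMeasurable]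
  exact hf.sq.integrable
def VV (n : ℕ) : Submodule ℝ (Fu n) where
  carrier := {u | Cc u}
  add_mem' := fun ha hb => ha.add hb
  zero_mem' := ⟨contDiff_const, HasCompactSupport.zero⟩
  smul_mem' := fun c u hu => hu.cmul c
noncomputable def TT {δ : ℝ} (hδ : 0 < δ) {b : ℝ → Mx n} (hb : Ell δ b) :
    VV n →ₗ[ℝ] Lp ℝ 2 (volume : Measure (G n)) where
  toFun := fun φ => (Lb_BC hδ hb 1 φ.2).memLp.toLp
  map_add' := fun φ ψ => by
    rw [← MemLp.toLp_add]
    congr 1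
    funext p
    exact Lb_add 1 b φ.2.sm ψ.2.sm p
  map_smul' := fun c φ => by
    simp only [RingHom.id_apply]
    rw [← MemLp.toLp_const_smul]
    congr 1
    funext p
    exact Lb_cmul 1 b φ.2.sm c p
theorem norm_toLp {f : Fu n} (hf : MemLp f 2 volume) : ‖hf.toLp‖ ^ 2 = ∫ p, f p ^ 2 := by
  rw [← real_inner_self_eq_norm_sq, L2.inner_def]
  refine integral_congr_ae ?_
  filter_upwards [hf.coeFn_toLp] with p hp
  rw [hp]; simp [pow_two]
theorem ell_conv {δ : ℝ} {b b' : ℝ → Mx n} (hb : Ell δ b) (hb' : Ell δ b')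
    {s : ℝ} (h0 : 0 ≤ s) (h1 : s ≤ 1) : Ell δ (fun x j k => (1 - s) * b x j k + s * b' x j k) := by
  have e : ∀ x (θ : Fi n → ℝ), ∑ j, ∑ k, ((1 - s) * b x j k + s * b' x j k) * θ j * θ k
      = (1 - s) * (∑ j, ∑ k, b x j k * θ j * θ k) + s * (∑ j, ∑ k, b' x j k * θ j * θ k) := by
    intro x θ
    simp only [Finset.mul_sum, ← Finset.sum_add_distrib]
    refine SC fun j _ => SC fun k _ => ?_
    ring
  constructor
  · intro j k; exact ((hb.meas j k).const_mul _).add ((hb'.meas j k).const_mul _)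
  · intro x j k; rw [hb.symm, hb'.symm]
  · intro x θ; rw [e]; nlinarith [hb.low x θ, hb'.low x θ]
  · intro x θ; rw [e]; nlinarith [hb.upp x θ, hb'.upp x θ]
theorem Lb_conv {b b' : ℝ → Mx n} (s : ℝ) (u : Fu n) (p : G n) :
    Lb 1 (fun x j k => (1 - s) * b x j k + s * b' x j k) u p = (1 - s) * Lb 1 b u p + s * Lb 1 b' u p := by
  have : ∑ j, ∑ k, ((1 - s) * b (p.2 0) j k + s * b' (p.2 0) j k) * pdxx j k u p
      = (1 - s) * (∑ j, ∑ k, b (p.2 0) j k * pdxx j k u p) + s * ∑ j, ∑ k, b' (p.2 0) j k * pdxx j k u p := by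
    simp only [Finset.mul_sum, ← Finset.sum_add_distrib]
    refine SC fun j _ => SC fun k _ => ?_
    ring
  simp only [Lb]; rw [this]; ring
theorem sq_sum2 (F : Mx n) :
    (∑ j, ∑ k, F j k) ^ 2 ≤ ((n + 1 : ℝ) ^ 2) * ∑ j, ∑ k, F j k ^ 2 := by
  have h := sq_sum_le_card_mul_sum_sq (s := (Finset.univ : Finset (Fi n × Fi n)))
    (f := fun x => F x.1 x.2)
  rw [← Finset.univ_product_univ, Finset.sum_product, Finset.sum_product] at h
  simpa [pow_two] using h
theorem Lb_diff (n : ℕ) {δ : ℝ} (hδ : 0 < δ) : ∃ C > 0, ∀ b b', Ell δ b → Ell δ b' → ∀ b'', Ell δ b'' →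
    ∀ u : Fu n, Cc u → ∫ p, (Lb 1 b u p - Lb 1 b' u p) ^ 2 ≤ C * ∫ p, Lb 1 b'' u p ^ 2 := by
  obtain ⟨N, hN, hB⟩ := B1 n hδ
  refine ⟨(n+1:ℝ)^2 * (2*δ⁻¹)^2 * ((n+1)^2 * N), by positivity, fun b b' hb hb' b'' hb'' u hu => ?_⟩
  have hBC : ∀ j k, BC (fun p => pdxx j k u p ^ 2) := fun j k => (hu.pdxx j k).bc.sq
  have hBCs : BC (fun p => ∑ j, ∑ k, pdxx j k u p ^ 2) := BC.sum _ fun j => BC.sum _ fun k => hBC j k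
  calc ∫ p, (Lb 1 b u p - Lb 1 b' u p) ^ 2
      ≤ ∫ p, (n+1:ℝ)^2 * (2*δ⁻¹)^2 * ∑ j, ∑ k, pdxx j k u p ^ 2 := by
        refine integral_mono ((Lb_BC hδ hb 1 hu).sub (Lb_BC hδ hb' 1 hu)).sq.integrable
          (hBCs.cmul _).integrable fun p => ?_
        have e : Lb 1 b u p - Lb 1 b' u p = ∑ j, ∑ k, (b (p.2 0) j k - b' (p.2 0) j k) * pdxx j k u p := by
          simp only [Lb, sub_mul, Finset.sum_sub_distrib]; ring
        simp only
        rw [e, mul_assoc]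
        refine (sq_sum2 _).trans (mll ?_ (by positivity))
        simp only [Finset.mul_sum]
        refine Finset.sum_le_sum fun j _ => Finset.sum_le_sum fun k _ => ?_
        rw [mul_pow]
        refine mlr ?_ (sq_nonneg _)
        have a1 := abs_le.1 (hb.abs hδ (p.2 0) j k)
        have a2 := abs_le.1 (hb'.abs hδ (p.2 0) j k)
        exact sq_le_sq' (by linarith) (by linarith)
    _ = (n+1:ℝ)^2 * (2*δ⁻¹)^2 * ∑ j, ∑ k, ∫ p, pdxx j k u p ^ 2 := by
        rw [integral_const_mul, integral_finsetSum _ fun j _ => (BC.sum _ fun k => hBC j k).integrable]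
        congr 1
        refine SC fun j _ => ?_
        rw [integral_finsetSum _ fun k _ => (hBC j k).integrable]
    _ ≤ (n+1:ℝ)^2 * (2*δ⁻¹)^2 * ∑ j : Fi n, ∑ k : Fi n, N * ∫ p, Lb 1 b'' u p ^ 2 := by
        gcongr with j _ k _
        exact (hB b'' hb'' u hu).2 j k
    _ = _ := by simp; ring
theorem approx {δ : ℝ} (hδ : 0 < δ) (hδ1 : δ ≤ 1) {b : ℝ → Mx n} (hb : Ell δ b)
    {g : Fu n} (hg : MemLp g 2 volume) {ε : ℝ} (hε : 0 < ε) :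
    ∃ φ, Cc φ ∧ ∫ p, (Lb 1 b φ p - g p) ^ 2 ≤ ε := by
  have hI := ell_bI (n := n) hδ hδ1
  obtain ⟨C, hC, hD⟩ := Lb_diff n hδ
  have hd0 : (LinearMap.range (TT hδ hI)).topologicalClosure = ⊤ := by
    rw [Submodule.topologicalClosure_eq_top_iff, Submodule.eq_bot_iff]
    intro h hh
    rw [Submodule.mem_orthogonal] at hh
    have := liouville (Lp.memLp h) (fun φ hφ => by
      have h1 := hh _ ⟨⟨φ, hφ⟩, rfl⟩
      rw [L2.inner_def] at h1
      rw [← h1]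
      refine integral_congr_ae ?_
      filter_upwards [(Lb_BC hδ hI 1 hφ).memLp.coeFn_toLp] with p hp
      simp only [TT, LinearMap.coe_mk, AddHom.coe_mk]
      rw [hp]; simp)
    exact (Lp.eq_zero_iff_ae_eq_zero).2 this
  have hd1 : (LinearMap.range (TT hδ hb)).topologicalClosure = ⊤ := by
    refine cm2 (TT hδ hI) (TT hδ hb) (C := Real.sqrt C) (Real.sqrt_nonneg _) (fun s h0 h1 φ => ?_) hd0
    have hs := ell_conv hI hb h0 h1
    have e1 : TT hδ hb φ - TT hδ hI φ
        = ((Lb_BC hδ hb 1 φ.2).memLp.sub (Lb_BC hδ hI 1 φ.2).memLp).toLp := by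
      rw [MemLp.toLp_sub (Lb_BC hδ hb 1 φ.2).memLp (Lb_BC hδ hI 1 φ.2).memLp]; rfl
    have e2 : (1 - s) • TT hδ hI φ + s • TT hδ hb φ = TT hδ hs φ := by
      have : TT hδ hs φ = (((Lb_BC hδ hI 1 φ.2).memLp.const_smul (1-s)).add
          ((Lb_BC hδ hb 1 φ.2).memLp.const_smul s)).toLp := by
        simp only [TT, LinearMap.coe_mk, AddHom.coe_mk]
        congr 1
        funext p
        exact Lb_conv s φ.1 p
      rw [this, MemLp.toLp_add ((Lb_BC hδ hI 1 φ.2).memLp.const_smul (1-s)) ((Lb_BC hδ hb 1 φ.2).memLp.const_smul s),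
        MemLp.toLp_const_smul _ (Lb_BC hδ hI 1 φ.2).memLp, MemLp.toLp_const_smul _ (Lb_BC hδ hb 1 φ.2).memLp]; rfl
    rw [e1, e2]
    refine abs_le_of_sq_le_sq' ?_ (by positivity) |>.2
    rw [mul_pow, Real.sq_sqrt hC.le, norm_toLp]
    simp only [TT, LinearMap.coe_mk, AddHom.coe_mk]
    rw [norm_toLp]
    exact hD b (bI n) hb hI _ hs φ.1 φ.2
  have hcl : hg.toLp ∈ closure (LinearMap.range (TT hδ hb) : Set (Lp ℝ 2 (volume : Measure (G n)))) := by
    have : hg.toLp ∈ (LinearMap.range (TT hδ hb)).topologicalClosure := by rw [hd1]; trivial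
    exact this
  obtain ⟨y, ⟨φ, rfl⟩, hy⟩ := Metric.mem_closure_iff.1 hcl (Real.sqrt ε) (Real.sqrt_pos.2 hε)
  refine ⟨φ.1, φ.2, ?_⟩
  rw [dist_comm, dist_eq_norm] at hy
  have e1 : TT hδ hb φ - hg.toLp = ((Lb_BC hδ hb 1 φ.2).memLp.sub hg).toLp := by
    rw [MemLp.toLp_sub (Lb_BC hδ hb 1 φ.2).memLp hg]; rfl
  have e2 := norm_toLp ((Lb_BC hδ hb 1 φ.2).memLp.sub hg)
  rw [← e1] at e2
  have : ‖TT hδ hb φ - hg.toLp‖ ^ 2 ≤ ε := by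
    rw [← Real.sq_sqrt hε.le]
    exact pow_le_pow_left₀ (norm_nonneg _) hy.le 2
  rw [e2] at this
  exact this
end appr
end KK
namespace KK
section mo
variable {n : ℕ}
abbrev G' (n : ℕ) := ℝ × (Fin n → ℝ)
noncomputable def io (n : ℕ) : G' n →L[ℝ] G n :=
  (ContinuousLinearMap.fst ℝ ℝ (Fin n → ℝ)).prod
    (ContinuousLinearMap.pi fun j => Fin.cases (0 : G' n →L[ℝ] ℝ)
      (fun i => (ContinuousLinearMap.proj i).comp (ContinuousLinearMap.snd ℝ ℝ (Fin n → ℝ))) j)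
theorem io_fst (q : G' n) : (io n q).1 = q.1 := rfl
theorem io_zero (q : G' n) : (io n q).2 0 = 0 := rfl
theorem io_succ (q : G' n) (i : Fin n) : (io n q).2 i.succ = q.2 i := rfl
noncomputable def pr (n : ℕ) : G n →L[ℝ] G' n :=
  (ContinuousLinearMap.fst ℝ ℝ (Fi n → ℝ)).prod
    (ContinuousLinearMap.pi fun i : Fin n => (ContinuousLinearMap.proj i.succ).comp
      (ContinuousLinearMap.snd ℝ ℝ (Fi n → ℝ)))
theorem pr_io (q : G' n) : pr n (io n q) = q := rfl
theorem io_norm (q : G' n) : ‖io n q‖ ≤ ‖q‖ := by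
  rw [Prod.norm_def, Prod.norm_def]
  refine max_le_max (le_of_eq rfl) ?_
  rw [pi_norm_le_iff_of_nonneg (norm_nonneg _)]
  intro j
  refine Fin.cases ?_ (fun i => ?_) j
  · rw [io_zero]; simp
  · rw [io_succ]; exact norm_le_pi_norm _ i
noncomputable def mo (k : G' n → ℝ) (w : Fu n) : Fu n := fun p => ∫ q, k q * w (p - io n q)
theorem mo_sm {k : G' n → ℝ} {w : Fu n} (hk : Cc k) (hw : Cc w) : Sm (mo k w) := by
  have e : mo k w = cv (Measure.map (io n) volume) (fun p => k (pr n p)) w := by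
    funext p
    unfold mo cv
    rw [integral_map (io n).continuous.measurable.aemeasurable]
    · simp only [pr_io]
    · refine Continuous.aestronglyMeasurable ?_
      exact (hk.sm.cont.comp (pr n).continuous).mul (hw.sm.cont.comp (by fun_prop))
  rw [e]
  refine cv_sm (Integrable.locallyIntegrable ?_) hw
  refine (integrable_map_measure (hk.sm.cont.comp (pr n).continuous).aestronglyMeasurable
    (io n).continuous.measurable.aemeasurable).2 ?_
  exact hk.integrable
theorem BC.meas {E : Type*} [NormedAddCommGroup E] [MeasurableSpace E] {f : E → ℝ} (hf : BC f) : Measurable f := hf.1.1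
theorem mo_int {k : G' n → ℝ} {w : Fu n} (hk : Cc k) (hw : BM w) (p : G n) :
    Integrable (fun q => k q * w (p - io n q)) := by
  obtain ⟨C, hC⟩ := hw.2
  have := integrable_bdd_mul (m := volume) (c := fun q => w (p - io n q)) (hk.integrable (m := volume))
    (hw.1.comp (by fun_prop)) (fun q => hC _)
  simpa [mul_comm] using this
theorem mo_dd {k : G' n → ℝ} {w : Fu n} (hk : Cc k) (hw : Cc w) (e : G n) :
    Dd e (mo k w) = mo k (Dd e w) := by
  funext p
  have h1 : HasLineDerivAt ℝ (mo k w) (Dd e (mo k w) p) p e := (mo_sm hk hw).hasLine e p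
  obtain ⟨C, hC⟩ := (hw.dd e).2.exists_bound_of_continuous (hw.dd e).sm.cont
  have h2 : HasDerivAt (fun s : ℝ => mo k w (p + s • e)) (mo k (Dd e w) p) 0 := by
    have := hasDerivAt_integral_of_dominated_loc_of_deriv_le (μ := (volume : Measure (G' n)))
      (F := fun (s : ℝ) q => k q * w (p + s • e - io n q))
      (F' := fun (s : ℝ) q => k q * Dd e w (p + s • e - io n q)) (x₀ := 0) (s := Set.univ)
      (bound := fun q => C * |k q|) Filter.univ_mem
      (evf fun s => (mo_int hk hw.bc.1 _).1)
      (mo_int hk hw.bc.1 _) (mo_int hk (hw.dd e).bc.1 _).1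
      (evf fun q s _ => ?_) (hk.integrable.abs.const_mul C)
      (evf fun q s _ => ?_)
    · have h3 := this.2
      simpa [mo] using h3
    · rw [norm_mul, mul_comm]
      exact mlr (hC _) (norm_nonneg _)
    · have h4 : HasDerivAt (fun s : ℝ => p + s • e - io n q) e s := by
        simpa using (((hasDerivAt_id s).smul_const e).const_add p).sub_const (io n q)
      exact ((hw.sm.diff (p + s • e - io n q)).hasFDerivAt.comp_hasDerivAt s h4).const_mul (k q)
  exact HasDerivAt.unique h1 h2
theorem mo_ibp {k : G' n → ℝ} {w : Fu n} (hk : Cc k) (hw : Cc w) (e : G' n) :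
    mo k (Dd (io n e) w) = mo (Dd e k) w := by
  funext p
  have hs : Sm (fun q => w ((-(io n)) q + p)) := hw.1.comp ((-(io n)).contDiff.add contDiff_const)
  have hF : Cc (fun q => k q * w ((-(io n)) q + p)) := hk.mul_right hs
  have h := int_dd (m := volume) (e := e) hF
  have e1 : ∀ q, Dd e (fun q => k q * w ((-(io n)) q + p)) q
      = Dd e k q * w (p - io n q) - k q * Dd (io n e) w (p - io n q) := by
    intro q
    rw [dd_mul hk.sm hs, dd_comp_affine hw.sm]
    have : (-(io n)) q + p = p - io n q := by simp; abel
    simp only [this]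
    have e2 : Dd ((-(io n)) e) w (p - io n q) = - Dd (io n e) w (p - io n q) := by simp [Dd]
    rw [e2]; ring
  simp only [e1] at h
  rw [integral_sub (mo_int (hk.dd e) hw.bc.1 p) (mo_int hk (hw.dd _).bc.1 p)] at h
  unfold mo
  linarith
theorem mo_Lb {δ : ℝ} (hδ : 0 < δ) {b : ℝ → Mx n} (hb : Ell δ b) {k : G' n → ℝ}
    {w : Fu n} (hk : Cc k) (hw : Cc w) : Lb 1 b (mo k w) = mo k (Lb 1 b w) := by
  funext p
  have h2 : ∀ j l, pdxx j l (mo k w) = mo k (pdxx j l w) := fun j l => by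
    rw [pdxx_eq, mo_dd hk hw, mo_dd hk (hw.dd _)]; rfl
  have h1 : pdt (mo k w) = mo k (pdt w) := mo_dd hk hw et
  have hz : ∀ q, (p - io n q).2 0 = p.2 0 := fun q => by simp [io_zero]
  have e0 : mo k (Lb 1 b w) p = ∫ q, (k q * (1 * pdt w (p - io n q))
      + ∑ j, ∑ l, k q * (b (p.2 0) j l * pdxx j l w (p - io n q))) := by
    unfold mo
    congr 1; funext q
    simp only [Lb, hz, mul_add, Finset.mul_sum]
  rw [e0]
  simp only [Lb, h1, h2]
  unfold mo
  simp only [← integral_const_mul]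
  have i2 : ∀ j l, Integrable fun q => k q * (b (p.2 0) j l * pdxx j l w (p - io n q)) := fun j l => by
    have := (mo_int hk (hw.pdxx j l).bc.1 p).const_mul (b (p.2 0) j l)
    refine this.congr (evf fun q => ?_)
    simp only; ring
  have i1 : Integrable fun q => k q * (1 * pdt w (p - io n q)) := by
    simpa using mo_int hk hw.pdt.bc.1 p
  rw [integral_add i1 (integrable_finsetSum _ fun j _ => integrable_finsetSum _ fun l _ => i2 j l),
    integral_finsetSum _ fun j _ => integrable_finsetSum _ fun l _ => i2 j l]
  congr 1
  · congr 1; funext q; ring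
  · refine SC fun j _ => ?_
    rw [integral_finsetSum _ fun l _ => i2 j l]
    refine SC fun l _ => ?_
    congr 1; funext q; ring
theorem mo_cs {k : G' n → ℝ} {f : Fu n} (hk : Cc k) (hf : BM f) (p : G n) :
    mo k f p ^ 2 ≤ (∫ q, |k q|) * ∫ q, |k q| * f (p - io n q) ^ 2 := by
  obtain ⟨C, hC⟩ := hf.2
  have ik : Integrable (fun q => |k q|) (volume : Measure (G' n)) := hk.integrable.abs
  have i1 : Integrable (fun q => |k q| * |f (p - io n q)|) (volume : Measure (G' n)) := by
    have := (mo_int hk hf p).abs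
    simpa only [abs_mul] using this
  have i2 : Integrable (fun q => |k q| * f (p - io n q) ^ 2) (volume : Measure (G' n)) := by
    have := (mo_int hk (w := fun q => f q ^ 2) ⟨hf.1.pow_const 2, C ^ 2, fun q => by
      rw [abs_pow]; exact pow_le_pow_left₀ (abs_nonneg _) (hC q) 2⟩ p).abs
    simpa only [abs_mul, abs_pow, sq_abs] using this
  set K := ∫ q, |k q|
  set c := ∫ q, |k q| * |f (p - io n q)| with hc
  set I := ∫ q, |k q| * f (p - io n q) ^ 2 with hI
  have hq : ∀ s : ℝ, 0 ≤ K * (s * s) + (-2 * c) * s + I := by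
    intro s
    have : K * (s * s) + (-2 * c) * s + I = ∫ q, |k q| * (|f (p - io n q)| - s) ^ 2 := by
      have e : ∀ q, |k q| * (|f (p - io n q)| - s) ^ 2 = (s * s) * |k q| + (-2 * s) * (|k q| * |f (p - io n q)|)
          + |k q| * f (p - io n q) ^ 2 := by
        intro q; rw [← sq_abs (f (p - io n q))]; ring
      simp only [e]
      rw [integral_add (f := fun q => s * s * |k q| + -2 * s * (|k q| * |f (p - (io n) q)|)) ((ik.const_mul _).add (i1.const_mul _)) i2, integral_add (ik.const_mul _) (i1.const_mul _),
        integral_const_mul, integral_const_mul]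
      ring
    rw [this]
    exact integral_nonneg fun q => mul_nonneg (abs_nonneg _) (sq_nonneg _)
  have hd := discrim_le_zero hq
  unfold discrim at hd
  have h1 : |mo k f p| ≤ c := by
    unfold mo
    refine (abs_integral_le_integral_abs).trans (le_of_eq ?_)
    simp only [abs_mul, hc]
  have : mo k f p ^ 2 ≤ c ^ 2 := by
    rw [← sq_abs]; exact pow_le_pow_left₀ (abs_nonneg _) h1 2
  nlinarith
theorem mo_EE {k : G' n → ℝ} {f : Fu n} (hk : Cc k) (hf : BC f) {θ η : ℝ}
    (hs : ∀ q, k q ≠ 0 → ‖q‖ < η) :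
    EE θ (mo k f) ≤ (∫ q, |k q|) ^ 2 * EE (θ + η) f := by
  obtain ⟨C, hC⟩ := hf.1.2
  set K := ∫ q, |k q| with hK
  have hK0 : 0 ≤ K := integral_nonneg fun q => abs_nonneg _
  have ik : Integrable (fun q => |k q|) (volume : Measure (G' n)) := hk.integrable.abs
  have hfin : IsFiniteMeasure ((volume : Measure (G n)).restrict (Metric.ball 0 θ)) :=
    ⟨by rw [Measure.restrict_apply_univ]; exact measure_ball_lt_top⟩
  have hint : Integrable (Function.uncurry fun (p : G n) (q : G' n) => |k q| * f (p - io n q) ^ 2)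
      (((volume : Measure (G n)).restrict (Metric.ball 0 θ)).prod volume) := by
    have hd : Integrable (fun z : G n × G' n => C ^ 2 * |k z.2|)
        (((volume : Measure (G n)).restrict (Metric.ball 0 θ)).prod volume) :=
      Integrable.mul_prod (integrable_const (C ^ 2)) ik
    refine hd.mono' ?_ (evf fun z => ?_)
    · refine Measurable.aestronglyMeasurable ?_
      refine ((hk.sm.cont.measurable.comp measurable_snd).abs).mul ((hf.meas.comp ?_).pow_const 2)
      exact measurable_fst.sub ((io n).continuous.measurable.comp measurable_snd)
    · simp only [Function.uncurry, norm_mul, norm_pow, Real.norm_eq_abs, abs_abs]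
      rw [mul_comm]
      exact mlr (pow_le_pow_left₀ (abs_nonneg _) (hC _) 2) (abs_nonneg _)
  have h1 : EE θ (mo k f) ≤ ∫ p in Bl n θ, K * ∫ q, |k q| * f (p - io n q) ^ 2 := by
    unfold EE
    refine integral_mono_of_nonneg (evf fun p => sq_nonneg _) ?_
      (evf fun p => mo_cs hk hf.1 p)
    exact hint.integral_prod_left.const_mul K
  have h2 : ∀ q, |k q| * ∫ p in Bl n θ, f (p - io n q) ^ 2 ≤ |k q| * EE (θ + η) f := by
    intro q
    by_cases hq : k q = 0
    · simp [hq]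
    · refine mll ?_ (abs_nonneg _)
      have hq' := hs q hq
      have e1 : ∫ p in Bl n θ, f (p - io n q) ^ 2
          = ∫ p, (Bl n θ).indicator (fun p => f (p - io n q) ^ 2) p :=
        (integral_indicator measurableSet_ball).symm
      have e2 := integral_add_right_eq_self (μ := (volume : Measure (G n)))
        ((Bl n θ).indicator (fun p => f (p - io n q) ^ 2)) (io n q)
      rw [e1, ← e2]
      unfold EE
      rw [← integral_indicator measurableSet_ball]
      refine integral_mono_of_nonneg (evf fun p => ?_)
        (hf.sq.integrable.indicator measurableSet_ball) (evf fun p => ?_)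
      · simp only [Pi.zero_apply]
        exact Set.indicator_nonneg (fun _ _ => sq_nonneg _) _
      · simp only
        by_cases hp : p + io n q ∈ Bl n θ
        · rw [Set.indicator_of_mem hp, Set.indicator_of_mem]
          · simp
          · rw [Metric.mem_ball, dist_zero_right] at hp ⊢
            have := norm_sub_le (p + io n q) (io n q)
            rw [add_sub_cancel_right] at this
            linarith [io_norm q]
        · rw [Set.indicator_of_notMem hp]
          exact Set.indicator_nonneg (fun _ _ => sq_nonneg _) _
  calc EE θ (mo k f) ≤ _ := h1
    _ = K * ∫ q, ∫ p in Bl n θ, |k q| * f (p - io n q) ^ 2 := by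
        rw [integral_const_mul, integral_integral_swap hint]
    _ ≤ K * ∫ q, |k q| * EE (θ + η) f := by
        refine mll (integral_mono hint.integral_prod_right
          (ik.mul_const _) fun q => ?_) hK0
        simp only [Function.uncurry]
        rw [integral_const_mul]
        exact h2 q
    _ = _ := by rw [integral_mul_const]; ring
theorem mo_close {f : Fu n} (hf : Cc f) {τ : ℝ} (hτ : 0 < τ) : ∃ η0 > 0, ∀ k : G' n → ℝ, Cc k →
    (∀ q, 0 ≤ k q) → ∫ q, k q = 1 → (∀ q, k q ≠ 0 → ‖q‖ < η0) → ∀ p, |mo k f p - f p| ≤ τ := by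
  have huc := hf.2.uniformContinuous_of_continuous hf.sm.cont
  rw [Metric.uniformContinuous_iff] at huc
  obtain ⟨η0, h0, huc⟩ := huc τ hτ
  refine ⟨η0, h0, fun k hk k0 k1 ks p => ?_⟩
  have e : mo k f p - f p = ∫ q, (k q * f (p - io n q) - k q * f p) := by
    rw [integral_sub (mo_int hk hf.bc.1 p) (hk.integrable.mul_const _), integral_mul_const, k1, one_mul]
    rfl
  rw [e]
  refine abs_integral_le_integral_abs.trans ?_
  calc _ ≤ ∫ q, k q * τ := by
        refine integral_mono ((mo_int hk hf.bc.1 p).sub (hk.integrable.mul_const _)).abs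
          (hk.integrable.mul_const _) fun q => ?_
        simp only [Pi.sub_apply]
        rw [← mul_sub, abs_mul, abs_of_nonneg (k0 q)]
        by_cases hq : k q = 0
        · simp [hq]
        · refine mll ?_ (k0 q)
          have : dist (p - io n q) p < η0 := by
            rw [dist_eq_norm]; simp
            exact lt_of_le_of_lt (io_norm q) (ks q hq)
          exact (huc this).le
    _ = τ := by rw [integral_mul_const, k1, one_mul]
theorem exists_kernel (n : ℕ) {η : ℝ} (hη : 0 < η) : ∃ k : G' n → ℝ, Cc k ∧ (∀ q, 0 ≤ k q) ∧ ∫ q, k q = 1 ∧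
    ∀ q, k q ≠ 0 → ‖q‖ < η := by
  let B : ContDiffBump (0 : G' n) := ⟨η / 2, η, by positivity, by linarith⟩
  refine ⟨B.normed volume, ⟨B.contDiff_normed, B.hasCompactSupport_normed⟩, B.nonneg_normed, B.integral_normed,
    fun q hq => ?_⟩
  have : q ∈ Function.support (B.normed volume) := hq
  rw [B.support_normed_eq] at this
  simpa using this
end mo
end KK
namespace KK
section dl
variable {E : Type*} [NormedAddCommGroup E] [NormedSpace ℝ E]
noncomputable def DL : List E → (E → ℝ) → E → ℝ
  | [], u => u
  | e :: l, u => DL l (Dd e u)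
theorem Sm.dl {u : E → ℝ} (h : Sm u) (l : List E) : Sm (DL l u) := by
  induction l generalizing u with
  | nil => exact h
  | cons e l ih => exact ih (h.dd e)
theorem Cc.dl {u : E → ℝ} (h : Cc u) (l : List E) : Cc (DL l u) := by
  induction l generalizing u with
  | nil => exact h
  | cons e l ih => exact ih (h.dd e)
theorem dl_comm {u : E → ℝ} (h : Sm u) (l : List E) (e : E) : DL l (Dd e u) = Dd e (DL l u) := by
  induction l generalizing u with
  | nil => rfl
  | cons f l ih => 
    show DL l (Dd f (Dd e u)) = Dd e (DL l (Dd f u))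
    rw [dd_comm h, ih (h.dd f)]
theorem dl_append (l l' : List E) (u : E → ℝ) : DL (l ++ l') u = DL l' (DL l u) := by
  induction l generalizing u with
  | nil => rfl
  | cons f l ih => exact ih _
theorem dl_add {u v : E → ℝ} (h : Sm u) (h' : Sm v) (l : List E) :
    DL l (fun p => u p + v p) = fun p => DL l u p + DL l v p := by
  induction l generalizing u v with
  | nil => rfl
  | cons f l ih =>
    show DL l (Dd f (fun p => u p + v p)) = fun p => DL l (Dd f u) p + DL l (Dd f v) p
    rw [← ih (h.dd f) (h'.dd f)]
    congr 1; funext p; exact dd_add h h' f p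
end dl
theorem sob_space {m : ℕ} (l : List (Fin m)) (hl : l.Nodup) (F : (Fin m → ℝ) → ℝ) (hF : Cc F)
    (x : Fin m → ℝ) : ‖F x‖ₑ ≤ (lmarginal (fun _ => (volume : Measure ℝ)) l.toFinset
      (fun y => ‖DL (l.map fun i => Pi.single i 1) F y‖ₑ)) x := by
  induction l generalizing F x with
  | nil => simp [DL]
  | cons i l ih =>
    rw [List.nodup_cons] at hl
    rw [List.toFinset_cons, lmarginal_insert _ ((hF.dl _).sm.cont.enorm.measurable)
      (by simpa using hl.1)]
    set g : ℝ → ℝ := fun s => F (Function.update x i s) with hg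
    have hup : ∀ s : ℝ, Function.update x i s
        = Function.update x i 0 + s • (Pi.single i 1 : Fin m → ℝ) := by
      intro s; funext j
      by_cases hj : j = i
      · subst hj; simp
      · simp [hj]
    have hgd : ∀ s, HasDerivAt g (Dd (Pi.single i 1) F (Function.update x i s)) s := by
      intro s
      have h4 : HasDerivAt (fun s : ℝ => Function.update x i s) (Pi.single i 1 : Fin m → ℝ) s := by
        have : (fun s : ℝ => Function.update x i s)
          = fun s => Function.update x i 0 + s • (Pi.single i 1 : Fin m → ℝ) := funext hup
        rw [this]
        simpa using (((hasDerivAt_id s).smul_const (Pi.single i 1 : Fin m → ℝ)).const_add (Function.update x i 0))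
      exact (hF.sm.diff _).hasFDerivAt.comp_hasDerivAt s h4
    have hgc : ContDiff ℝ 1 g := by
      have : ContDiff ℝ ∞ g := by
        have e : g = fun s => F (Function.update x i 0 + s • (Pi.single i 1 : Fin m → ℝ)) := by
          funext s; simp only [hg]; rw [hup]
        rw [e]
        exact hF.1.comp (contDiff_const.add (contDiff_id.smul contDiff_const))
      exact this.of_le (by exact_mod_cast le_top)
    have hgs : HasCompactSupport g := by
      have hcl : Topology.IsClosedEmbedding (fun s : ℝ => Function.update x i s) := by
        have : Function.LeftInverse (fun y : Fin m → ℝ => y i) (fun s : ℝ => Function.update x i s) := by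
          intro s; simp
        exact this.isClosedEmbedding (continuous_apply i) (by fun_prop)
      exact hF.2.comp_isClosedEmbedding hcl
    have h1 := hgs.enorm_le_lintegral_Ici_deriv hgc (x i)
    have e0 : g (x i) = F x := by simp [hg]
    rw [e0] at h1
    refine h1.trans ((setLIntegral_le_lintegral _ _).trans (lintegral_mono fun s => ?_))
    rw [(hgd s).deriv]
    exact ih hl.2 _ (hF.dd _) _
theorem dl_slice {n : ℕ} (t : ℝ) (l : List (Fi n)) {F : Fu n} (hF : Sm F) (x : Fi n → ℝ) :
    DL (l.map fun i => Pi.single i 1) (fun y => F (t, y)) x = DL (l.map ex) F (t, x) := by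
  induction l generalizing F with
  | nil => rfl
  | cons i l ih =>
    show DL (l.map fun i => Pi.single i 1) (Dd (Pi.single i 1) fun y => F (t, y)) x
      = DL (l.map ex) (Dd (ex i) F) (t, x)
    rw [← ih (hF.dd _)]
    congr 1
    have := dd_comp_affine hF (ContinuousLinearMap.inr ℝ ℝ (Fi n → ℝ)) (t, 0) (Pi.single i 1)
    simp only [ContinuousLinearMap.inr_apply, Prod.mk_add_mk, zero_add, add_zero] at this
    exact this
def I0 (n : ℕ) : List (G n) := (List.finRange (n+1)).map ex ++ [et]
theorem sobolev {n : ℕ} {F : Fu n} (hF : Cc F) (p : G n) : |F p| ≤ ∫ q, |DL (I0 n) F q| := by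
  have hD := hF.dl (I0 n)
  set H := DL ((List.finRange (n+1)).map ex) F with hH
  have hHc : Cc H := hF.dl _
  have eI : DL (I0 n) F = Dd et H := by unfold I0; rw [dl_append]; rfl
  have key : ‖F p‖ₑ ≤ ∫⁻ q, ‖DL (I0 n) F q‖ₑ := by
    have hs : Cc (fun y => F (p.1, y)) := by
      refine ⟨hF.1.comp (contDiff_const.prodMk contDiff_id), ?_⟩
      have : Function.LeftInverse (fun y : G n => y.2) (fun y => (p.1, y)) := fun s => rfl
      exact hF.2.comp_isClosedEmbedding (this.isClosedEmbedding continuous_snd (by fun_prop))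
    have h1 := sob_space (List.finRange (n+1)) (List.nodup_finRange _) _ hs p.2
    have eu : (List.finRange (n+1)).toFinset = Finset.univ := by ext; simp
    rw [eu, lmarginal_univ] at h1
    simp only [dl_slice _ _ hF.sm] at h1
    rw [eI, Measure.volume_eq_prod, lintegral_prod_symm _ ((hHc.dd et).sm.cont.enorm.measurable.aemeasurable)]
    refine h1.trans (lintegral_mono fun x => ?_)
    set g : ℝ → ℝ := fun s => H (s, x) with hg
    have hgd : ∀ s, HasDerivAt g (Dd et H (s, x)) s := by
      intro s
      have h4 : HasDerivAt (fun s : ℝ => ((s, x) : G n)) et s :=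
        (hasDerivAt_id s).prodMk (hasDerivAt_const s x)
      exact (hHc.sm.diff _).hasFDerivAt.comp_hasDerivAt s h4
    have hgc : ContDiff ℝ 1 g := (hHc.1.comp (contDiff_id.prodMk contDiff_const)).of_le (by exact_mod_cast le_top)
    have hgs : HasCompactSupport g := by
      have : Function.LeftInverse (fun y : G n => y.1) (fun s => (s, x)) := fun s => rfl
      exact hHc.2.comp_isClosedEmbedding (this.isClosedEmbedding continuous_fst (by fun_prop))
    have h2 := hgs.enorm_le_lintegral_Ici_deriv hgc p.1
    refine h2.trans ((setLIntegral_le_lintegral _ _).trans (lintegral_mono fun s => ?_))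
    rw [(hgd s).deriv]
  have h3 := ofReal_integral_norm_eq_lintegral_enorm (hD.integrable (m := volume))
  rw [← h3, Real.enorm_eq_ofReal_abs, ENNReal.ofReal_le_ofReal_iff (integral_nonneg fun _ => norm_nonneg _)] at key
  exact key
end KK
namespace KK
theorem cs_gen {α : Type*} [MeasurableSpace α] (m : Measure α) [IsFiniteMeasure m] {f : α → ℝ}
    (h1 : Integrable f m) (h2 : Integrable (fun p => f p ^ 2) m) :
    ∫ p, |f p| ∂m ≤ √(m.real Set.univ) * √(∫ p, f p ^ 2 ∂m) := by
  set c := ∫ p, |f p| ∂m with hc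
  set I := ∫ p, f p ^ 2 ∂m with hI
  have hq : ∀ s : ℝ, 0 ≤ m.real Set.univ * (s * s) + (-2 * c) * s + I := by
    intro s
    have : m.real Set.univ * (s * s) + (-2 * c) * s + I = ∫ p, (|f p| - s) ^ 2 ∂m := by
      have e : ∀ p, (|f p| - s) ^ 2 = (s * s + (-2 * s) * |f p|) + f p ^ 2 := by
        intro q; rw [← sq_abs (f q)]; ring
      simp only [e]
      rw [integral_add (f := fun p => s * s + (-2 * s) * |f p|) ((integrable_const _).add (h1.abs.const_mul _)) h2,
        integral_add (integrable_const _) (h1.abs.const_mul _), integral_const, smul_eq_mul, integral_const_mul]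
      simp only [hc, hI]; ring
    rw [this]
    exact integral_nonneg fun q => sq_nonneg _
  have hd := discrim_le_zero hq
  unfold discrim at hd
  rw [← Real.sqrt_mul measureReal_nonneg]
  refine Real.le_sqrt_of_sq_le ?_
  nlinarith
section lei
variable {n : ℕ}
theorem cs_ball {θ : ℝ} {f : Fu n} (hf : LM f) {s : Set (G n)} (hs : s ⊆ Metric.ball 0 θ)
    (hm : MeasurableSet s) :
    ∫ p in s, |f p| ≤ √((volume s).toReal) * √(EE θ f) := by
  have hfin : IsFiniteMeasure ((volume : Measure (G n)).restrict s) :=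
    ⟨by rw [Measure.restrict_apply_univ]; exact (measure_mono hs).trans_lt measure_ball_lt_top⟩
  have := cs_gen ((volume : Measure (G n)).restrict s) (f := f) ((hf.intOn θ).mono_set hs) ((hf.sq.intOn θ).mono_set hs)
  refine this.trans ?_
  rw [measureReal_restrict_apply_univ]
  refine mll (Real.sqrt_le_sqrt ?_) (Real.sqrt_nonneg _)
  exact setIntegral_mono_set (hf.sq.intOn θ) (evf fun _ => sq_nonneg _)
    (evf hs)
theorem leibniz {θ : ℝ} (I : List (G n)) (χ : Fu n) (hχ : Cc χ) (hs : tsupport χ ⊆ Metric.ball 0 θ) :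
    ∃ C : ℝ, 0 ≤ C ∧ ∀ h : Fu n, Sm h → ∀ M : ℝ, (∀ J : List (G n), J.Sublist I → EE θ (DL J h) ≤ M) →
      ∫ p, |DL I (fun p => χ p * h p) p| ≤ C * √M := by
  induction I generalizing χ with
  | nil =>
    obtain ⟨K, hK0, hK⟩ := bd_one hχ
    refine ⟨K * √((volume (Bl n θ)).toReal), by positivity, fun h hh M hM => ?_⟩
    have h1 : ∫ p, |χ p * h p| ≤ ∫ p in Bl n θ, K * |h p| := by
      refine int_le_set (hχ.mul_right hh).bc.abs (hh.lm.abs.cmul K) (fun p hp => by simp [zero_out hs p hp]) fun p => ?_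
      rw [abs_mul]; exact mlr (hK p) (abs_nonneg _)
    rw [integral_const_mul] at h1
    refine h1.trans ?_
    rw [mul_assoc]
    refine mll ((cs_ball hh.lm le_rfl measurableSet_ball).trans ?_) hK0.le
    exact mll (Real.sqrt_le_sqrt (hM [] (by simp))) (Real.sqrt_nonneg _)
  | cons e I ih =>
    obtain ⟨C1, h1, H1⟩ := ih χ hχ hs
    obtain ⟨C2, h2, H2⟩ := ih (Dd e χ) (hχ.dd e) (dd_zero hs e)
    refine ⟨C1 + C2, by positivity, fun h hh M hM => ?_⟩
    have a1 := H1 (Dd e h) (hh.dd e) M fun J hJ => hM (e :: J) (hJ.cons_cons e)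
    have a2 := H2 h hh M fun J hJ => hM J (hJ.cons e)
    have e1 : DL (e :: I) (fun p => χ p * h p) = fun p => DL I (fun p => χ p * Dd e h p) p + DL I (fun p => Dd e χ p * h p) p := by
      rw [← dl_add (hχ.sm.mul (hh.dd e)) ((hχ.dd e).sm.mul hh)]
      show DL I (Dd e _) = _
      congr 1; funext p; exact dd_mul hχ.sm hh e p
    rw [e1]
    have c1 := (hχ.mul_right (hh.dd e)).dl I
    have c2 := ((hχ.dd e).mul_right hh).dl I
    calc _ ≤ ∫ p, (|DL I (fun p => χ p * Dd e h p) p| + |DL I (fun p => Dd e χ p * h p) p|) :=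
          (c1.add c2).bc.abs.mono (c1.bc.abs.add c2.bc.abs) fun p => abs_add_le _ _
      _ = _ := c1.bc.abs.int_add c2.bc.abs
      _ ≤ _ := by rw [add_mul]; exact add_le_add a1 a2
theorem sup_bd (n : ℕ) {θ1 θ2 : ℝ} (h1 : 0 < θ1) (h2 : θ1 < θ2) : ∃ C : ℝ, 0 ≤ C ∧ ∀ h : Fu n, Sm h →
    ∀ M : ℝ, (∀ J : List (G n), J.Sublist (I0 n) → EE θ2 (DL J h) ≤ M) →
    ∀ p ∈ Bl n θ1, |h p| ≤ C * √M := by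
  obtain ⟨χ, hχ, hχ1, -, hs⟩ := cutoff n h1 h2
  obtain ⟨C, hC, H⟩ := leibniz (I0 n) χ hχ hs
  refine ⟨C, hC, fun h hh M hM p hp => ?_⟩
  have := sobolev (hχ.mul_right hh) p
  simp only [hχ1 p hp, one_mul] at this
  exact this.trans (H h hh M hM)
def TD (e : G n) : Prop := e = et ∨ ∃ j : Fi n, j ≠ 0 ∧ e = ex j
def TL (l : List (G n)) : Prop := ∀ e ∈ l, TD e
theorem interior (n : ℕ) {δ : ℝ} (hδ : 0 < δ) (K : ℕ) : ∀ {θ1 θ2 : ℝ}, 0 < θ1 → θ1 < θ2 → ∃ C : ℝ, 1 ≤ C ∧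
    ∀ b : ℝ → Mx n, Ell δ b → ∀ f : Fu n, Sm f → ∀ M : ℝ, EE θ2 f ≤ M →
    (∀ l, TL l → l.length ≤ K → EE θ2 (Lb 1 b (DL l f)) ≤ M) →
    ∀ l, TL l → l.length ≤ K → EE θ1 (DL l f) ≤ C * M := by
  induction K with
  | zero =>
    intro θ1 θ2 h1 h2
    refine ⟨1, le_rfl, fun b hb f hf M hM _ l _ hl => ?_⟩
    have : l = [] := List.eq_nil_of_length_eq_zero (by omega)
    subst this
    rw [one_mul]
    exact (EE_mono h2.le hf.lm).trans hM
  | succ K ih =>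
    intro θ1 θ2 h1 h2
    have hm1 : θ1 < (θ1 + θ2) / 2 := by linarith
    have hm2 : (θ1 + θ2) / 2 < θ2 := by linarith
    obtain ⟨C, hC, H⟩ := ih h1 hm1
    obtain ⟨N, hN, HN⟩ := C2 n hδ (h1.trans hm1) hm2
    refine ⟨C * (1 + 2 * N), by nlinarith, fun b hb f hf M hM hL l hl hlen => ?_⟩
    have hM0 : 0 ≤ M := (EE_nonneg _ _).trans hM
    cases l with
    | nil =>
      refine ((EE_mono h2.le hf.lm).trans hM).trans ?_
      exact le_mul_of_one_le_left hM0 (by nlinarith)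
    | cons e l =>
      obtain ⟨g1, g2, -⟩ := HN b hb f hf
      have hL0 := hL [] (by simp [TL]) (by simp)
      have hL0' : EE θ2 (Lb 1 b f) ≤ M := hL0
      have he : EE ((θ1 + θ2) / 2) (Dd e f) ≤ (1 + 2 * N) * M := by
        have : N * (EE θ2 f + EE θ2 (Lb 1 b f)) ≤ N * (M + M) := by gcongr
        rcases hl e (by simp) with rfl | ⟨j, -, rfl⟩
        · rw [← pdt_eq]; linarith
        · linarith [g1 j]
      have := H b hb (Dd e f) (hf.dd e) ((1 + 2 * N) * M) he ?_ l (fun e' h' => hl e' (by simp [h'])) (by simp at hlen; omega)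
      · rw [mul_assoc]; exact this
      · intro l' hl' hlen'
        have h3 := hL (e :: l') (by
          intro e' h'
          rcases List.mem_cons.1 h' with rfl | h'
          · exact hl _ (by simp)
          · exact hl' _ h') (by simp; omega)
        refine (EE_mono hm2.le (Lb_LM hδ hb 1 ((hf.dd e).dl l'))).trans (h3.trans ?_)
        exact le_mul_of_one_le_left hM0 (by linarith)
theorem int_sup (n : ℕ) {δ : ℝ} (hδ : 0 < δ) {θ1 θ2 : ℝ} (h1 : 0 < θ1) (h2 : θ1 < θ2) : ∃ C : ℝ, 0 ≤ C ∧
    ∀ b : ℝ → Mx n, Ell δ b → ∀ f : Fu n, Sm f → ∀ M : ℝ, EE θ2 f ≤ M →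
    (∀ l, TL l → l.length ≤ n + 3 → EE θ2 (Lb 1 b (DL l f)) ≤ M) →
    ∀ l, TL l → l.length ≤ 1 → ∀ p ∈ Bl n θ1,
      |DL l f p| ≤ C * √M ∧ |Dd (ex 0) (DL l f) p| ≤ C * √M := by
  set a1 := θ1 + (θ2 - θ1) / 3 with ha1
  set a2 := θ1 + 2 * (θ2 - θ1) / 3 with ha2
  have q1 : θ1 < a1 := by rw [ha1]; linarith
  have q2 : a1 < a2 := by rw [ha1, ha2]; linarith
  have q3 : a2 < θ2 := by rw [ha2]; linarith
  obtain ⟨C, hC, H⟩ := interior n hδ (n + 3) (by linarith : (0:ℝ) < a2) q3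
  obtain ⟨N, hN, HN⟩ := C2 n hδ (by linarith : (0:ℝ) < a1) q2
  obtain ⟨S, hS, HS⟩ := sup_bd n h1 q1
  set K := C + N * (C + 1) with hK
  have hCK : C ≤ K := by rw [hK]; nlinarith
  refine ⟨S * √K, by positivity, fun b hb f hf M hM hL l hl hlen p hp => ?_⟩
  have hM0 : 0 ≤ M := (EE_nonneg _ _).trans hM
  have b0 := H b hb f hf M hM hL
  have base : ∀ l, TL l → l.length ≤ n + 3 → EE a1 (DL l f) ≤ K * M ∧ EE a1 (Dd (ex 0) (DL l f)) ≤ K * M ∧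
      EE a1 (Dd (ex 0) (Dd (ex 0) (DL l f))) ≤ K * M := by
    intro l hl hlen
    have c0 := b0 l hl hlen
    obtain ⟨g1, -, g3⟩ := HN b hb (DL l f) (hf.dl l)
    have c1 : EE a2 (Lb 1 b (DL l f)) ≤ M := (EE_mono q3.le (Lb_LM hδ hb 1 (hf.dl l))).trans (hL l hl hlen)
    have c2 : N * (EE a2 (DL l f) + EE a2 (Lb 1 b (DL l f))) ≤ K * M := by
      have : N * (EE a2 (DL l f) + EE a2 (Lb 1 b (DL l f))) ≤ N * (C * M + M) := by gcongr
      refine this.trans ?_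
      rw [hK]; nlinarith
    refine ⟨(EE_mono q2.le (hf.dl l).lm).trans (c0.trans (mlr hCK hM0)), (g1 0).trans c2, ?_⟩
    rw [← pdxx_eq]; exact (g3 0 0).trans c2
  have hI0 : I0 n = ex 0 :: (((List.finRange n).map fun i => ex i.succ) ++ [et]) := by
    unfold I0; rw [List.finRange_succ]; simp [Function.comp_def]
  have hsub : ∀ J : List (G n), J.Sublist (I0 n) → (TL J ∧ J.length ≤ n + 1) ∨ ∃ J', J = ex 0 :: J' ∧ TL J' ∧ J'.length ≤ n + 1 := by
    intro J hJ
    rw [hI0] at hJ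
    have tl : TL (((List.finRange n).map fun i => (ex i.succ : G n)) ++ [et]) := by
      intro e he
      rcases List.mem_append.1 he with he | he
      · obtain ⟨i, -, rfl⟩ := List.mem_map.1 he
        exact Or.inr ⟨i.succ, Fin.succ_ne_zero i, rfl⟩
      · exact Or.inl (by simpa using he)
    have good : ∀ J' : List (G n), J'.Sublist (((List.finRange n).map fun i => (ex i.succ : G n)) ++ [et]) → TL J' ∧ J'.length ≤ n + 1 :=
      fun J' h' => ⟨fun e he => tl e (h'.subset he), by simpa using h'.length_le⟩
    cases hJ with
    | cons _ h => exact Or.inl (good _ h)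
    | cons_cons _ h => exact Or.inr ⟨_, rfl, good _ h⟩
  have tapp : ∀ J, TL J → J.length ≤ n + 1 → TL (l ++ J) ∧ (l ++ J).length ≤ n + 3 := fun J h h' =>
    ⟨fun e he => (List.mem_append.1 he).elim (hl e) (h e), by simp; omega⟩
  have sq : S * √(K * M) = S * √K * √M := by rw [Real.sqrt_mul (by linarith)]; ring
  constructor
  · rw [← sq]
    refine HS _ (hf.dl l) _ (fun J hJ => ?_) p hp
    rcases hsub J hJ with ⟨t1, t2⟩ | ⟨J', rfl, t1, t2⟩
    · rw [← dl_append]; exact (base _ (tapp J t1 t2).1 (tapp J t1 t2).2).1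
    · show EE a1 (DL J' (Dd (ex 0) (DL l f))) ≤ _
      rw [dl_comm (hf.dl l), ← dl_append]; exact (base _ (tapp _ t1 t2).1 (tapp _ t1 t2).2).2.1
  · rw [← sq]
    refine HS _ ((hf.dl l).dd _) _ (fun J hJ => ?_) p hp
    rcases hsub J hJ with ⟨t1, t2⟩ | ⟨J', rfl, t1, t2⟩
    · rw [dl_comm (hf.dl l), ← dl_append]; exact (base _ (tapp J t1 t2).1 (tapp J t1 t2).2).2.1
    · show EE a1 (DL J' (Dd (ex 0) (Dd (ex 0) (DL l f)))) ≤ _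
      rw [dl_comm ((hf.dl l).dd _), dl_comm (hf.dl l), ← dl_append]; exact (base _ (tapp _ t1 t2).1 (tapp _ t1 t2).2).2.2
end lei
end KK
open scoped ContDiff Pointwise
namespace KK
section geo
theorem ballC_eq {d : ℕ} (r : ℝ) (hr : 0 < r) (x : Fin d → ℝ) :
    ballC r x = (fun y => x + y) '' (r • ballC 1 (0 : Fin d → ℝ)) := by
  ext y
  simp only [ballC, Set.mem_image, Set.mem_smul_set, Set.mem_ofPred_eq]
  constructor
  · intro h
    refine ⟨y - x, ⟨r⁻¹ • (y - x), ?_, by rw [smul_smul, mul_inv_cancel₀ hr.ne', one_smul]⟩, by abel⟩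
    have : ∑ j, ((r⁻¹ • (y - x)) j - (0 : Fin d → ℝ) j) ^ 2 = (r⁻¹) ^ 2 * ∑ j, (y j - x j) ^ 2 := by
      rw [Finset.mul_sum]; refine SC fun j _ => ?_
      simp; ring
    rw [this, inv_pow, inv_mul_lt_iff₀ (by positivity)]
    simpa using h
  · rintro ⟨_, ⟨w, hw, rfl⟩, rfl⟩
    have : ∑ j, ((x + r • w) j - x j) ^ 2 = r ^ 2 * ∑ j, (w j - (0 : Fin d → ℝ) j) ^ 2 := by
      rw [Finset.mul_sum]; refine SC fun j _ => ?_
      simp; ring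
    rw [this]
    have h2 : 0 < r ^ 2 := by positivity
    nlinarith
theorem ballC_open {d : ℕ} (r : ℝ) (x : Fin d → ℝ) : IsOpen (ballC r x) :=
  isOpen_lt (by fun_prop) continuous_const
theorem ballC_sub {d : ℕ} {r : ℝ} (hr : 0 ≤ r) {x y : Fin d → ℝ} (h : y ∈ ballC r x) (j : Fin d) : |y j - x j| < r := by
  refine abs_lt_of_sq_lt_sq ?_ hr
  exact lt_of_le_of_lt (Finset.single_le_sum (f := fun j => (y j - x j) ^ 2) (fun _ _ => sq_nonneg _) (Finset.mem_univ j)) h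
theorem ballC_bdd {d : ℕ} {r : ℝ} (hr : 0 < r) (x : Fin d → ℝ) : ballC r x ⊆ Metric.ball x r := by
  intro y hy
  rw [Metric.mem_ball, dist_pi_lt_iff hr]
  intro j; rw [Real.dist_eq]; exact ballC_sub hr.le hy j
theorem vol_ballC {d : ℕ} {r : ℝ} (hr : 0 < r) (x : Fin d → ℝ) :
    (volume (ballC r x)).toReal = r ^ d * (volume (ballC 1 (0 : Fin d → ℝ))).toReal := by
  rw [ballC_eq r hr x, Set.image_add_left, measure_preimage_add, Measure.addHaar_smul, ENNReal.toReal_mul]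
  simp [abs_of_pos hr]
  left; positivity
theorem vol_ballC_fin {d : ℕ} {r : ℝ} (hr : 0 < r) (x : Fin d → ℝ) : volume (ballC r x) < ⊤ :=
  (measure_mono (ballC_bdd hr x)).trans_lt measure_ball_lt_top
theorem vol_ballC_pos {d : ℕ} {r : ℝ} (hr : 0 < r) (x : Fin d → ℝ) : 0 < (volume (ballC r x)).toReal := by
  refine ENNReal.toReal_pos ?_ (vol_ballC_fin hr x).ne
  refine ((ballC_open r x).measure_pos volume ⟨x, ?_⟩).ne'
  simp [ballC]; positivity
noncomputable def vQ (d : ℕ) : ℝ := (volume (ballC 1 (0 : Fin d → ℝ))).toReal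
theorem vQ_pos (d : ℕ) : 0 < vQ d := vol_ballC_pos one_pos _
theorem vol_Q {d : ℕ} {r : ℝ} (hr : 0 < r) (z : ℝ × (Fin d → ℝ)) :
    (volume (Qcyl r z)).toReal = r ^ (d + 2) * vQ d := by
  unfold Qcyl
  rw [Measure.volume_eq_prod, Measure.prod_prod, ENNReal.toReal_mul, vol_ballC hr, Real.volume_Ioo]
  rw [ENNReal.toReal_ofReal (by nlinarith [sq_nonneg r])]
  unfold vQ; ring
theorem Q_open {d : ℕ} (r : ℝ) (z : ℝ × (Fin d → ℝ)) : IsOpen (Qcyl r z) := isOpen_Ioo.prod (ballC_open _ _)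
theorem vol_Q_fin {d : ℕ} {r : ℝ} (hr : 0 < r) (z : ℝ × (Fin d → ℝ)) : volume (Qcyl r z) < ⊤ := by
  unfold Qcyl
  rw [Measure.volume_eq_prod, Measure.prod_prod]
  exact ENNReal.mul_lt_top (by simp) (vol_ballC_fin hr _)
noncomputable def Ps (n : ℕ) : (G' n × ℝ) ≃ᵐ G n :=
  (MeasurableEquiv.prodAssoc).trans ((MeasurableEquiv.refl ℝ).prodCongr
    (MeasurableEquiv.prodComm.trans (MeasurableEquiv.piFinSuccAbove (fun _ : Fi n => ℝ) 0).symm))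
theorem Ps_apply {n : ℕ} (y : G' n) (τ : ℝ) : Ps n (y, τ) = (y.1, Fin.cons τ y.2) := by
  have : Ps n (y, τ) = (y.1, Fin.insertNth (α := fun _ => ℝ) 0 τ y.2) := rfl
  rw [this, Fin.insertNth_zero]
  rfl
theorem Ps_mp (n : ℕ) : MeasurePreserving (Ps n) volume volume := by
  have h1 : MeasurePreserving (MeasurableEquiv.prodAssoc : (ℝ × (Fin n → ℝ)) × ℝ ≃ᵐ ℝ × ((Fin n → ℝ) × ℝ)) volume volume :=
    volume_preserving_prodAssoc
  have h2 := (volume_preserving_piFinSuccAbove (fun _ : Fi n => ℝ) 0).symm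
  have h3 : MeasurePreserving (MeasurableEquiv.prodComm : (Fin n → ℝ) × ℝ ≃ᵐ ℝ × (Fin n → ℝ)) volume volume :=
    Measure.measurePreserving_swap
  have h4 := (MeasurePreserving.id (volume : Measure ℝ)).prod (h2.comp h3)
  exact h4.comp h1
theorem Ps_io {n : ℕ} (y : G' n) (τ : ℝ) : Ps n (y, τ) = io n y + τ • ex 0 := by
  rw [Ps_apply]
  refine Prod.ext ?_ ?_
  · simp [io_fst, ex]
  · funext j
    refine Fin.cases ?_ (fun i => ?_) j
    · simp [io_zero, ex]
    · simp [io_succ, ex]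
end geo
end KK
namespace KK
section grad
variable {n : ℕ}
noncomputable def W (i : Option (Fi n × Fin n)) (u : Fu n) : Fu n :=
  match i with
  | none => pdt u
  | some jk => pdxx jk.1 jk.2.succ u
theorem td_ex (k : Fin n) : TD (ex k.succ : G n) := Or.inr ⟨k.succ, Fin.succ_ne_zero k, rfl⟩
theorem td_et : TD (et : G n) := Or.inl rfl
theorem tl_cons {e : G n} {l : List (G n)} (he : TD e) (hl : TL l) : TL (e :: l) := by
  intro e' h'
  rcases List.mem_cons.1 h' with rfl | h'
  · exact he
  · exact hl _ h'
theorem tl_nil : TL ([] : List (G n)) := by simp [TL]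
theorem gradW (n : ℕ) {δ : ℝ} (hδ : 0 < δ) : ∃ C : ℝ, 0 < C ∧
    ∀ b : ℝ → Mx n, Ell δ b → ∀ z : Fu n, Sm z → ∀ M : ℝ,
    EE (3/4) (pdt z) ≤ M → (∀ j k, EE (3/4) (pdxx j k z) ≤ M) →
    (∀ l, TL l → l.length ≤ n + 5 → EE (3/4) (Lb 1 b (DL l z)) ≤ M) →
    ∀ i, ∀ p ∈ Bl n (1/4), (∀ e, TD e → |Dd e (W i z) p| ≤ C * √M) ∧
      |Dd (ex 0) (W i z) p| ≤ C * √M + C * ∑ k : Fin n, |Lb 1 b (Dd (ex k.succ) z) p| := by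
  obtain ⟨C, hC, H⟩ := int_sup n hδ (by norm_num : (0:ℝ) < 1/4) (by norm_num : (1/4:ℝ) < 3/4)
  set m : ℝ := (n + 1 : ℝ) with hm
  set C' := (1 + C) + δ⁻¹ * (1 + (C + m * m * (δ⁻¹ * C))) with hC'
  have hδ' : 0 < δ⁻¹ := by positivity
  have hm0 : 0 < m := by positivity
  have c1 : C ≤ C' := by rw [hC']; nlinarith [mul_nonneg (mul_nonneg hm0.le hm0.le) (mul_nonneg hδ'.le hC), mul_pos hδ' one_pos, mul_nonneg hδ'.le hC, mul_nonneg hδ'.le (mul_nonneg (mul_nonneg hm0.le hm0.le) (mul_nonneg hδ'.le hC))]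
  have c2 : δ⁻¹ * (C + m * m * (δ⁻¹ * C)) ≤ C' := by rw [hC']; nlinarith
  have c3 : δ⁻¹ ≤ C' := by rw [hC']; nlinarith [mul_nonneg (mul_nonneg hm0.le hm0.le) (mul_nonneg hδ'.le hC), mul_nonneg hδ'.le hC, mul_nonneg hδ'.le (mul_nonneg (mul_nonneg hm0.le hm0.le) (mul_nonneg hδ'.le hC))]
  have hC'0 : 0 < C' := lt_of_lt_of_le hδ' c3
  refine ⟨C', hC'0, fun b hb z hz M hM1 hM2 hL i p hp => ?_⟩
  have sM := Real.sqrt_nonneg M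
  set S := ∑ k : Fin n, |Lb 1 b (Dd (ex k.succ) z) p| with hS
  have hS0 : 0 ≤ S := SN fun _ _ => abs_nonneg _
  have up : ∀ x : ℝ, x ≤ C * √M → x ≤ C' * √M := fun x hx => hx.trans (mlr c1 sM)
  have up' : ∀ x : ℝ, x ≤ C * √M → x ≤ C' * √M + C' * S := fun x hx =>
    (up x hx).trans (le_add_of_nonneg_right (mul_nonneg hC'0.le hS0))
  have F1 : ∀ l, TL l → l.length ≤ 1 → |DL l (pdt z) p| ≤ C * √M ∧ |Dd (ex 0) (DL l (pdt z)) p| ≤ C * √M :=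
    fun l hl hlen => H b hb (pdt z) (hz.dd _) M hM1 (fun l hl hlen => hL (et :: l) (tl_cons td_et hl) (by simp; omega)) l hl hlen p hp
  have F2 : ∀ j k : Fin n, ∀ l, TL l → l.length ≤ 1 → |DL l (pdxx j.succ k.succ z) p| ≤ C * √M ∧
      |Dd (ex 0) (DL l (pdxx j.succ k.succ z)) p| ≤ C * √M :=
    fun j k l hl hlen => H b hb (pdxx j.succ k.succ z) ((hz.dd _).dd _) M (hM2 _ _)
      (fun l hl hlen => hL (ex k.succ :: ex j.succ :: l) (tl_cons (td_ex k) (tl_cons (td_ex j) hl)) (by simp; omega)) l hl hlen p hp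
  have td1 : ∀ e : G n, TD e → TL [e] := fun e he => tl_cons he tl_nil
  match i with
  | none =>
    exact ⟨fun e he => up _ (F1 [e] (td1 e he) (by simp)).1, up' _ (F1 [] tl_nil (by simp)).2⟩
  | some (j, k) =>
    refine Fin.cases ?_ (fun j => ?_) j
    · -- normal-tangential
      have G1 : ∀ e, TD e → |Dd e (Dd (ex 0) (Dd (ex k.succ) z)) p| ≤ C * √M := by
        intro e he
        rw [dd_comm (hz.dd _)]
        rcases he with rfl | ⟨i, hi, rfl⟩
        · rw [dd_comm hz]
          exact (F1 [ex k.succ] (td1 _ (td_ex k)) (by simp)).2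
        · obtain ⟨i, rfl⟩ := Fin.exists_succ_eq.2 hi
          exact (F2 i k [] tl_nil (by simp)).2
      refine ⟨fun e he => up _ (G1 e he), ?_⟩
      show |Dd (ex 0) (Dd (ex 0) (Dd (ex k.succ) z)) p| ≤ _
      set v := Dd (ex k.succ) z with hv
      have hvS : Sm v := hz.dd _
      have eL : Lb 1 b v p = pdt v p + ∑ i, ∑ j, b (p.2 0) i j * pdxx i j v p := by simp [Lb]
      have tt : |pdt v p| ≤ C * √M := by
        rw [pdt_eq, hv, dd_comm hz]
        exact (F1 [ex k.succ] (td1 _ (td_ex k)) (by simp)).1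
      have ts : ∀ i (j : Fin n), |pdxx i j.succ v p| ≤ C * √M := by
        intro i j
        rw [pdxx_eq, hv, dd_comm (hz.dd _), dd_comm (hz)]
        refine Fin.cases ?_ (fun i => ?_) i
        · have := G1 (ex j.succ) (td_ex j)
          rwa [dd_comm hz] 
        · rw [dd_comm ((hz.dd _)), dd_comm hz, dd_comm (hz.dd _), dd_comm hz]
          exact (F2 j k [ex i.succ] (td1 _ (td_ex i)) (by simp)).1
      have hbb : ∀ i j, |b (p.2 0) i j| ≤ δ⁻¹ := fun i j => hb.abs hδ _ i j
      set T := δ⁻¹ * (C * √M) with hT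
      have hT0 : 0 ≤ T := by positivity
      have tb : ∀ i j, ¬ (i = 0 ∧ j = 0) → |b (p.2 0) i j * pdxx i j v p| ≤ T := by
        intro i j hij
        rw [abs_mul]
        refine mul_le_mul (hbb i j) ?_ (abs_nonneg _) hδ'.le
        by_cases hj : j = 0
        · have hi : i ≠ 0 := fun h => hij ⟨h, hj⟩
          obtain ⟨i, rfl⟩ := Fin.exists_succ_eq.2 hi
          rw [pdxx_comm hvS]; exact ts _ _
        · obtain ⟨j, rfl⟩ := Fin.exists_succ_eq.2 hj
          exact ts _ _
      have e1 : b (p.2 0) 0 0 * pdxx 0 0 v p = Lb 1 b v p - pdt v p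
          - ∑ i, ∑ j, (if i = 0 ∧ j = 0 then 0 else b (p.2 0) i j * pdxx i j v p) := by
        have e2 : ∑ i, ∑ j, b (p.2 0) i j * pdxx i j v p
            = ∑ i, ∑ j, (if i = 0 ∧ j = 0 then 0 else b (p.2 0) i j * pdxx i j v p)
              + ∑ i : Fi n, ∑ j : Fi n, (if i = 0 ∧ j = 0 then b (p.2 0) 0 0 * pdxx 0 0 v p else 0) := by
          rw [← Finset.sum_add_distrib]
          refine SC fun i _ => ?_
          rw [← Finset.sum_add_distrib]
          refine SC fun j _ => ?_
          by_cases h : i = 0 ∧ j = 0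
          · obtain ⟨rfl, rfl⟩ := h; simp
          · simp [h]
        have e3 : ∑ i : Fi n, ∑ j : Fi n, (if i = 0 ∧ j = 0 then b (p.2 0) 0 0 * pdxx 0 0 v p else 0)
            = b (p.2 0) 0 0 * pdxx 0 0 v p := by
          simp [ite_and]
        rw [eL, e2, e3]; ring
      have e4 : |∑ i, ∑ j, (if i = 0 ∧ j = 0 then 0 else b (p.2 0) i j * pdxx i j v p)| ≤ m * m * T := by
        refine (Finset.abs_sum_le_sum_abs _ _).trans ?_
        have : ∀ i : Fi n, |∑ j, (if i = 0 ∧ j = 0 then 0 else b (p.2 0) i j * pdxx i j v p)| ≤ m * T := by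
          intro i
          refine (Finset.abs_sum_le_sum_abs _ _).trans ?_
          refine (Finset.sum_le_card_nsmul _ _ T fun j _ => ?_).trans (le_of_eq (by simp [hm]))
          by_cases h : i = 0 ∧ j = 0
          · simp [h, hT0]
          · rw [if_neg h]; exact tb i j h
        refine (Finset.sum_le_card_nsmul _ _ (m * T) fun i _ => this i).trans (le_of_eq (by simp [hm]; ring))
      have hLS : |Lb 1 b v p| ≤ S := by
        rw [hS]
        exact Finset.single_le_sum (f := fun k : Fin n => |Lb 1 b (Dd (ex k.succ) z) p|) (fun _ _ => abs_nonneg _) (Finset.mem_univ k)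
      have e5 : |b (p.2 0) 0 0 * pdxx 0 0 v p| ≤ S + C * √M + m * m * T := by
        rw [e1]
        exact (abs_sub _ _).trans (add_le_add ((abs_sub _ _).trans (add_le_add hLS tt)) e4)
      have b0 := (hb.diag hδ (p.2 0) 0).1
      rw [abs_mul, abs_of_pos (lt_of_lt_of_le hδ b0)] at e5
      rw [← pdxx_eq]
      have e6 : δ * |pdxx 0 0 v p| ≤ S + C * √M + m * m * T :=
        (mlr b0 (abs_nonneg _)).trans e5
      have e7 : |pdxx 0 0 v p| ≤ δ⁻¹ * (S + C * √M + m * m * T) := by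
        rw [← div_eq_inv_mul, le_div_iff₀ hδ]; linarith
      calc _ ≤ _ := e7
        _ = δ⁻¹ * (C + m * m * (δ⁻¹ * C)) * √M + δ⁻¹ * S := by rw [hT]; ring
        _ ≤ _ := add_le_add (mlr c2 sM) (mlr c3 hS0)
    · exact ⟨fun e he => up _ (F2 j k [e] (td1 e he) (by simp)).1, up' _ (F2 j k [] tl_nil (by simp)).2⟩
end grad
end KK
namespace KK
section poinc
variable {n : ℕ}
def Bx (n : ℕ) (ρ : ℝ) : Set (G n) := Set.Ioo (-ρ ^ 2) (ρ ^ 2) ×ˢ Set.pi Set.univ fun _ => Set.Ioo (-ρ) ρ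
def Bx' (n : ℕ) (ρ : ℝ) : Set (G' n) := Set.Ioo (-ρ ^ 2) (ρ ^ 2) ×ˢ Set.pi Set.univ fun _ => Set.Ioo (-ρ) ρ
theorem Bx_meas (n : ℕ) (ρ : ℝ) : MeasurableSet (Bx n ρ) :=
  measurableSet_Ioo.prod (MeasurableSet.univ_pi fun _ => measurableSet_Ioo)
theorem Bx'_meas (n : ℕ) (ρ : ℝ) : MeasurableSet (Bx' n ρ) :=
  measurableSet_Ioo.prod (MeasurableSet.univ_pi fun _ => measurableSet_Ioo)
theorem Bx_pre (n : ℕ) (ρ : ℝ) : Ps n ⁻¹' Bx n ρ = Bx' n ρ ×ˢ Set.Ioo (-ρ) ρ := by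
  ext ⟨y, τ⟩
  simp only [Set.mem_preimage, Ps_apply, Bx, Bx', Set.mem_prod, Set.mem_pi, Set.mem_univ, true_imp_iff]
  rw [Fin.forall_fin_succ]
  simp only [Fin.cons_zero, Fin.cons_succ]
  tauto
theorem vol_Bx {ρ : ℝ} (hρ : 0 < ρ) : (volume (Bx n ρ)).toReal = 2 ^ (n+2) * ρ ^ (n+3) := by
  unfold Bx
  rw [Measure.volume_eq_prod, Measure.prod_prod, ENNReal.toReal_mul, Real.volume_Ioo, Real.volume_pi_Ioo_toReal (fun _ => by linarith),
    ENNReal.toReal_ofReal (by nlinarith)]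
  simp; ring
theorem Bx_sub {ρ : ℝ} (hρ : 0 < ρ) (h : ρ ≤ 1/4) : Bx n ρ ⊆ Metric.ball 0 (1/4) := by
  intro p hp
  rw [Metric.mem_ball, dist_zero_right, Prod.norm_def, max_lt_iff, pi_norm_lt_iff (by norm_num)]
  constructor
  · rw [Real.norm_eq_abs, abs_lt]; constructor <;> nlinarith [hp.1.1, hp.1.2]
  · intro j; rw [Real.norm_eq_abs, abs_lt]
    have := hp.2 j trivial
    constructor <;> linarith [this.1, this.2]
theorem Q_sub_Bx {ρ : ℝ} (hρ : 0 < ρ) : Qcyl ρ (0 : G n) ⊆ Bx n ρ := by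
  intro p hp
  refine ⟨⟨?_, ?_⟩, fun j _ => ?_⟩
  · have := hp.1.1; simp at this; nlinarith
  · simpa using hp.1.2
  · have := ballC_sub hρ.le hp.2 j
    simp at this; exact abs_lt.1 this
theorem io_decomp (y : G' n) : io n y = y.1 • et + ∑ i : Fin n, y.2 i • ex i.succ := by
  refine Prod.ext ?_ ?_
  · simp [io_fst, et, ex, Prod.fst_sum]
  · funext j
    refine Fin.cases ?_ (fun i => ?_) j
    · simp [io_zero, et, ex, Prod.snd_sum, Finset.sum_apply]
    · simp [io_succ, et, ex, Prod.snd_sum, Finset.sum_apply, Pi.single_apply]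
theorem poinc {w g : Fu n} (hw : Sm w) (hg : LM g) (g0 : ∀ p, 0 ≤ g p) {K ρ : ℝ} (hK : 0 ≤ K) (hρ : 0 < ρ) (hρ1 : ρ ≤ 1/4)
    (h1 : ∀ p ∈ Bl n (1/4), ∀ e, TD e → |Dd e w p| ≤ K)
    (h2 : ∀ p ∈ Bl n (1/4), |Dd (ex 0) w p| ≤ K + g p) :
    ∫ p in Qcyl ρ (0 : G n), |w p - w 0| ≤ (n + 3) * ρ * K * (volume (Bx n ρ)).toReal + 2 * ρ * ∫ p in Bx n ρ, g p := by
  have mI : MeasurableSet (Set.Ioo (-ρ) ρ) := measurableSet_Ioo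
  have hsm : ∀ y ∈ Bx' n ρ, ∀ s ∈ Set.Ioo (-ρ) ρ, Ps n (y, s) ∈ Bl n (1/4) := by
    intro y hy s hs
    refine Bx_sub hρ hρ1 ?_
    have : (y, s) ∈ Ps n ⁻¹' Bx n ρ := by rw [Bx_pre]; exact ⟨hy, hs⟩
    exact this
  have fB : volume (Bx n ρ) < ⊤ := (measure_mono (Bx_sub hρ hρ1)).trans_lt measure_ball_lt_top
  obtain ⟨Cg, hCg⟩ := hg.2 (1/4)
  have lsub : LM (fun p => |w p - w 0|) := (hw.lm.sub (BM.const _).lm).abs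
  have iB : ∀ {f : Fu n}, LM f → IntegrableOn f (Bx n ρ) := fun hf => (hf.intOn (1/4)).mono_set (Bx_sub hρ hρ1)
  have iP : ∀ {f : Fu n}, LM f → IntegrableOn (fun q => f (Ps n q)) (Bx' n ρ ×ˢ Set.Ioo (-ρ) ρ) := by
    intro f hf
    have := ((Ps_mp n).integrableOn_comp_preimage (Ps n).measurableEmbedding (f := f) (s := Bx n ρ)).2 (iB hf)
    rwa [Bx_pre] at this
  have eP : ∀ f : Fu n, ∫ p in Bx n ρ, f p = ∫ q in Bx' n ρ ×ˢ Set.Ioo (-ρ) ρ, f (Ps n q) := by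
    intro f
    rw [← Bx_pre, (Ps_mp n).setIntegral_preimage_emb (Ps n).measurableEmbedding]
  set h : G' n → ℝ := fun y => ∫ s in Set.Ioo (-ρ) ρ, g (Ps n (y, s)) with hh
  have ig : ∀ y ∈ Bx' n ρ, IntegrableOn (fun s => g (Ps n (y, s))) (Set.Ioo (-ρ) ρ) := by
    intro y hy
    refine Measure.integrableOn_of_bounded (M := Cg) (by simp) ?_ ?_
    · exact (hg.1.comp ((Ps n).measurable.comp measurable_prodMk_left)).aestronglyMeasurable
    · refine (ae_restrict_iff' mI).2 (evf fun s hs => hCg _ (hsm y hy s hs))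
  have pw : ∀ q ∈ Bx' n ρ ×ˢ Set.Ioo (-ρ) ρ, |w (Ps n q) - w 0| ≤ (n + 3) * ρ * K + h q.1 := by
    rintro ⟨y, τ⟩ ⟨hy, hτ⟩
    simp only at hy hτ ⊢
    have hy1 : |y.1| ≤ ρ := by
      rw [abs_le]; constructor <;> nlinarith [hy.1.1, hy.1.2]
    have hy2 : ∀ i, |y.2 i| ≤ ρ := fun i => by
      have := hy.2 i trivial
      rw [abs_le]; exact ⟨this.1.le, this.2.le⟩
    have s1 : |w (io n y) - w 0| ≤ (n + 1) * ρ * K := by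
      have hd : ∀ s : ℝ, HasDerivAt (fun s : ℝ => w (s • io n y)) (Dd (io n y) w (s • io n y)) s := by
        intro s
        have h4 : HasDerivAt (fun s : ℝ => s • io n y) (io n y) s := by
          simpa using (hasDerivAt_id s).smul_const (io n y)
        exact (hw.diff _).hasFDerivAt.comp_hasDerivAt s h4
      have := norm_image_sub_le_of_norm_deriv_le_segment_01' (f := fun s : ℝ => w (s • io n y)) (C := (n + 1) * ρ * K)
        (fun s _ => (hd s).hasDerivWithinAt) (fun s hs => ?_)
      · simpa using this
      · have hb : s • io n y ∈ Bl n (1/4) := by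
          have h5 := hsm y hy 0 ⟨by linarith, hρ⟩
          rw [Ps_io, zero_smul, add_zero, mem_ball_zero_iff] at h5
          rw [mem_ball_zero_iff, norm_smul, Real.norm_eq_abs, abs_of_nonneg hs.1]
          nlinarith [norm_nonneg (io n y), hs.2, hs.1]
        have ed : Dd (io n y) w (s • io n y) = y.1 * Dd et w (s • io n y) + ∑ i : Fin n, y.2 i * Dd (ex i.succ) w (s • io n y) := by
          conv_lhs => unfold Dd
          rw [io_decomp y, map_add, map_sum]
          simp [Dd]
        rw [ed, Real.norm_eq_abs]
        refine (abs_add_le _ _).trans ?_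
        have t1 : |y.1 * Dd et w (s • io n y)| ≤ ρ * K := by
          rw [abs_mul]; exact mul_le_mul hy1 (h1 _ hb _ td_et) (abs_nonneg _) hρ.le
        have t2 : |∑ i : Fin n, y.2 i * Dd (ex i.succ) w (s • io n y)| ≤ n * (ρ * K) := by
          refine (Finset.abs_sum_le_sum_abs _ _).trans ?_
          refine (Finset.sum_le_card_nsmul _ _ (ρ * K) fun i _ => ?_).trans (le_of_eq (by simp))
          rw [abs_mul]; exact mul_le_mul (hy2 i) (h1 _ hb _ (td_ex i)) (abs_nonneg _) hρ.le
        linarith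
    have s2 : |w (Ps n (y, τ)) - w (io n y)| ≤ 2 * ρ * K + h y := by
      have hd : ∀ s : ℝ, HasDerivAt (fun s : ℝ => w (io n y + s • ex 0)) (Dd (ex 0) w (io n y + s • ex 0)) s := by
        intro s
        have h4 : HasDerivAt (fun s : ℝ => io n y + s • (ex 0 : G n)) (ex 0) s := by
          simpa using ((hasDerivAt_id s).smul_const (ex 0 : G n)).const_add (io n y)
        exact (hw.diff _).hasFDerivAt.comp_hasDerivAt s h4
      have hc : Continuous fun s : ℝ => Dd (ex 0) w (io n y + s • ex 0) := (hw.dd _).cont.comp (by fun_prop)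
      have ft := intervalIntegral.integral_eq_sub_of_hasDerivAt (a := 0) (b := τ) (fun s _ => hd s) (hc.intervalIntegrable _ _)
      simp only [zero_smul, add_zero] at ft
      rw [Ps_io, ← ft]
      have ic : IntegrableOn (fun s : ℝ => ‖Dd (ex 0) w (io n y + s • ex 0)‖) (Set.Ioo (-ρ) ρ) :=
        (hc.norm.integrableOn_Icc (a := -ρ) (b := ρ)).mono_set Set.Ioo_subset_Icc_self
      calc _ ≤ ∫ s in Set.uIoc 0 τ, ‖Dd (ex 0) w (io n y + s • ex 0)‖ := intervalIntegral.norm_integral_le_integral_norm_uIoc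
        _ ≤ ∫ s in Set.Ioo (-ρ) ρ, ‖Dd (ex 0) w (io n y + s • ex 0)‖ := by
            refine setIntegral_mono_set ic (evf fun _ => norm_nonneg _) (evf ?_)
            intro s hs
            rcases Set.mem_uIoc.1 hs with hs | hs
            · exact ⟨by linarith [hs.1], by linarith [hs.2, hτ.2]⟩
            · exact ⟨by linarith [hs.1, hτ.1], by linarith [hs.2]⟩
        _ ≤ ∫ s in Set.Ioo (-ρ) ρ, (K + g (Ps n (y, s))) := by
            refine setIntegral_mono_on ic ((integrableOn_const (by simp)).add (ig y hy)) mI fun s hs => ?_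
            rw [← Ps_io]; exact h2 _ (hsm y hy s hs)
        _ = 2 * ρ * K + h y := by
            have ik : Integrable (fun _ : ℝ => K) (volume.restrict (Set.Ioo (-ρ) ρ)) := integrableOn_const (by simp)
            rw [integral_add (μ := volume.restrict (Set.Ioo (-ρ) ρ)) (f := fun _ : ℝ => K) (g := fun s => g (Ps n (y, s))) ik (ig y hy)]
            simp only [integral_const, hh, smul_eq_mul, measureReal_restrict_apply_univ]
            rw [Real.volume_real_Ioo_of_le (by linarith)]
            ring
    have := abs_sub_le (w (Ps n (y, τ))) (w (io n y)) (w 0)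
    linarith
  have ih : IntegrableOn h (Bx' n ρ) := by
    have := iP hg
    unfold IntegrableOn at this
    rw [Measure.volume_eq_prod (G' n) ℝ, ← Measure.prod_restrict] at this
    exact this.integral_prod_left
  have fB' : volume (Bx' n ρ) < ⊤ := by
    have : Bx' n ρ ⊆ Metric.ball 0 1 := by
      intro p hp
      rw [Metric.mem_ball, dist_zero_right, Prod.norm_def, max_lt_iff, pi_norm_lt_iff (by norm_num)]
      constructor
      · rw [Real.norm_eq_abs, abs_lt]; constructor <;> nlinarith [hp.1.1, hp.1.2]
      · intro j; rw [Real.norm_eq_abs, abs_lt]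
        have := hp.2 j trivial
        constructor <;> linarith [this.1, this.2]
    exact (measure_mono this).trans_lt measure_ball_lt_top
  have ih2 : IntegrableOn (fun q : G' n × ℝ => h q.1) (Bx' n ρ ×ˢ Set.Ioo (-ρ) ρ) := by
    unfold IntegrableOn
    rw [Measure.volume_eq_prod (G' n) ℝ, ← Measure.prod_restrict]
    have hfin : IsFiniteMeasure ((volume : Measure ℝ).restrict (Set.Ioo (-ρ) ρ)) := ⟨by simp⟩
    have := Integrable.mul_prod (f := h) (g := fun _ : ℝ => (1:ℝ)) ih (integrable_const (μ := (volume : Measure ℝ).restrict (Set.Ioo (-ρ) ρ)) 1)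
    simpa using this
  have fBI : volume (Bx' n ρ ×ˢ Set.Ioo (-ρ) ρ) = volume (Bx n ρ) := by
    rw [← Bx_pre, (Ps_mp n).measure_preimage (Bx_meas n ρ).nullMeasurableSet]
  have ic : IntegrableOn (fun q : G' n × ℝ => ((n:ℝ) + 3) * ρ * K) (Bx' n ρ ×ˢ Set.Ioo (-ρ) ρ) :=
    integrableOn_const (by rw [fBI]; exact fB.ne)
  have eh : ∫ q in Bx' n ρ ×ˢ Set.Ioo (-ρ) ρ, h q.1 = 2 * ρ * ∫ p in Bx n ρ, g p := by
    have a1 := setIntegral_prod_mul (μ := (volume : Measure (G' n))) (ν := (volume : Measure ℝ)) h (fun _ : ℝ => (1:ℝ)) (Bx' n ρ) (Set.Ioo (-ρ) ρ)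
    simp only [mul_one, integral_const, smul_eq_mul, measureReal_restrict_apply_univ] at a1
    rw [Real.volume_real_Ioo_of_le (by linarith)] at a1
    rw [Measure.volume_eq_prod (G' n) ℝ, a1, eP, Measure.volume_eq_prod (G' n) ℝ, setIntegral_prod _ (by
      have := iP hg
      rwa [Measure.volume_eq_prod (G' n) ℝ] at this)]
    simp only [hh]; ring
  calc _ ≤ ∫ p in Bx n ρ, |w p - w 0| :=
        setIntegral_mono_set (iB lsub) (evf fun _ => abs_nonneg _) (evf (Q_sub_Bx hρ))
    _ = ∫ q in Bx' n ρ ×ˢ Set.Ioo (-ρ) ρ, |w (Ps n q) - w 0| := eP _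
    _ ≤ ∫ q in Bx' n ρ ×ˢ Set.Ioo (-ρ) ρ, (((n:ℝ) + 3) * ρ * K + h q.1) :=
        setIntegral_mono_on (iP lsub) (ic.add ih2) ((Bx'_meas n ρ).prod mI) pw
    _ = _ := by
        rw [integral_add ic ih2, eh, integral_const, measureReal_restrict_apply_univ, smul_eq_mul]
        unfold Measure.real
        rw [fBI]; ring
end poinc
end KK
namespace KK
section core
variable {n : ℕ}
noncomputable def dir (o : Option (Fin n)) : G' n :=
  match o with
  | none => (1, 0)
  | some i => (0, Pi.single i 1)
theorem td_dir {e : G n} (he : TD e) : ∃ o, e = io n (dir o) := by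
  rcases he with rfl | ⟨j, hj, rfl⟩
  · refine ⟨none, Prod.ext rfl ?_⟩
    funext j; refine Fin.cases rfl (fun i => ?_) j
    rw [io_succ]; rfl
  · obtain ⟨i, rfl⟩ := Fin.exists_succ_eq.2 hj
    refine ⟨some i, Prod.ext rfl ?_⟩
    funext j; refine Fin.cases ?_ (fun l => ?_) j
    · rw [io_zero]; simp [ex]
    · rw [io_succ]; simp [ex, dir, Pi.single_apply]
theorem ker_list (m : ℕ) : ∀ k : G' n → ℝ, Cc k → tsupport k ⊆ Metric.ball 0 (1/4) →
    ∃ K : ℝ, 0 ≤ K ∧ ∀ l : List (G n), TL l → l.length ≤ m → ∃ k' : G' n → ℝ, Cc k' ∧ (∀ q, k' q ≠ 0 → ‖q‖ < 1/4) ∧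
      ∫ q, |k' q| ≤ K ∧ ∀ w, Cc w → DL l (mo k w) = mo k' w := by
  have hs0 : ∀ k : G' n → ℝ, tsupport k ⊆ Metric.ball 0 (1/4) → ∀ q, k q ≠ 0 → ‖q‖ < 1/4 := by
    intro k hs q hq
    simpa using hs (subset_tsupport k hq)
  induction m with
  | zero =>
    intro k hk hs
    refine ⟨∫ q, |k q|, by positivity, fun l hl h0 => ⟨k, hk, hs0 k hs, le_rfl, fun w hw => ?_⟩⟩
    have : l = [] := List.length_eq_zero_iff.1 (by omega)
    subst this; rfl
  | succ m ih =>
    intro k hk hs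
    have hd : ∀ o : Option (Fin n), tsupport (Dd (dir o) k) ⊆ Metric.ball 0 (1/4) := fun o =>
      (closure_minimal (fun q hq => by
        by_contra h
        have : k =ᶠ[nhds q] fun _ => 0 := (notMem_tsupport_iff_eventuallyEq.1 h)
        apply hq; unfold Dd; rw [this.fderiv_eq]; simp) (isClosed_tsupport k)).trans hs
    choose K hK0 hK using fun o => ih (Dd (dir o) k) (hk.dd _) (hd o)
    refine ⟨(∫ q, |k q|) + ∑ o, K o, add_nonneg (by positivity) (SN fun o _ => hK0 o), fun l hl h0 => ?_⟩
    cases l with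
    | nil => exact ⟨k, hk, hs0 k hs, by linarith [SN fun o (_ : o ∈ Finset.univ) => hK0 o], fun w hw => rfl⟩
    | cons e l =>
      obtain ⟨o, ho⟩ := td_dir (hl e (by simp))
      obtain ⟨k', h1, h2, h3, h4⟩ := hK o l (fun e he => hl e (by simp [he])) (by simpa using h0)
      refine ⟨k', h1, h2, h3.trans ?_, fun w hw => ?_⟩
      · have := Finset.single_le_sum (f := K) (fun o _ => hK0 o) (Finset.mem_univ o)
        have : 0 ≤ ∫ q, |k q| := by positivity
        linarith
      · rw [← h4 w hw]
        show DL l (Dd e (mo k w)) = _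
        rw [mo_dd hk hw, ho, mo_ibp hk hw]
theorem ut_bd (n : ℕ) {δ : ℝ} (hδ : 0 < δ) : ∃ C : ℝ, 0 < C ∧ ∀ b : ℝ → Mx n, Ell δ b →
    ∀ U : Fu n, Sm U → EE 1 (pdt U) ≤ C * (EE 1 (Lb 1 b U) + ∑ j, ∑ k, EE 1 (pdxx j k U)) := by
  set c : ℝ := (n+1)^2 * δ⁻¹^2 with hc
  have c0 : 0 ≤ c := by positivity
  refine ⟨2 + 2 * c, by positivity, fun b hb U hU => ?_⟩
  have l1 : LM (Lb 1 b U) := Lb_LM hδ hb 1 hU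
  have l2 : ∀ j k, LM (pdxx j k U) := fun j k => (hU.pdxx j k).lm
  have key := EE_le (θ := 1) (f := pdt U) (g := fun p => 2 * Lb 1 b U p ^ 2 + 2 * c * ∑ j, ∑ k, pdxx j k U p ^ 2) hU.pdt.lm
    ((l1.sq.cmul _).add ((LM.sum _ fun j => LM.sum _ fun k => (l2 j k).sq).cmul _)) (fun p _ => by
      have e : pdt U p = Lb 1 b U p - ∑ j, ∑ k, b (p.2 0) j k * pdxx j k U p := by unfold Lb; ring
      have h1 := sq_sum2 (fun j k => b (p.2 0) j k * pdxx j k U p)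
      have h2 : ∑ j, ∑ k, (b (p.2 0) j k * pdxx j k U p)^2 ≤ δ⁻¹^2 * ∑ j, ∑ k, pdxx j k U p ^ 2 := by
        simp only [Finset.mul_sum]
        refine Finset.sum_le_sum fun j _ => Finset.sum_le_sum fun k _ => ?_
        rw [mul_pow]
        exact mlr (sq_le_sq' (abs_le.1 (hb.abs hδ _ j k)).1 (abs_le.1 (hb.abs hδ _ j k)).2) (sq_nonneg _)
      have h3 : (∑ j, ∑ k, b (p.2 0) j k * pdxx j k U p)^2 ≤ c * ∑ j, ∑ k, pdxx j k U p ^ 2 := by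
        refine h1.trans ?_
        rw [hc, mul_assoc]
        exact mll h2 (by positivity)
      rw [e]
      nlinarith [sq_nonneg (Lb 1 b U p + ∑ j, ∑ k, b (p.2 0) j k * pdxx j k U p)])
  refine key.trans ?_
  rw [integral_add ((l1.sq.cmul 2).intOn 1) (((LM.sum _ fun j => LM.sum _ fun k => (l2 j k).sq).cmul (2*c)).intOn 1),
    integral_const_mul, integral_const_mul, integral_finsetSum _ fun j _ => (LM.sum _ fun k => (l2 j k).sq).intOn 1]
  rw [SC fun j _ => integral_finsetSum _ fun k _ => (l2 j k).sq.intOn 1]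
  have s0 : 0 ≤ ∑ j, ∑ k, EE 1 (pdxx j k U) := SN fun j _ => SN fun k _ => EE_nonneg _ _
  have a0 : 0 ≤ EE 1 (Lb 1 b U) := EE_nonneg _ _
  change 2 * EE 1 (Lb 1 b U) + 2 * c * ∑ j, ∑ k, EE 1 (pdxx j k U) ≤ _
  nlinarith [mul_nonneg c0 s0, mul_nonneg c0 a0]
theorem phi_facts (n : ℕ) {δ : ℝ} (hδ : 0 < δ) (hδ1 : δ ≤ 1) : ∃ N : ℝ, 0 < N ∧ ∀ b : ℝ → Mx n, Ell δ b →
    ∀ U : Fu n, Cc U → ∀ ε : ℝ, 0 < ε → ∃ φ, Cc φ ∧ EE 1 (Lb 1 b (fun p => U p - φ p)) ≤ ε ∧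
      (∫ p, pdt φ p ^ 2 ≤ N * (EE 1 (Lb 1 b U) + ε)) ∧ ∀ j k, ∫ p, pdxx j k φ p ^ 2 ≤ N * (EE 1 (Lb 1 b U) + ε) := by
  classical
  obtain ⟨N, hN, H⟩ := B1 n hδ
  refine ⟨2 * N, by positivity, fun b hb U hU ε hε => ?_⟩
  have hL := Lb_BC hδ hb 1 hU
  set g := (Bl n 1).indicator (Lb 1 b U) with hg
  have gm : Measurable g := hL.1.1.indicator Metric.isOpen_ball.measurableSet
  have gB : BC g := by
    refine ⟨⟨gm, ?_⟩, hL.2.mono (Set.support_indicator.subset.trans Set.inter_subset_right)⟩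
    obtain ⟨C, hC⟩ := hL.1.2
    refine ⟨C, fun p => le_trans ?_ (hC p)⟩
    rw [hg, Set.indicator_apply]; split_ifs
    · exact le_rfl
    · simp
  obtain ⟨φ, hφ, h1⟩ := approx hδ hδ1 hb gB.memLp hε
  have hF := Lb_BC hδ hb 1 hφ
  have hD := hF.sub gB
  have i2 : ∫ p, g p ^ 2 = EE 1 (Lb 1 b U) := by
    unfold EE
    rw [← integral_indicator Metric.isOpen_ball.measurableSet]
    congr 1; funext p
    rw [hg, Set.indicator_apply, Set.indicator_apply]; split_ifs <;> simp
  have i1 : ∫ p, Lb 1 b φ p ^ 2 ≤ 2 * (EE 1 (Lb 1 b U) + ε) := by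
    have := BC.mono (m := volume) hF.sq ((hD.sq.cmul 2).add (gB.sq.cmul 2)) (fun p => by nlinarith [sq_nonneg (Lb 1 b φ p - 2 * g p)])
    rw [BC.int_add (hD.sq.cmul 2) (gB.sq.cmul 2), integral_const_mul, integral_const_mul, i2] at this
    linarith
  refine ⟨φ, hφ, ?_, ?_, fun j k => ?_⟩
  · refine le_trans ?_ h1
    rw [EE_congr (g := fun p => (-1) * (Lb 1 b φ p - g p)) ?_, EE_cmul]
    · simpa using EE_le_int hD
    · intro p hp
      rw [Lb_sub 1 b hU.sm hφ.sm, hg, Set.indicator_of_mem hp]; ring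
  · have := (H b hb φ hφ).1; nlinarith
  · have := (H b hb φ hφ).2 j k; nlinarith
end core
end KK
namespace KK
section core2
variable {n : ℕ}
theorem W_Cc {u : Fu n} (hu : Cc u) (i) : Cc (W i u) := by
  cases i with
  | none => exact hu.pdt
  | some jk => exact hu.pdxx _ _
theorem W_Sm {u : Fu n} (hu : Sm u) (i) : Sm (W i u) := by
  cases i with
  | none => exact hu.pdt
  | some jk => exact hu.pdxx _ _
theorem mo_pdt {k : G' n → ℝ} {w : Fu n} (hk : Cc k) (hw : Cc w) : pdt (mo k w) = mo k (pdt w) := mo_dd hk hw _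
theorem mo_pdxx {k : G' n → ℝ} {w : Fu n} (hk : Cc k) (hw : Cc w) (j l) : pdxx j l (mo k w) = mo k (pdxx j l w) := by
  rw [pdxx_eq, mo_dd hk hw, mo_dd hk (hw.dd _)]; rfl
theorem mo_W {k : G' n → ℝ} {w : Fu n} (hk : Cc k) (hw : Cc w) (i) : W i (mo k w) = mo k (W i w) := by
  cases i with
  | none => exact mo_pdt hk hw
  | some jk => exact mo_pdxx hk hw _ _
theorem pdt_sub' {u v : Fu n} (hu : Sm u) (hv : Sm v) : pdt (fun p => u p - v p) = fun p => pdt u p - pdt v p := by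
  funext p; exact dd_sub hu hv _ p
theorem pdxx_sub' {u v : Fu n} (hu : Sm u) (hv : Sm v) (j k) :
    pdxx j k (fun p => u p - v p) = fun p => pdxx j k u p - pdxx j k v p := by
  have : Dd (ex k) (fun p => u p - v p) = fun p => Dd (ex k) u p - Dd (ex k) v p := by
    funext p; exact dd_sub hu hv _ p
  rw [pdxx_eq, this]; funext p
  exact dd_sub (hu.dd _) (hv.dd _) _ p
theorem W_sub {u v : Fu n} (hu : Sm u) (hv : Sm v) (i) : W i (fun p => u p - v p) = fun p => W i u p - W i v p := by
  cases i with
  | none => exact pdt_sub' hu hv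
  | some jk => exact pdxx_sub' hu hv _ _
theorem mo_sub {k : G' n → ℝ} {f g : Fu n} (hk : Cc k) (hf : Cc f) (hg : Cc g) (p : G n) :
    mo k (fun p => f p - g p) p = mo k f p - mo k g p := by
  unfold mo
  rw [← integral_sub (mo_int hk hf.bc.1 p) (mo_int hk hg.bc.1 p)]
  congr 1; funext q; ring
theorem sqrt_add_le' {x y : ℝ} (hx : 0 ≤ x) (hy : 0 ≤ y) : √(x + y) ≤ √x + √y := by
  rw [Real.sqrt_le_left (by positivity)]
  nlinarith [Real.sq_sqrt hx, Real.sq_sqrt hy, Real.sqrt_nonneg x, Real.sqrt_nonneg y, mul_nonneg (Real.sqrt_nonneg x) (Real.sqrt_nonneg y)]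
theorem aux1 {P ρ : ℝ} (h0 : 0 ≤ P) (h1 : P ≤ 1) (h2 : 0 ≤ ρ) (h3 : ρ ≤ 1/4) : ρ * P ^ 2 ≤ P := by
  have : P ^ 2 ≤ P := by nlinarith
  nlinarith [sq_nonneg P]
theorem aux2 {I X ρ : ℝ} (h0 : I ≤ X) (h1 : 0 ≤ X) (h2 : 0 ≤ ρ) (h3 : ρ ≤ 1/4) : 2 * ρ * I ≤ 2 * X := by
  nlinarith [mll h0 h2]
theorem aux3 {D τ : ℝ} (h0 : 0 ≤ D) (h1 : 0 < τ) : ∃ s : ℝ, 0 < s ∧ D * s ≤ τ / 2 :=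
  ⟨τ / (2 * (D + 1)), by positivity, by
    rw [mul_div_assoc', div_le_div_iff₀ (by positivity) (by positivity)]; nlinarith⟩
set_option maxHeartbeats 1000000 in
theorem core (n : ℕ) {δ : ℝ} (hδ : 0 < δ) (hδ1 : δ ≤ 1) : ∃ C : ℝ, 0 < C ∧ ∀ b : ℝ → Mx n, Ell δ b →
    ∀ U : Fu n, Cc U → ∀ ρ : ℝ, 0 < ρ → ρ ≤ 1/4 → ∀ i, ∀ τ : ℝ, 0 < τ → ∃ c : ℝ,
      ∫ p in Qcyl ρ (0 : G n), |W i U p - c| ≤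
        C * (ρ ^ (n+4) * √(∑ j, ∑ k, EE 1 (pdxx j k U)) + √(ρ ^ (n+3)) * √(EE 1 (Lb 1 b U))) + τ := by
  obtain ⟨Cg, hCg, HG⟩ := gradW n hδ
  obtain ⟨Cu, hCu, HU⟩ := ut_bd n hδ
  obtain ⟨N, hN, HP⟩ := phi_facts n hδ hδ1
  set v : ℝ := 2 ^ (n+2) with hv
  have v0 : 0 < v := by positivity
  set C0 : ℝ := 2 * Cu + 2 + 2 * N with hC0
  have C00 : 0 < C0 := by positivity
  refine ⟨√v * √N + (n+3) * Cg * √C0 * v, by positivity, fun b hb U hU ρ hρ hρ1 i τ hτ => ?_⟩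
  set A2 := EE 1 (Lb 1 b U) with hA2
  set S2 := ∑ j, ∑ k, EE 1 (pdxx j k U) with hS2
  have a0 : 0 ≤ A2 := EE_nonneg _ _
  have s0 : 0 ≤ S2 := SN fun j _ => SN fun k _ => EE_nonneg _ _
  set P := √(ρ ^ (n+3)) with hP
  have P0 : 0 ≤ P := Real.sqrt_nonneg _
  have PP : P ^ 2 = ρ ^ (n+3) := Real.sq_sqrt (by positivity)
  have P1 : P ≤ 1 := Real.sqrt_le_one.2 (pow_le_one₀ hρ.le (by linarith))
  have VB : (volume (Bx n ρ)).toReal = v * P ^ 2 := by rw [vol_Bx hρ, PP]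
  have fB : volume (Bx n ρ) < ⊤ := (measure_mono (Bx_sub hρ hρ1)).trans_lt measure_ball_lt_top
  have sB : √((volume (Bx n ρ)).toReal) = √v * P := by
    rw [VB, Real.sqrt_mul v0.le, Real.sqrt_sq P0]
  have hQm : MeasurableSet (Qcyl ρ (0 : G n)) := (Q_open _ _).measurableSet
  have QB := Q_sub_Bx (n := n) hρ
  have Qb : Qcyl ρ (0 : G n) ⊆ Metric.ball 0 (1/4) := QB.trans (Bx_sub hρ hρ1)
  have VQ : (volume (Qcyl ρ (0 : G n))).toReal ≤ v * P ^ 2 := by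
    rw [← VB]; exact ENNReal.toReal_mono fB.ne (measure_mono QB)
  have sQ : √((volume (Qcyl ρ (0 : G n))).toReal) ≤ √v * P := by
    rw [← sB]; exact Real.sqrt_le_sqrt (by rw [VB]; exact VQ)
  have hWU := W_Cc hU i
  obtain ⟨η0, hη0, Hη⟩ := mo_close hWU (τ := τ / (2 * v)) (by positivity)
  obtain ⟨k, hk, k0, k1, ks⟩ := exists_kernel n (η := min η0 (1/8)) (by positivity)
  have kt : tsupport k ⊆ Metric.ball 0 (1/4) := by
    refine (closure_minimal (fun q hq => ?_) Metric.isClosed_closedBall).trans (Metric.closedBall_subset_ball (by norm_num : (1/8:ℝ) < 1/4))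
    have := ks q hq
    simp; linarith only [this, min_le_right η0 (1/8)]
  have kabs : ∫ q, |k q| = 1 := by rw [← k1]; congr 1; funext q; exact abs_of_nonneg (k0 q)
  have ks4 : ∀ q, k q ≠ 0 → ‖q‖ < 1/4 := fun q hq => by linarith only [ks q hq, min_le_right η0 (1/8)]
  obtain ⟨K, hK, HK⟩ := ker_list (n+5) k hk kt
  set D : ℝ := √v * √N + (n+3) * Cg * √(C0 + K^2) * v + 2 * Cg * (n * (√v * K)) with hD
  have D0 : 0 ≤ D := by positivity
  obtain ⟨s, hs, hsD⟩ := aux3 D0 hτ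
  obtain ⟨φ, hφ, p1, p2, p3⟩ := HP b hb U hU (s^2) (by positivity)
  set w : Fu n := fun p => U p - φ p with hw
  have wC : Cc w := hU.sub hφ
  set z := mo k w with hz
  have zS : Sm z := mo_sm hk wC
  set M : ℝ := C0 * (A2 + S2) + (C0 + K^2) * s^2 with hM
  have M0 : 0 ≤ M := by positivity
  have HL : ∀ l, TL l → l.length ≤ n+5 → EE (3/4) (Lb 1 b (DL l z)) ≤ K^2 * s^2 := by
    intro l hl hl5
    obtain ⟨k', q1, q2, q3, q4⟩ := HK l hl hl5
    rw [hz, q4 w wC, mo_Lb hδ hb q1 wC]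
    refine (mo_EE q1 (Lb_BC hδ hb 1 wC) q2).trans ?_
    have e : (3/4 : ℝ) + 1/4 = 1 := by norm_num
    rw [e]
    exact mul_le_mul (pow_le_pow_left₀ (by positivity) q3 2) p1 (EE_nonneg _ _) (by positivity)
  have gen : ∀ f g : Fu n, Cc f → Cc g → EE (3/4) (mo k fun p => f p - g p) ≤ 2 * EE 1 f + 2 * ∫ p, g p ^ 2 := by
    intro f g hf hg
    have h1 := mo_EE (θ := 3/4) hk (hf.sub hg).bc ks4
    have e : (3/4 : ℝ) + 1/4 = 1 := by norm_num
    rw [kabs, e] at h1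
    have h2 := EE_add (θ := 1) hf.sm.lm (hg.sm.lm.cmul (-1))
    rw [EE_cmul] at h2
    have h3 := EE_le_int (θ := 1) hg.bc
    have h4 : (EE 1 fun p => f p - g p) = EE 1 fun p => f p + -1 * g p := by congr 1; funext p; ring
    linarith only [h1, h2, h3, h4]
  have m1 : EE (3/4) (pdt z) ≤ M := by
    rw [hz, mo_pdt hk wC, hw, pdt_sub' hU.sm hφ.sm]
    refine (gen _ _ hU.pdt hφ.pdt).trans ?_
    have h1 := HU b hb U hU.sm
    have h2 : 0 ≤ K^2 * s^2 := by positivity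
    have h3 : 0 ≤ 2 * N * S2 := by positivity
    have h4 : 0 ≤ (2 * Cu + 2) * s^2 := by positivity
    rw [hM, hC0]
    linarith only [h1, h2, h3, h4, p2, a0, s0]
  have m2 : ∀ j l, EE (3/4) (pdxx j l z) ≤ M := by
    intro j l
    rw [hz, mo_pdxx hk wC, hw, pdxx_sub' hU.sm hφ.sm]
    refine (gen _ _ (hU.pdxx j l) (hφ.pdxx j l)).trans ?_
    have h1 : EE 1 (pdxx j l U) ≤ S2 :=
      (Finset.single_le_sum (f := fun l => EE 1 (pdxx j l U)) (fun l _ => EE_nonneg _ _) (Finset.mem_univ l)).trans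
      (Finset.single_le_sum (f := fun j => ∑ l, EE 1 (pdxx j l U)) (fun j _ => SN fun l _ => EE_nonneg _ _) (Finset.mem_univ j))
    have h5 := p3 j l
    have h2 : 0 ≤ K^2 * s^2 := by positivity
    have h3 : 0 ≤ 2 * N * S2 := by positivity
    have h4 : 0 ≤ (2 * Cu + 2) * s^2 := by positivity
    have h6 : 0 ≤ 2 * Cu * (A2 + S2) := by positivity
    rw [hM, hC0]
    linarith only [h1, h2, h3, h4, h5, h6, a0, s0]
  have m3 : ∀ l, TL l → l.length ≤ n+5 → EE (3/4) (Lb 1 b (DL l z)) ≤ M := fun l h1 h2 => (HL l h1 h2).trans (by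
    rw [hM]; linarith only [mul_nonneg C00.le (add_nonneg a0 s0), mul_nonneg C00.le (sq_nonneg s)])
  have hgr := HG b hb z zS M m1 m2 m3 i
  have lk : ∀ k : Fin n, LM (Lb 1 b (Dd (ex k.succ) z)) := fun k => Lb_LM hδ hb 1 (zS.dd _)
  set g : Fu n := fun p => Cg * ∑ k : Fin n, |Lb 1 b (Dd (ex k.succ) z) p| with hg
  have gL : LM g := (LM.sum _ fun k => (lk k).abs).cmul _
  have hpo := poinc (W_Sm zS i) gL (fun p => mul_nonneg hCg.le (SN fun k _ => abs_nonneg _)) (K := Cg * √M)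
    (by positivity) hρ hρ1 (fun p hp e he => (hgr p hp).1 e he) (fun p hp => (hgr p hp).2)
  have ig : ∫ p in Bx n ρ, g p ≤ Cg * (n * (√v * K)) * s := by
    have ii : ∀ k : Fin n, IntegrableOn (fun p => |Lb 1 b (Dd (ex k.succ) z) p|) (Bx n ρ) := fun k =>
      ((lk k).abs.intOn (1/4)).mono_set (Bx_sub hρ hρ1)
    rw [hg, integral_const_mul, integral_finsetSum _ fun k _ => ii k, mul_assoc]
    refine mll ?_ hCg.le
    have : ∀ k : Fin n, ∫ p in Bx n ρ, |Lb 1 b (Dd (ex k.succ) z) p| ≤ √v * K * s := by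
      intro k
      refine (cs_ball (θ := 3/4) (lk k) ((Bx_sub hρ hρ1).trans (Metric.ball_subset_ball (by norm_num))) (Bx_meas n ρ)).trans ?_
      have h1 := HL [ex k.succ] (by intro e he; simp at he; subst he; exact td_ex k) (by simp)
      change EE (3/4) (Lb 1 b (Dd (ex k.succ) z)) ≤ _ at h1
      have h2 : √(EE (3/4) (Lb 1 b (Dd (ex k.succ) z))) ≤ K * s := Real.sqrt_le_iff.2 ⟨by positivity, by rw [mul_pow]; exact h1⟩
      rw [sB, mul_assoc (√v) K s]
      refine mul_le_mul ?_ h2 (Real.sqrt_nonneg _) (by positivity)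
      exact mul_le_of_le_one_right (Real.sqrt_nonneg v) P1
    refine (Finset.sum_le_sum fun k _ => this k).trans ?_
    simp only [Finset.sum_const, Finset.card_univ, Fintype.card_fin, nsmul_eq_mul]; exact le_of_eq (by ring)
  have sM : √M ≤ √C0 * (√A2 + √S2) + √(C0 + K^2) * s := by
    rw [hM]
    refine (sqrt_add_le' (by positivity) (by positivity)).trans ?_
    rw [Real.sqrt_mul C00.le, Real.sqrt_mul (by positivity) (s^2), Real.sqrt_sq hs.le]
    have := mll (sqrt_add_le' a0 s0) (Real.sqrt_nonneg C0)
    linarith only [this]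
  have wφ := W_Cc hφ i
  have iφ : ∫ p, W i φ p ^ 2 ≤ N * (A2 + s^2) := by
    cases i with
    | none => exact p2
    | some jk => exact p3 _ _
  have t2 : ∫ p in Qcyl ρ (0 : G n), |mo k (W i φ) p| ≤ √v * P * (√N * (√A2 + s)) := by
    refine (cs_ball (mo_sm hk wφ).lm Qb hQm).trans ?_
    refine mul_le_mul sQ ?_ (Real.sqrt_nonneg _) (by positivity)
    have h1 := mo_EE (θ := 1/4) hk wφ.bc ks4
    rw [kabs] at h1
    have h2 := EE_le_int (θ := 1/4+1/4) wφ.bc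
    refine (Real.sqrt_le_sqrt (by linarith only [h1, h2, iφ] : _ ≤ N * (A2 + s^2))).trans ?_
    rw [Real.sqrt_mul hN.le]
    refine mll ((sqrt_add_le' a0 (by positivity)).trans ?_) (Real.sqrt_nonneg _)
    rw [Real.sqrt_sq hs.le]
  have fQ : volume (Qcyl ρ (0 : G n)) ≠ ⊤ := ((measure_mono QB).trans_lt fB).ne
  have i1 : IntegrableOn (fun p => τ / (2 * v)) (Qcyl ρ (0 : G n)) := integrableOn_const fQ
  have i2 : IntegrableOn (fun p => |mo k (W i φ) p|) (Qcyl ρ (0 : G n)) := ((mo_sm hk wφ).lm.abs.intOn (1/4)).mono_set Qb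
  have zc : LM (fun p => |W i z p - W i z 0|) := ((W_Sm zS i).lm.sub (cont_lm continuous_const)).abs
  have i3 : IntegrableOn (fun p => |W i z p - W i z 0|) (Qcyl ρ (0 : G n)) := (zc.intOn (1/4)).mono_set Qb
  refine ⟨W i z 0, ?_⟩
  have hsplit : ∫ p in Qcyl ρ (0 : G n), |W i U p - W i z 0| ≤ ∫ p in Qcyl ρ (0 : G n), (τ / (2 * v) + |mo k (W i φ) p| + |W i z p - W i z 0|) := by
    refine setIntegral_mono_on ?_ ((i1.add i2).add i3) hQm fun p _ => ?_
    · exact (((hWU.sm.lm.sub (cont_lm continuous_const)).abs).intOn (1/4)).mono_set Qb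
    · have h1 := Hη k hk k0 k1 (fun q hq => (ks q hq).trans_le (min_le_left _ _)) p
      have h2 : W i z p = mo k (W i U) p - mo k (W i φ) p := by
        rw [hz, mo_W hk wC, hw, W_sub hU.sm hφ.sm, mo_sub hk hWU wφ]
      have h3 : W i U p - W i z 0 = (-(mo k (W i U) p - W i U p) + mo k (W i φ) p) + (W i z p - W i z 0) := by rw [h2]; ring
      rw [h3]
      refine (abs_add_le _ _).trans (add_le_add_left ((abs_add_le _ _).trans ?_) _)
      rw [abs_neg]; exact add_le_add_left h1 _
  have hI : ∫ p in Qcyl ρ (0 : G n), (τ / (2 * v) + |mo k (W i φ) p| + |W i z p - W i z 0|) =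
      (volume (Qcyl ρ (0 : G n))).toReal * (τ / (2 * v)) + (∫ p in Qcyl ρ (0 : G n), |mo k (W i φ) p|) + ∫ p in Qcyl ρ (0 : G n), |W i z p - W i z 0| := by
    have i12 : IntegrableOn (fun p => τ / (2 * v) + |mo k (W i φ) p|) (Qcyl ρ (0 : G n)) := i1.add i2
    rw [integral_add i12 i3, integral_add i1 i2]
    simp [Measure.real]
  rw [hI] at hsplit
  have t1 : (volume (Qcyl ρ (0 : G n))).toReal * (τ / (2 * v)) ≤ τ / 2 := by
    have : (volume (Qcyl ρ (0 : G n))).toReal ≤ v := by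
      linarith only [VQ, mll (pow_le_one₀ P0 P1 : P ^ 2 ≤ 1) v0.le]
    calc _ ≤ v * (τ / (2*v)) := mlr this (by positivity)
      _ = τ/2 := by field_simp
  rw [VB] at hpo
  have hρP : ρ * P ^ 2 = ρ ^ (n+4) := by rw [PP]; ring
  have t3 : (n+3) * ρ * (Cg * √M) * (v * P^2) ≤ (n+3) * Cg * √C0 * v * (P * √A2 + ρ^(n+4) * √S2) + (n+3) * Cg * √(C0 + K^2) * v * s := by
    have h1 : ρ * P^2 ≤ P := aux1 P0 P1 hρ.le hρ1
    have h2 : ρ * P^2 ≤ 1 := h1.trans P1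
    have e1 : (n+3) * ρ * (Cg * √M) * (v * P^2) = (n+3) * Cg * v * (ρ * P^2 * √M) := by ring
    have h3 : ρ * P^2 * √M ≤ √C0 * (P * √A2 + ρ^(n+4) * √S2) + √(C0 + K^2) * s := by
      refine (mll sM (by positivity)).trans ?_
      rw [← hρP]
      have g1 : √C0 * √A2 * (ρ * P^2) ≤ √C0 * √A2 * P := mll h1 (by positivity)
      have g2 : √(C0 + K^2) * s * (ρ * P^2) ≤ √(C0 + K^2) * s * 1 := mll h2 (by positivity)
      linarith only [g1, g2]
    rw [e1]
    refine (mll h3 (by positivity)).trans (le_of_eq ?_)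
    ring
  have t4 : 2 * ρ * ∫ p in Bx n ρ, g p ≤ 2 * (Cg * (n * (√v * K)) * s) := by
    exact aux2 ig (by positivity) hρ.le hρ1
  have t5 : √v * P * (√N * (√A2 + s)) ≤ √v * √N * (P * √A2) + √v * √N * s := by
    have : √v * √N * s * P ≤ √v * √N * s * 1 := mll P1 (by positivity)
    linarith only [this]
  have t6 : 0 ≤ √v * √N * (ρ^(n+4) * √S2) := by positivity
  have hDe : D * s = √v * √N * s + (n+3) * Cg * √(C0 + K^2) * v * s + 2 * (Cg * (n * (√v * K)) * s) := by rw [hD]; ring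
  linarith only [hsplit, hpo, t1, t2, t3, t4, t5, t6, hDe, hsD]
end core2
end KK
namespace KK
section scale
variable {n : ℕ}
noncomputable def AS (n : ℕ) (σ : ℝ) : G n →L[ℝ] G n :=
  ((σ ^ 2) • ContinuousLinearMap.id ℝ ℝ).prodMap (σ • ContinuousLinearMap.id ℝ (Fi n → ℝ))
theorem AS_fst (σ : ℝ) (p : G n) : (AS n σ p).1 = σ ^ 2 * p.1 := rfl
theorem AS_snd (σ : ℝ) (p : G n) (j) : (AS n σ p).2 j = σ * p.2 j := rfl
theorem AS_et (σ : ℝ) : AS n σ et = σ ^ 2 • et := Prod.ext (by simp [AS_fst, et]) (by funext j; simp [AS_snd, et])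
theorem AS_ex (σ : ℝ) (j) : AS n σ (ex j) = σ • ex j := Prod.ext (by simp [AS_fst, ex]) (by funext i; simp [AS_snd, ex])
theorem AS_det (σ : ℝ) : LinearMap.det (AS n σ : G n →ₗ[ℝ] G n) = σ ^ (n+3) := by
  have : (AS n σ : G n →ₗ[ℝ] G n) = LinearMap.prodMap ((σ ^ 2) • LinearMap.id) (σ • LinearMap.id) := rfl
  rw [this, LinearMap.det_prodMap, LinearMap.det_smul, LinearMap.det_smul]
  simp; ring
theorem AS_inj {σ : ℝ} (hσ : 0 < σ) (z : G n) : MeasurableEmbedding fun p => AS n σ p + z := by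
  refine Continuous.measurableEmbedding (by fun_prop) fun p q h => ?_
  have h' : AS n σ p = AS n σ q := add_right_cancel h
  refine Prod.ext ?_ (funext fun j => ?_)
  · have := congrArg Prod.fst h'
    rw [AS_fst, AS_fst] at this
    exact mul_left_cancel₀ (by positivity) this
  · have := congrFun (congrArg Prod.snd h') j
    rw [AS_snd, AS_snd] at this
    exact mul_left_cancel₀ (by positivity) this
theorem AS_map {σ : ℝ} (hσ : 0 < σ) (z : G n) :
    Measure.map (fun p => AS n σ p + z) volume = ENNReal.ofReal ((σ ^ (n+3))⁻¹) • (volume : Measure (G n)) := by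
  have h1 : (fun p => AS n σ p + z) = (fun p => p + z) ∘ ((AS n σ : G n →ₗ[ℝ] G n) : G n → G n) := rfl
  have hA : Measurable ((AS n σ : G n →ₗ[ℝ] G n) : G n → G n) := (AS n σ).continuous.measurable
  rw [h1, ← Measure.map_map (measurable_add_const z) hA,
    Measure.map_linearMap_addHaar_eq_smul_addHaar _ (by rw [AS_det]; positivity), AS_det, Measure.map_smul,
    (measurePreserving_add_right volume z).map_eq, abs_of_pos (by positivity)]
theorem AS_int {σ : ℝ} (hσ : 0 < σ) (z : G n) (s : Set (G n)) (f : Fu n) :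
    ∫ p in (fun p => AS n σ p + z) ⁻¹' s, f (AS n σ p + z) = (σ ^ (n+3))⁻¹ * ∫ p in s, f p := by
  rw [← (AS_inj hσ z).setIntegral_map, AS_map hσ z, Measure.restrict_smul, integral_smul_measure, ENNReal.toReal_ofReal (by positivity)]
  rfl
theorem AS_pdt {u : Fu n} (hu : Sm u) (σ : ℝ) (z : G n) :
    pdt (fun p => u (AS n σ p + z)) = fun p => σ ^ 2 * pdt u (AS n σ p + z) := by
  rw [pdt_eq, dd_comp_affine hu, AS_et]; funext p; rw [dd_smul_dir]; rfl
theorem AS_pdxx {u : Fu n} (hu : Sm u) (σ : ℝ) (z : G n) (j k) :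
    pdxx j k (fun p => u (AS n σ p + z)) = fun p => σ ^ 2 * pdxx j k u (AS n σ p + z) := by
  have h1 : Dd (ex k) (fun p => u (AS n σ p + z)) = fun p => σ * Dd (ex k) u (AS n σ p + z) := by
    rw [dd_comp_affine hu, AS_ex]; funext p; rw [dd_smul_dir]
  have h2 : Sm (fun p => Dd (ex k) u (AS n σ p + z)) := (hu.dd _).comp ((AS n σ).contDiff.add contDiff_const)
  rw [pdxx_eq, h1]; funext p
  rw [dd_cmul h2, dd_comp_affine (hu.dd _), AS_ex]
  simp only [dd_smul_dir, pdxx_eq]; ring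
theorem AS_W {u : Fu n} (hu : Sm u) (σ : ℝ) (z : G n) (i) :
    W i (fun p => u (AS n σ p + z)) = fun p => σ ^ 2 * W i u (AS n σ p + z) := by
  cases i with
  | none => exact AS_pdt hu σ z
  | some jk => exact AS_pdxx hu σ z _ _
theorem AS_Lb {u : Fu n} (hu : Sm u) (σ : ℝ) (z : G n) (b) :
    Lb 1 (fun s => b (σ * s + z.2 0)) (fun p => u (AS n σ p + z)) = fun p => σ ^ 2 * Lb 1 b u (AS n σ p + z) := by
  funext p
  unfold Lb
  rw [AS_pdt hu]
  simp only [AS_pdxx hu, Prod.snd_add, Pi.add_apply, AS_snd, mul_add, Finset.mul_sum]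
  congr 1
  · ring
  · refine SC fun j _ => SC fun k _ => by ring
def Qs (P : ℝ) (z : G n) : Set (G n) := Qcyl P (z.1 - P ^ 2 / 2, z.2)
theorem AS_Q {σ ρ : ℝ} (hσ : 0 < σ) (z : G n) : (fun p => AS n σ p + z) ⁻¹' (Qcyl (ρ * σ) z) = Qcyl ρ 0 := by
  ext p
  simp only [Qcyl, Set.mem_preimage, Set.mem_prod, Set.mem_Ioo, ballC, Set.mem_ofPred_eq, Prod.fst_add, Prod.snd_add, AS_fst,
    Pi.add_apply, AS_snd, Prod.fst_zero, Prod.snd_zero, Pi.zero_apply, sub_zero, zero_add, add_sub_cancel_right]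
  have h2 : 0 < σ ^ 2 := by positivity
  refine and_congr (and_congr ?_ ?_) ?_
  · constructor
    · intro h; by_contra hc; nlinarith
    · intro h; nlinarith
  · constructor
    · intro h; by_contra hc; nlinarith
    · intro h; nlinarith
  · simp only [mul_pow, ← Finset.mul_sum]
    constructor
    · intro h; by_contra hc; nlinarith
    · intro h; nlinarith
theorem AS_ball {σ : ℝ} (hσ : 0 < σ) (z : G n) : Bl n 1 ⊆ (fun p => AS n σ p + z) ⁻¹' (Qs ((n+2) * σ) z) := by
  intro p hp
  rw [Metric.mem_ball, dist_zero_right, Prod.norm_def, max_lt_iff, pi_norm_lt_iff (by norm_num)] at hp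
  have h1 := abs_lt.1 hp.1
  have h2 : 0 < σ ^ 2 := by positivity
  have hn : (0:ℝ) ≤ n := Nat.cast_nonneg n
  have h3 : 4 * σ ^ 2 ≤ ((n+2) * σ) ^ 2 := by
    rw [mul_pow]; exact mlr (by nlinarith) h2.le
  refine ⟨⟨?_, ?_⟩, ?_⟩
  · simp only [Prod.fst_add, AS_fst]; nlinarith
  · simp only [Prod.fst_add, AS_fst]; nlinarith
  · show ∑ j, ((AS n σ p + z).2 j - z.2 j) ^ 2 < _
    simp only [Prod.snd_add, Pi.add_apply, AS_snd, add_sub_cancel_right, mul_pow, ← Finset.mul_sum]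
    have : ∑ j, p.2 j ^ 2 ≤ n + 1 := by
      refine (Finset.sum_le_sum (g := fun _ => (1:ℝ)) fun j _ => ?_).trans (by simp)
      have := abs_lt.1 (hp.2 j); nlinarith
    rw [mul_comm]
    exact mul_lt_mul_of_pos_right (by nlinarith) h2
theorem EE_AS {σ : ℝ} (hσ : 0 < σ) (z : G n) {f : Fu n} (hf : BC f) :
    EE 1 (fun p => σ ^ 2 * f (AS n σ p + z)) ≤ σ ^ 4 * ((σ ^ (n+3))⁻¹ * ∫ p in Qs ((n+2) * σ) z, f p ^ 2) := by
  rw [EE_cmul, ← AS_int hσ z _ (fun p => f p ^ 2)]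
  have e : (σ ^ 2) ^ 2 = σ ^ 4 := by ring
  rw [e]
  refine mll ?_ (by positivity)
  unfold EE
  refine setIntegral_mono_set ?_ (evf fun _ => sq_nonneg _) (AS_ball hσ z).eventuallyLE
  have h1 : IntegrableOn (fun p => f p ^ 2) (Qs ((n+2) * σ) z) (Measure.map (fun p => AS n σ p + z) volume) := by
    rw [AS_map hσ z]
    exact (hf.sq.integrable.smul_measure ENNReal.ofReal_ne_top).integrableOn
  exact ((AS_inj hσ z).integrableOn_map_iff).1 h1
end scale
end KK
namespace KK
section scale2
variable {n : ℕ}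
theorem avg_osc {d : ℕ} {w : ℝ × (Fin d → ℝ) → ℝ} {s : Set (ℝ × (Fin d → ℝ))} (hs : 0 < (volume s).toReal)
    (iw : IntegrableOn w s) (c : ℝ) :
    avg s (fun y => |w y - avg s w|) ≤ 2 * (((volume s).toReal)⁻¹ * ∫ p in s, |w p - c|) := by
  have fs : volume s ≠ ⊤ := fun h => by rw [h] at hs; simp at hs
  set V := (volume s).toReal with hV
  have ic : ∀ c : ℝ, IntegrableOn (fun _ : ℝ × (Fin d → ℝ) => c) s := fun c => integrableOn_const fs
  have i1 : ∀ c, IntegrableOn (fun p => |w p - c|) s := fun c => (iw.sub (ic c)).abs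
  have cc : ∀ c : ℝ, ∫ p in s, c = V * c := fun c => by simp [Measure.real, hV]
  set I := ∫ p in s, |w p - c| with hI
  have h1 : |avg s w - c| ≤ V⁻¹ * I := by
    have : avg s w - c = V⁻¹ * ∫ p in s, (w p - c) := by
      rw [integral_sub iw (ic c), cc, mul_sub, inv_mul_cancel_left₀ hs.ne']; rfl
    rw [this, abs_mul, abs_of_pos (inv_pos.2 hs)]
    exact mll abs_integral_le_integral_abs (inv_pos.2 hs).le
  have h2 : ∫ p in s, |w p - avg s w| ≤ ∫ p in s, (|w p - c| + V⁻¹ * I) := by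
    refine integral_mono (i1 _) ((i1 c).add (ic _)) fun p => ?_
    have := abs_sub_le (w p) c (avg s w)
    rw [abs_sub_comm c] at this
    exact this.trans (add_le_add_right h1 _)
  rw [integral_add (i1 c) (ic _), cc, mul_inv_cancel_left₀ hs.ne'] at h2
  change V⁻¹ * _ ≤ _
  have := mll h2 (inv_pos.2 hs).le
  linarith
theorem AS_Cc {u : Fu n} (hu : Cc u) {σ : ℝ} (hσ : 0 < σ) (z : G n) : Cc fun p => u (AS n σ p + z) := by
  refine ⟨hu.1.comp ((AS n σ).contDiff.add contDiff_const), ?_⟩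
  have hi : Function.Injective (AS n σ : G n →ₗ[ℝ] G n) := fun p q h => (AS_inj hσ z).injective (by
    show AS n σ p + z = AS n σ q + z
    exact congrArg (· + z) h)
  exact hu.2.comp_isClosedEmbedding ((Homeomorph.addRight z).isClosedEmbedding.comp
    (LinearMap.isClosedEmbedding_of_injective (LinearMap.ker_eq_bot.2 hi)))
theorem scaled (n : ℕ) {δ : ℝ} (hδ : 0 < δ) (hδ1 : δ ≤ 1) : ∃ C : ℝ, 0 < C ∧ ∀ b : ℝ → Mx n, Ell δ b →
    ∀ u : Fu n, Cc u → ∀ r : ℝ, 0 < r → ∀ z : G n, ∀ κ : ℝ, 4 ≤ κ → ∀ i,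
      avg (Qcyl r z) (fun y => |W i u y - avg (Qcyl r z) (W i u)|) ≤
        C * (κ⁻¹ * √(avg (Qs ((n+2) * (κ * r)) z) fun y => ∑ j, ∑ k, pdxx j k u y ^ 2) +
          √(κ ^ (n+3)) * √(avg (Qs ((n+2) * (κ * r)) z) fun y => Lb 1 b u y ^ 2)) := by
  obtain ⟨C, hC, H⟩ := core n hδ hδ1
  set vq := vQ (n+1) with hvq
  have vq0 : 0 < vq := vQ_pos _
  set m : ℝ := (n+2) ^ (n+3) * vq with hm
  have m0 : 0 < m := by positivity
  refine ⟨2 * (vq⁻¹ * (C * √m)), by positivity, fun b hb u hu r hr z κ hκ i => ?_⟩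
  have κ0 : 0 < κ := by linarith
  set σ := κ * r with hσ'
  have hσ : 0 < σ := by positivity
  set ρ := κ⁻¹ with hρ'
  have hρ : 0 < ρ := by positivity
  have hρ1 : ρ ≤ 1/4 := by rw [hρ', one_div]; exact inv_anti₀ (by norm_num) hκ
  have hr' : r = ρ * σ := by rw [hρ', hσ']; field_simp
  set J := σ ^ (n+3) with hJ
  have J0 : 0 < J := by positivity
  set b' : ℝ → Mx n := fun s => b (σ * s + z.2 0) with hb'
  have hbb : Ell δ b' := ⟨fun j k => (hb.meas j k).comp (by fun_prop), fun s => hb.symm _, fun s => hb.low _, fun s => hb.upp _⟩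
  have hUC := AS_Cc hu hσ z
  have av : ∀ f : Fu n, J⁻¹ * ∫ p in Qs ((n+2) * σ) z, f p = m * avg (Qs ((n+2) * σ) z) f := by
    intro f
    unfold avg
    have : (volume (Qs ((n+2) * σ) z)).toReal = m * J := by
      unfold Qs; rw [vol_Q (by positivity), mul_pow, ← hvq, hm, hJ]; ring
    rw [this, mul_inv]; field_simp
  set Sb := avg (Qs ((n+2) * σ) z) fun y => ∑ j, ∑ k, pdxx j k u y ^ 2 with hSb
  set Ab := avg (Qs ((n+2) * σ) z) fun y => Lb 1 b u y ^ 2 with hAb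
  have hL := Lb_BC hδ hb 1 hu
  have s1 : √(∑ j, ∑ k, EE 1 (pdxx j k fun p => u (AS n σ p + z))) ≤ σ^2 * (√m * √Sb) := by
    rw [← Real.sqrt_mul m0.le, hSb, ← av]
    refine Real.sqrt_le_iff.2 ⟨by positivity, ?_⟩
    have hX : ∀ j k, Integrable (fun p => pdxx j k u p ^ 2) (volume.restrict (Qs ((n+2) * σ) z)) := fun j k =>
      ((hu.pdxx j k).bc.sq.integrable (m := volume)).integrableOn
    rw [mul_pow, Real.sq_sqrt (mul_nonneg (inv_pos.2 J0).le (integral_nonneg fun p => SN fun j _ => SN fun k _ => sq_nonneg _)),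
      integral_finsetSum _ fun j _ => integrable_finsetSum _ fun k _ => hX j k]
    rw [SC fun j _ => integral_finsetSum _ fun k _ => hX j k]
    simp only [Finset.mul_sum]
    refine Finset.sum_le_sum fun j _ => Finset.sum_le_sum fun k _ => ?_
    rw [AS_pdxx hu.sm]
    have := EE_AS hσ z (hu.pdxx j k).bc
    rw [← pow_mul]; exact this
  have s2 : √(EE 1 (Lb 1 b' fun p => u (AS n σ p + z))) ≤ σ^2 * (√m * √Ab) := by
    rw [← Real.sqrt_mul m0.le, hAb, ← av]
    refine Real.sqrt_le_iff.2 ⟨by positivity, ?_⟩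
    rw [mul_pow, Real.sq_sqrt (mul_nonneg (inv_pos.2 J0).le (integral_nonneg fun p => sq_nonneg _)), hb', AS_Lb hu.sm]
    have := EE_AS hσ z hL
    rw [← pow_mul]; exact this
  have hV : (volume (Qcyl r z)).toReal = ρ ^ (n+3) * J * vq := by rw [vol_Q hr, hr', hJ]; ring
  have V0 : 0 < (volume (Qcyl r z)).toReal := by rw [hV]; positivity
  set Pr := ρ ^ (n+3) with hPr
  have Pr0 : 0 < Pr := by positivity
  refine le_of_forall_pos_le_add fun τ hτ => ?_
  obtain ⟨c, hc⟩ := H b' hbb _ hUC ρ hρ hρ1 i (τ / 2 * (Pr * vq * σ^2)) (by positivity)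
  have e1 : ∫ p in Qcyl ρ (0 : G n), |W i (fun p => u (AS n σ p + z)) p - c| = σ^2 * (J⁻¹ * ∫ p in Qcyl r z, |W i u p - c / σ^2|) := by
    rw [hr', ← AS_int hσ z _ (fun p => |W i u p - c / σ^2|), AS_Q hσ z, AS_W hu.sm, ← integral_const_mul]
    congr 1; funext p
    have : σ ^ 2 * W i u (AS n σ p + z) - c = σ^2 * (W i u (AS n σ p + z) - c / σ^2) := by field_simp
    rw [this, abs_mul, abs_of_pos (by positivity)]
  rw [e1] at hc
  refine (avg_osc V0 ((W_Cc hu i).bc.integrable (m := volume)).integrableOn (c / σ^2)).trans ?_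
  set I := ∫ p in Qcyl r z, |W i u p - c / σ^2| with hI
  rw [hV]
  have hk : Pr * √(κ ^ (n+3)) = √Pr := by
    have : κ ^ (n+3) = Pr⁻¹ := by rw [hPr, hρ', inv_pow, inv_inv]
    rw [this, Real.sqrt_inv]
    have := Real.mul_self_sqrt Pr0.le
    have h0 : 0 < √Pr := Real.sqrt_pos.2 Pr0
    field_simp; linarith
  have e2 : ρ ^ (n+4) = Pr * ρ := by rw [hPr]; ring
  rw [e2, ← hk] at hc
  have g1 : C * (Pr * ρ * √(∑ j, ∑ k, EE 1 (pdxx j k fun p => u (AS n σ p + z))) + Pr * √(κ ^ (n+3)) * √(EE 1 (Lb 1 b' fun p => u (AS n σ p + z))))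
      ≤ C * (Pr * ρ * (σ^2 * (√m * √Sb)) + Pr * √(κ ^ (n+3)) * (σ^2 * (√m * √Ab))) := by
    gcongr
  have g2 := hc.trans (add_le_add_left g1 _)
  have g3 : σ^2 * (J⁻¹ * I) ≤ Pr * vq * σ^2 * (vq⁻¹ * (C * √m) * (ρ * √Sb + √(κ ^ (n+3)) * √Ab) + τ / 2) := by
    refine g2.trans (le_of_eq ?_)
    field_simp
  have g4 : (Pr * J * vq)⁻¹ * I = (Pr * vq * σ^2)⁻¹ * (σ^2 * (J⁻¹ * I)) := by field_simp
  rw [g4]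
  have g5 := mll g3 (by positivity : 0 ≤ (Pr * vq * σ^2)⁻¹)
  rw [inv_mul_cancel_left₀ (by positivity)] at g5
  linarith only [g5]
end scale2
end KK
namespace KK
section freeze
variable {n : ℕ}
theorem intb {X : Type*} [MeasurableSpace X] {m : Measure X} [IsFiniteMeasure m] {f : X → ℝ} (hf : Measurable f)
    {K : ℝ} (h : ∀ x, |f x| ≤ K) : Integrable f m :=
  Integrable.of_bound hf.aestronglyMeasurable K (evf h)
theorem int_meas {X Y : Type*} [MeasurableSpace X] [MeasurableSpace Y] (m : Measure Y) [IsFiniteMeasure m] {f : X → Y → ℝ}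
    (hf : Measurable (Function.uncurry f)) : Measurable fun x => ∫ y, f x y ∂m :=
  (StronglyMeasurable.integral_prod_right (f := f) hf.stronglyMeasurable).measurable
theorem int_bd {Y : Type*} [MeasurableSpace Y] (m : Measure Y) [IsFiniteMeasure m] {f : Y → ℝ} {K : ℝ}
    (h : ∀ y, |f y| ≤ K) : |∫ y, f y ∂m| ≤ K * m.real Set.univ :=
  norm_integral_le_of_norm_le_const (f := f) (evf h)
theorem abs_osc {Y T : Type*} [MeasurableSpace Y] [MeasurableSpace T] (m : Measure Y) [IsFiniteMeasure m]
    (mT : Measure T) [IsFiniteMeasure mT] (hV : 0 < m.real Set.univ) {f : Y → T → ℝ} (hf : Measurable (Function.uncurry f))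
    {K : ℝ} (hK : ∀ y t, |f y t| ≤ K) {s : T → Y → Y → ℝ} (hs : Measurable fun q : T × Y × Y => s q.1 q.2.1 q.2.2)
    (hs0 : ∀ t y y', |f y t - f y' t| ≤ s t y y') {K' : ℝ} (hs1 : ∀ t y y', |s t y y'| ≤ K') :
    ∫ t, ∫ y, |f y t - (m.real Set.univ)⁻¹ * ∫ y', f y' t ∂m| ∂m ∂mT ≤
      (m.real Set.univ)⁻¹ * ∫ t, ∫ y, ∫ y', s t y y' ∂m ∂m ∂mT := by
  set V := m.real Set.univ with hVd
  have ft : ∀ t, Measurable fun y => f y t := fun t => hf.comp (by fun_prop : Measurable fun y => (y, t))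
  have mf : Measurable fun t => ∫ y', f y' t ∂m := int_meas m (f := fun t y => f y t) (hf.comp measurable_swap)
  have ms1 : ∀ t y, Measurable fun y' => s t y y' := fun t y => hs.comp (by fun_prop : Measurable fun y' => (t, y, y'))
  have ms2 : Measurable fun q : T × Y => ∫ y', s q.1 q.2 y' ∂m :=
    int_meas m (f := fun (q : T × Y) y' => s q.1 q.2 y') (hs.comp (by fun_prop : Measurable fun q : (T × Y) × Y => (q.1.1, q.1.2, q.2)))
  have ms3 : Measurable fun t => ∫ y, ∫ y', s t y y' ∂m ∂m := int_meas m (f := fun t y => ∫ y', s t y y' ∂m) ms2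
  have bf : ∀ t, |∫ y', f y' t ∂m| ≤ K * V := fun t => int_bd m fun y => hK y t
  have key : ∀ t y, |f y t - V⁻¹ * ∫ y', f y' t ∂m| ≤ V⁻¹ * ∫ y', s t y y' ∂m := by
    intro t y
    have e : f y t - V⁻¹ * ∫ y', f y' t ∂m = V⁻¹ * ∫ y', (f y t - f y' t) ∂m := by
      rw [integral_sub (integrable_const _) (intb (ft t) fun y => hK y t), integral_const, mul_sub, smul_eq_mul,
        inv_mul_cancel_left₀ hV.ne']
    rw [e, abs_mul, abs_of_pos (inv_pos.2 hV)]
    refine mll (abs_integral_le_integral_abs.trans ?_) (inv_pos.2 hV).le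
    refine integral_mono ?_ (intb (ms1 t y) (hs1 t y)) fun y' => hs0 t y y'
    exact ((integrable_const _).sub (intb (ft t) fun y => hK y t)).abs
  have mg : Measurable (Function.uncurry fun t y => |f y t - V⁻¹ * ∫ y', f y' t ∂m|) :=
    ((hf.comp measurable_swap).sub ((mf.comp measurable_fst).const_mul _)).abs
  have bg : ∀ t y, |(|f y t - V⁻¹ * ∫ y', f y' t ∂m|)| ≤ V⁻¹ * (K' * V) := fun t y => by
    rw [abs_abs]
    exact (key t y).trans (mll ((le_abs_self _).trans (int_bd m (hs1 t y))) (inv_pos.2 hV).le)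
  rw [← integral_const_mul]
  refine integral_mono (intb (m := mT) (int_meas m mg) (fun t => int_bd m (bg t)))
    ((intb (m := mT) ms3 fun t => int_bd m fun y => int_bd m (hs1 t y)).const_mul _) fun t => ?_
  simp only
  rw [← integral_const_mul V⁻¹ (fun y => ∫ y', s t y y' ∂m)]
  refine integral_mono (intb (m := m) (mg.comp (by fun_prop : Measurable fun y => (t, y))) (bg t))
    ((intb (m := m) (ms2.comp (by fun_prop : Measurable fun y => (t, y))) fun y => int_bd m (hs1 t y)).const_mul _) fun y => key t y
structure AC (δ : ℝ) (a : G n → Mx n) : Prop where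
  meas : ∀ j k, Measurable fun q => a q j k
  symm : ∀ q j k, a q j k = a q k j
  ell : ∀ (q : G n) (θ : Fi n → ℝ),
          δ * ∑ j, (θ j) ^ 2 ≤ ∑ j, ∑ k, a q j k * θ j * θ k ∧
          ∑ j, ∑ k, a q j k * θ j * θ k ≤ δ⁻¹ * ∑ j, (θ j) ^ 2
variable {δ : ℝ} {a : G n → Mx n}
theorem AC.abs (hδ : 0 < δ) (ha : AC δ a) (q : G n) (j k : Fi n) : |a q j k| ≤ δ⁻¹ :=
  (mat_bounds hδ (ha.symm q) (ha.ell q)).2 j k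
theorem AC.measP (ha : AC δ a) (j k : Fi n) :
    Measurable (Function.uncurry fun (y : G' n) (τ : ℝ) => a (y.1, Fin.cons τ y.2) j k) := by
  have := (ha.meas j k).comp (Ps n).measurable
  have e : (Function.uncurry fun (y : G' n) (τ : ℝ) => a (y.1, Fin.cons τ y.2) j k) = (fun q => a q j k) ∘ Ps n := by
    funext ⟨y, τ⟩; simp [Ps_apply]
  rw [e]; exact this
noncomputable def frz (a : G n → Mx n) (S : Set (G' n)) (s : ℝ) (j k : Fi n) : ℝ :=
  (volume.real S)⁻¹ * ∫ y in S, a (y.1, Fin.cons s y.2) j k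
theorem vol_Gam {ρ : ℝ} (hρ : 0 < ρ) (t : ℝ) (x : Fin n → ℝ) : volume.real (GammaC ρ t x) = ρ ^ (n+2) * vQ n :=
  vol_Q hρ (t, x)
theorem frz_ell (hδ : 0 < δ) (ha : AC δ a) {S : Set (G' n)} (hS : 0 < volume.real S) (hS' : volume S < ⊤) :
    Ell δ (frz a S) := by
  have : IsFiniteMeasure (volume.restrict S) := ⟨by simpa using hS'⟩
  have it : ∀ s j k, Integrable (fun y : G' n => a (y.1, Fin.cons s y.2) j k) (volume.restrict S) := fun s j k =>
    intb ((ha.measP j k).comp (by fun_prop : Measurable fun y => (y, s))) fun y => ha.abs hδ _ j k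
  have it2 : ∀ s (θ : Fi n → ℝ), Integrable (fun y : G' n => ∑ j, ∑ k, a (y.1, Fin.cons s y.2) j k * θ j * θ k) (volume.restrict S) :=
    fun s θ => integrable_finsetSum _ fun j _ => integrable_finsetSum _ fun k _ => ((it s j k).mul_const _).mul_const _
  have e : ∀ s (θ : Fi n → ℝ), ∑ j, ∑ k, frz a S s j k * θ j * θ k =
      (volume.real S)⁻¹ * ∫ y in S, ∑ j, ∑ k, a (y.1, Fin.cons s y.2) j k * θ j * θ k := by
    intro s θ
    rw [integral_finsetSum _ fun j _ => integrable_finsetSum _ fun k _ => ((it s j k).mul_const _).mul_const _, Finset.mul_sum]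
    refine SC fun j _ => ?_
    rw [integral_finsetSum _ fun k _ => ((it s j k).mul_const _).mul_const _, Finset.mul_sum]
    refine SC fun k _ => ?_
    rw [integral_mul_const, integral_mul_const, frz]; ring
  have c : ∀ c : ℝ, ∫ y in S, c = volume.real S * c := fun c => by simp
  refine ⟨fun j k => ?_, fun s j k => ?_, fun s θ => ?_, fun s θ => ?_⟩
  · exact (int_meas (volume.restrict S) (f := fun s y => a (y.1, Fin.cons s y.2) j k) ((ha.measP j k).comp measurable_swap)).const_mul _
  · simp only [frz, ha.symm _ j k]
  · rw [e, le_inv_mul_iff₀ hS, ← c]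
    exact integral_mono (integrable_const _) (it2 s θ) fun y => (ha.ell _ θ).1
  · rw [e, inv_mul_le_iff₀ hS, ← c]
    exact integral_mono (it2 s θ) (integrable_const _) fun y => (ha.ell _ θ).2
noncomputable def ss (a : G n → Mx n) (τ : ℝ) (y y' : G' n) : ℝ :=
  ⨆ j, ⨆ k, |a (y.1, Fin.cons τ y.2) j k - a (y'.1, Fin.cons τ y'.2) j k|
theorem ss_le (a : G n → Mx n) (τ : ℝ) (y y' : G' n) (j k : Fi n) :
    |a (y.1, Fin.cons τ y.2) j k - a (y'.1, Fin.cons τ y'.2) j k| ≤ ss a τ y y' :=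
  (le_ciSup (f := fun k => |a (y.1, Fin.cons τ y.2) j k - a (y'.1, Fin.cons τ y'.2) j k|) (Set.finite_range _).bddAbove k).trans
    (le_ciSup (f := fun j => ⨆ k, |a (y.1, Fin.cons τ y.2) j k - a (y'.1, Fin.cons τ y'.2) j k|) (Set.finite_range _).bddAbove j)
theorem ss_abs (hδ : 0 < δ) (ha : AC δ a) (τ : ℝ) (y y' : G' n) : |ss a τ y y'| ≤ 2 * δ⁻¹ := by
  rw [abs_of_nonneg ((abs_nonneg _).trans (ss_le a τ y y' 0 0))]
  refine ciSup_le fun j => ciSup_le fun k => (abs_sub _ _).trans ?_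
  linarith [ha.abs hδ (y.1, Fin.cons τ y.2) j k, ha.abs hδ (y'.1, Fin.cons τ y'.2) j k]
theorem ss_meas (ha : AC δ a) : Measurable fun q : ℝ × G' n × G' n => ss a q.1 q.2.1 q.2.2 := by
  refine Measurable.iSup fun j => Measurable.iSup fun k => Measurable.abs (Measurable.sub ?_ ?_)
  · exact (ha.measP j k).comp (by fun_prop : Measurable fun q : ℝ × G' n × G' n => (q.2.1, q.1))
  · exact (ha.measP j k).comp (by fun_prop : Measurable fun q : ℝ × G' n × G' n => (q.2.2, q.1))
theorem Gam_fin {ρ : ℝ} (hρ : 0 < ρ) (t : ℝ) (x : Fin n → ℝ) : volume (GammaC ρ t x) < ⊤ := vol_Q_fin hρ (t, x)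
theorem osc_abs (hδ : 0 < δ) (ha : AC δ a) {ρ : ℝ} (hρ : 0 < ρ) (t : ℝ) (x : Fi n → ℝ) :
    |oscA a ρ t x| ≤ 4 * δ⁻¹ := by
  set Γ := GammaC ρ t (fun j : Fin n => x j.succ) with hΓ
  have : IsFiniteMeasure (volume.restrict Γ) := ⟨by simpa using Gam_fin hρ t _⟩
  have h : |∫ τ in Set.Ioo (x 0 - ρ) (x 0 + ρ), ∫ y in Γ, ∫ y' in Γ, ss a τ y y'| ≤ _ :=
    int_bd _ fun τ => int_bd _ fun y => int_bd _ fun y' => ss_abs hδ ha τ y y'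
  rw [measureReal_restrict_apply_univ, measureReal_restrict_apply_univ, hΓ, vol_Gam hρ, Real.volume_real_Ioo_of_le (by linarith)] at h
  have hv := vQ_pos n
  have e : oscA a ρ t x = (ρ^5 * (ρ ^ n * vQ n)^2)⁻¹ * ∫ τ in Set.Ioo (x 0 - ρ) (x 0 + ρ), ∫ y in Γ, ∫ y' in Γ, ss a τ y y' := by
    rw [oscA, vol_ballC hρ, mul_inv]; rfl
  rw [e, abs_mul, abs_of_pos (by positivity), inv_mul_le_iff₀ (by positivity)]
  refine h.trans (le_of_eq ?_)
  ring
theorem asharp_abs (hδ : 0 < δ) (ha : AC δ a) {R : ℝ} (hR : 0 < R) : aSharp a R ≤ 4 * δ⁻¹ ∧ 0 ≤ aSharp a R ∧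
    ∀ ρ, 0 < ρ → ρ ≤ R → ∀ t x, oscA a ρ t x ≤ aSharp a R := by
  have h0 : (0:ℝ) ≤ 4 * δ⁻¹ := by positivity
  have b1 : ∀ z : G n, BddAbove (Set.range fun r : {r : ℝ // 0 < r ∧ r ≤ R} => oscA a r.val z.1 z.2) := fun z =>
    ⟨4 * δ⁻¹, by rintro _ ⟨r, rfl⟩; exact (le_abs_self _).trans (osc_abs hδ ha r.2.1 _ _)⟩
  have b2 : BddAbove (Set.range fun z : G n => ⨆ r : {r : ℝ // 0 < r ∧ r ≤ R}, oscA a r.val z.1 z.2) :=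
    ⟨4 * δ⁻¹, by rintro _ ⟨z, rfl⟩; exact Real.iSup_le (fun r => (le_abs_self _).trans (osc_abs hδ ha r.2.1 _ _)) h0⟩
  have h3 : ∀ ρ, 0 < ρ → ρ ≤ R → ∀ t x, oscA a ρ t x ≤ aSharp a R := fun ρ h1 h2 t x =>
    (le_ciSup (b1 (t, x)) ⟨ρ, h1, h2⟩).trans (le_ciSup b2 (t, x))
  refine ⟨Real.iSup_le (fun z => Real.iSup_le (fun r => (le_abs_self _).trans (osc_abs hδ ha r.2.1 _ _)) h0) h0, ?_, h3⟩
  refine le_trans ?_ (h3 R hR le_rfl 0 0)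
  rw [oscA]
  refine mul_nonneg (by positivity) (integral_nonneg fun τ => integral_nonneg fun y => integral_nonneg fun y' => ?_)
  exact (abs_nonneg _).trans (ss_le a τ y y' 0 0)
theorem frz_osc (hδ : 0 < δ) (ha : AC δ a) {ρ R : ℝ} (hR : 0 < R) (hρ : 0 < ρ) (hρR : ρ ≤ R) (z : G n) (j k : Fi n) :
    ∫ p in Qcyl ρ z, |frz a (GammaC ρ z.1 fun i : Fin n => z.2 i.succ) (p.2 0) j k - a p j k| ≤ ρ ^ (n+3) * vQ n * aSharp a R := by
  set Γ := GammaC ρ z.1 (fun j : Fin n => z.2 j.succ) with hΓ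
  have fin : IsFiniteMeasure (volume.restrict Γ) := ⟨by simpa using Gam_fin hρ z.1 _⟩
  set I := Set.Ioo (z.2 0 - ρ) (z.2 0 + ρ) with hI
  have hv := vQ_pos n
  have vΓ : volume.real Γ = ρ ^ (n+2) * vQ n := vol_Gam hρ _ _
  have hEl : Ell δ (frz a Γ) := frz_ell hδ ha (by rw [vΓ]; positivity) (Gam_fin hρ z.1 _)
  set F : Fu n := fun p => |frz a Γ (p.2 0) j k - a p j k| with hF
  have mF : Measurable F := (((hEl.meas j k).comp meas_x0).sub (ha.meas j k)).abs
  have bF : ∀ p, |F p| ≤ 2 * δ⁻¹ := fun p => by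
    rw [hF, abs_abs]
    refine (abs_sub _ _).trans ?_
    linarith [ha.abs hδ p j k, hEl.abs hδ (p.2 0) j k]
  have st : Ps n ⁻¹' Qcyl ρ z ⊆ Γ ×ˢ I := by
    rintro ⟨y, τ⟩ h
    rw [Set.mem_preimage, Ps_apply] at h
    refine ⟨⟨h.1, ?_⟩, ?_⟩
    · have h2 := h.2
      rw [ballC, Set.mem_ofPred_eq, Fin.sum_univ_succ] at h2
      simp only [Fin.cons_succ] at h2
      refine lt_of_le_of_lt ?_ h2
      linarith [sq_nonneg ((Fin.cons τ y.2 : Fi n → ℝ) 0 - z.2 0)]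
    · have := ballC_sub hρ.le h.2 0
      rw [abs_lt] at this
      simp only [Fin.cons_zero] at this
      exact ⟨by linarith [this.1], by linarith [this.2]⟩
  have h1 : ∫ p in Qcyl ρ z, F p = ∫ q in Ps n ⁻¹' Qcyl ρ z, F (Ps n q) :=
    ((Ps_mp n).setIntegral_preimage_emb (Ps n).measurableEmbedding F _).symm
  have rp : (volume : Measure (G' n × ℝ)).restrict (Γ ×ˢ I) = (volume.restrict Γ).prod (volume.restrict I) := by
    rw [Measure.prod_restrict]; rfl
  have finI : IsFiniteMeasure (volume.restrict I) := ⟨by simp [hI]⟩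
  have mFP : Measurable fun q => F (Ps n q) := mF.comp (Ps n).measurable
  have h2 : ∫ q in Ps n ⁻¹' Qcyl ρ z, F (Ps n q) ≤ ∫ q in Γ ×ˢ I, F (Ps n q) := by
    refine setIntegral_mono_set ?_ (evf fun q => abs_nonneg _) (evf st)
    rw [IntegrableOn, rp]
    exact intb mFP fun q => bF _
  rw [rp, integral_prod_symm _ (intb mFP fun q => bF _)] at h2
  have h3 := abs_osc (volume.restrict Γ) (volume.restrict I) (f := fun (y : G' n) τ => a (y.1, Fin.cons τ y.2) j k) (s := ss a)
    (by rw [measureReal_restrict_apply_univ, vΓ]; positivity) (ha.measP j k) (fun y τ => ha.abs hδ _ j k) (ss_meas ha)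
    (fun τ y y' => ss_le a τ y y' j k) (fun τ y y' => ss_abs hδ ha τ y y')
  rw [measureReal_restrict_apply_univ] at h3
  rw [h1]
  have h4 : ∫ τ in I, ∫ y in Γ, F (Ps n (y, τ)) = ∫ τ in I, ∫ y in Γ, |a (y.1, Fin.cons τ y.2) j k - (volume.real Γ)⁻¹ * ∫ y' in Γ, a (y'.1, Fin.cons τ y'.2) j k| := by
    simp only [hF, Ps_apply, Fin.cons_zero, frz]
    simp only [abs_sub_comm]
  rw [h4] at h2
  refine (h2.trans h3).trans ?_
  have e : oscA a ρ z.1 z.2 = (ρ^5 * (ρ ^ n * vQ n)^2)⁻¹ * ∫ τ in I, ∫ y in Γ, ∫ y' in Γ, ss a τ y y' := by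
    rw [oscA, vol_ballC hρ, mul_inv]; rfl
  have h5 := (asharp_abs hδ ha hR).2.2 ρ hρ hρR z.1 z.2
  rw [e, inv_mul_le_iff₀ (by positivity)] at h5
  rw [vΓ, inv_mul_le_iff₀ (by positivity)]
  refine h5.trans (le_of_eq ?_)
  ring
end freeze
end KK
namespace KK
section holder
variable {n : ℕ}
theorem cs2 (f g : Mx n) :
    (∑ j, ∑ k, f j k * g j k) ^ 2 ≤ (∑ j, ∑ k, f j k ^ 2) * ∑ j, ∑ k, g j k ^ 2 := by
  have h := Finset.sum_mul_sq_le_sq_mul_sq (Finset.univ : Finset (Fi n × Fi n)) (fun x => f x.1 x.2) (fun x => g x.1 x.2)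
  simpa only [← Finset.univ_product_univ, Finset.sum_product] using h
theorem hold {X : Type*} [MeasurableSpace X] {m : Measure X} [IsFiniteMeasure m] {μ ν : ℝ} (hμ : 1 < μ) (hν : 1 < ν)
    (hμν : 1 / μ + 1 / ν = 1) {D U H : X → ℝ} (mD : Measurable D) (mU : Measurable U) (D0 : ∀ x, 0 ≤ D x) (U0 : ∀ x, 0 ≤ U x)
    {K K' : ℝ} (hK : 0 < K) (hD : ∀ x, D x ≤ K) (hU : ∀ x, U x ≤ K') {S : Set X} (hS : MeasurableSet S) (US : ∀ x, x ∉ S → U x = 0)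
    (H0 : ∀ x, 0 ≤ H x) (hH : ∀ x, H x ≤ D x * U x) {V E A : ℝ} (hV : 0 < V) (hE : 0 ≤ E) (hA : 0 ≤ A) (hDS : ∫ x in S, D x ∂m ≤ E * V * A) :
    V⁻¹ * ∫ x, H x ∂m ≤ (K ^ (ν - 1) * E) ^ (1/ν) * A ^ (1/ν) * (V⁻¹ * ∫ x, U x ^ μ ∂m) ^ (1/μ) := by
  have hc : ν.HolderConjugate μ := by
    rw [Real.holderConjugate_iff]; refine ⟨hν, ?_⟩
    rw [← hμν]; simp [add_comm]
  set f : X → ℝ := S.indicator D with hf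
  have mf : Measurable f := mD.indicator hS
  have f0 : ∀ x, 0 ≤ f x := fun x => Set.indicator_nonneg (fun x _ => D0 x) x
  have fK : ∀ x, f x ≤ K := fun x => (Set.indicator_le_self' (fun x _ => D0 x) x).trans (hD x)
  have bf : ∀ x, |f x| ≤ K := fun x => by rw [abs_of_nonneg (f0 x)]; exact fK x
  have bU : ∀ x, |U x| ≤ K' := fun x => by rw [abs_of_nonneg (U0 x)]; exact hU x
  have e1 : ∀ x, D x * U x = f x * U x := fun x => by
    by_cases h : x ∈ S
    · rw [hf, Set.indicator_of_mem h]
    · rw [US x h]; simp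
  have i1 : Integrable (fun x => f x * U x) m := (intb mU bU).bdd_mul (c := K) mf.aestronglyMeasurable (evf bf)
  have h1 : ∫ x, H x ∂m ≤ ∫ x, f x * U x ∂m :=
    integral_mono_of_nonneg (evf H0) i1 (evf fun x => (hH x).trans (e1 x).le)
  have h2 := integral_mul_le_Lp_mul_Lq_of_nonneg (μ := m) hc (evf f0) (evf U0)
    (MemLp.of_bound mf.aestronglyMeasurable K (evf bf))
    (MemLp.of_bound mU.aestronglyMeasurable K' (evf bU))
  have h3 : ∫ x, f x ^ ν ∂m ≤ K ^ (ν - 1) * (E * V * A) := by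
    have : ∫ x, f x ^ ν ∂m ≤ ∫ x, K ^ (ν - 1) * f x ∂m := by
      refine integral_mono_of_nonneg (evf fun x => Real.rpow_nonneg (f0 x) _) ((intb mf bf).const_mul _)
        (evf fun x => ?_)
      simp only
      rcases (f0 x).eq_or_lt with h | h
      · rw [← h, Real.zero_rpow (by linarith)]; simp
      · calc f x ^ ν = f x ^ (ν - 1) * f x := by rw [← Real.rpow_add_one h.ne']; ring_nf
          _ ≤ _ := mlr (Real.rpow_le_rpow h.le (fK x) (by linarith)) h.le
    refine this.trans ?_
    rw [integral_const_mul, hf, integral_indicator hS]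
    exact mll hDS (Real.rpow_nonneg hK.le _)
  have J0 : 0 ≤ ∫ x, f x ^ ν ∂m := integral_nonneg fun x => Real.rpow_nonneg (f0 x) _
  have I0 : 0 ≤ ∫ x, U x ^ μ ∂m := integral_nonneg fun x => Real.rpow_nonneg (U0 x) _
  set I := ∫ x, U x ^ μ ∂m
  have h4 := Real.rpow_le_rpow J0 h3 (by positivity : 0 ≤ 1/ν)
  have KE : 0 ≤ K ^ (ν - 1) * E := by positivity
  calc V⁻¹ * ∫ x, H x ∂m ≤ V⁻¹ * ((K ^ (ν - 1) * (E * V * A)) ^ (1/ν) * I ^ (1/μ)) :=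
        mll ((h1.trans h2).trans (mlr h4 (by positivity))) (by positivity)
    _ = _ := by
      rw [show K ^ (ν - 1) * (E * V * A) = (K ^ (ν - 1) * E) * (V * A) by ring, Real.mul_rpow KE (by positivity),
        Real.mul_rpow hV.le hA, Real.mul_rpow (by positivity : 0 ≤ V⁻¹) I0, Real.inv_rpow hV.le]
      have : V⁻¹ = (V ^ (1/μ))⁻¹ * (V ^ (1/ν))⁻¹ := by
        rw [← mul_inv, ← Real.rpow_add hV, hμν, Real.rpow_one]
      have h5 : 0 < V ^ (1/ν) := by positivity
      rw [this]; field_simp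
theorem off_cyl {u : Fu n} (hu : Cc u) {R : ℝ} (hR : 0 < R) (hs : Function.support u ⊆ Qcyl R (0 : G n)) (j k : Fi n)
    {p : G n} (hp : p ∉ Qcyl R (0 : G n)) : pdxx j k u p = 0 := by
  set Vc : Set (G n) := {q | 0 ≤ q.1 ∧ q.1 ≤ R^2 ∧ ∑ j, q.2 j ^ 2 ≤ R ^ 2} with hVc
  have cl : IsClosed Vc := by
    have h1 : IsClosed {q : G n | 0 ≤ q.1} := isClosed_le (by fun_prop) (by fun_prop)
    have h2 : IsClosed {q : G n | q.1 ≤ R^2} := isClosed_le (by fun_prop) (by fun_prop)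
    have h3 : IsClosed {q : G n | ∑ j, q.2 j ^ 2 ≤ R ^ 2} := isClosed_le (by fun_prop) (by fun_prop)
    exact h1.inter (h2.inter h3)
  have sub : Qcyl R (0 : G n) ⊆ Vc := by
    rintro q ⟨h1, h2⟩
    simp only [ballC, Set.mem_ofPred_eq] at h2
    simp at h1 h2
    exact ⟨h1.1.le, h1.2.le, h2.le⟩
  have ts : tsupport u ⊆ Vc := closure_minimal (hs.trans sub) cl
  have z0 : ∀ q, q ∉ Vc → pdxx j k u q = 0 := fun q hq => by
    have h1 : tsupport (pdxx j k u) ⊆ tsupport u :=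
      (tsupport_fderiv_apply_subset ℝ _).trans (tsupport_fderiv_apply_subset ℝ _)
    exact image_eq_zero_of_notMem_tsupport fun h => hq (ts (h1 h))
  have cont : Continuous (pdxx j k u) := (hu.pdxx j k).sm.cont
  let γ : ℝ → G n := fun l => (R^2/2 + l * (p.1 - R^2/2), l • p.2)
  have hγ : Continuous γ := by fun_prop
  have γ1 : γ 1 = p := by ext <;> simp [γ]
  have ev : ∀ᶠ l in nhdsWithin (1:ℝ) (Set.Ioi 1), pdxx j k u (γ l) = 0 := by
    filter_upwards [self_mem_nhdsWithin] with l hl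
    have hl' : 1 < l := hl
    refine z0 _ fun ⟨h1, h2, h3⟩ => hp ?_
    simp only [γ] at h1 h2 h3
    have R2 : 0 < R^2 := by positivity
    refine ⟨⟨?_, ?_⟩, ?_⟩
    · simp only [Prod.fst_zero]; by_contra hc; push Not at hc; nlinarith
    · simp only [Prod.fst_zero, zero_add]; by_contra hc; push Not at hc; nlinarith
    · simp only [ballC, Set.mem_ofPred_eq, Prod.snd_zero, Pi.zero_apply, sub_zero]
      have e : ∑ j, (l • p.2) j ^ 2 = l^2 * ∑ j, p.2 j ^ 2 := by
        rw [Finset.mul_sum]; exact SC fun j _ => by simp [mul_pow]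
      rw [e] at h3
      by_contra hc; push Not at hc
      have l2 : 1 < l ^ 2 := one_lt_pow₀ hl' two_ne_zero
      have := mll hc (by positivity : 0 ≤ l ^ 2)
      have := mul_lt_mul_of_pos_right l2 R2
      linarith
  have t1 : Filter.Tendsto (fun l => pdxx j k u (γ l)) (nhdsWithin (1:ℝ) (Set.Ioi 1)) (nhds (pdxx j k u p)) := by
    have := (cont.comp hγ).tendsto 1
    simp only [Function.comp_apply, γ1] at this
    exact this.mono_left nhdsWithin_le_nhds
  exact tendsto_nhds_unique t1 ((Filter.tendsto_congr' ev).2 tendsto_const_nhds)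
theorem froz {δ : ℝ} (hδ : 0 < δ) {μ ν : ℝ} (hμ : 1 < μ) (hν : 1 < ν) (hμν : 1 / μ + 1 / ν = 1) :
    ∃ C : ℝ, 0 < C ∧ ∀ a : G n → Mx n, AC δ a → ∀ R, 0 < R → ∀ u : Fu n, Cc u →
      Function.support u ⊆ Qcyl R (0 : G n) → ∀ P, 0 < P → ∀ z : G n, ∃ b, Ell δ b ∧
        avg (Qcyl P z) (fun y => (∑ j, ∑ k, (b (y.2 0) j k - a y j k) * pdxx j k u y) ^ 2) ≤
          C * (aSharp a R) ^ (1/ν) * (avg (Qcyl P z) fun y => (∑ j, ∑ k, pdxx j k u y ^ 2) ^ μ) ^ (1/μ) := by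
  have hv := vQ_pos n
  have hv' := vQ_pos (n+1)
  set K : ℝ := ((n:ℝ)+1)*((n+1)*(2*δ⁻¹)^2) with hKd
  have hK : 0 < K := by positivity
  set E : ℝ := ((n:ℝ)+1)*((n+1)*(2*δ⁻¹ * (vQ n * (vQ (n+1))⁻¹))) with hE
  refine ⟨(K ^ (ν - 1) * E) ^ (1/ν), by positivity, fun a ha R hR u hu hs P hP z => ?_⟩
  have A0 := (asharp_abs hδ ha hR).2.1
  obtain ⟨ρ, ζ, hρ, hρR, hρP, hout⟩ : ∃ (ρ : ℝ) (ζ : G n), 0 < ρ ∧ ρ ≤ R ∧ ρ ≤ P ∧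
      ∀ y ∈ Qcyl P z, y ∉ Qcyl ρ ζ → ∀ j k, pdxx j k u y = 0 := by
    rcases le_total P R with h | h
    · exact ⟨P, z, hP, h, le_rfl, fun y h1 h2 => absurd h1 h2⟩
    · exact ⟨R, 0, hR, le_rfl, h, fun y h1 h2 j k => off_cyl hu hR hs j k h2⟩
  set Γ := GammaC ρ ζ.1 (fun j : Fin n => ζ.2 j.succ) with hΓ
  have vΓ : volume.real Γ = ρ ^ (n+2) * vQ n := vol_Gam hρ _ _
  have hEl : Ell δ (frz a Γ) := frz_ell hδ ha (by rw [vΓ]; positivity) (Gam_fin hρ ζ.1 _)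
  refine ⟨frz a Γ, hEl, ?_⟩
  set c : Fi n → Fi n → Fu n := fun j k y => frz a Γ (y.2 0) j k - a y j k with hc
  have mc : ∀ j k, Measurable (c j k) := fun j k => ((hEl.meas j k).comp meas_x0).sub (ha.meas j k)
  have bc : ∀ j k y, |c j k y| ≤ 2 * δ⁻¹ := fun j k y =>
    (abs_sub _ _).trans (by linarith [ha.abs hδ y j k, hEl.abs hδ (y.2 0) j k])
  set Q := Qcyl P z with hQ
  set S := Qcyl ρ ζ with hS
  have fin : IsFiniteMeasure (volume.restrict Q) := ⟨by simpa using vol_Q_fin hP z⟩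
  have finS : IsFiniteMeasure (volume.restrict S) := ⟨by simpa using vol_Q_fin hρ ζ⟩
  have mS : MeasurableSet S := (Q_open ρ ζ).measurableSet
  have mQ : MeasurableSet Q := (Q_open P z).measurableSet
  set Vv := (volume Q).toReal with hVv
  have eV : Vv = P ^ (n+3) * vQ (n+1) := vol_Q hP z
  have hV : 0 < Vv := by rw [eV]; positivity
  set D : Fu n := fun y => ∑ j, ∑ k, c j k y ^ 2 with hD
  have mD : Measurable D := Finset.measurable_fun_sum _ fun j _ => Finset.measurable_fun_sum _ fun k _ => (mc j k).pow_const 2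
  have D0 : ∀ y, 0 ≤ D y := fun y => SN fun j _ => SN fun k _ => sq_nonneg _
  have s2 : ∀ (f : Mx n) (M : ℝ), (∀ j k, f j k ≤ M) → ∑ j, ∑ k, f j k ≤ ((n:ℝ)+1)*((n+1)*M) := by
    intro f M h
    refine (Finset.sum_le_sum fun j _ => Finset.sum_le_sum fun k _ => h j k).trans (le_of_eq ?_)
    simp
  have DK : ∀ y, D y ≤ K := fun y => s2 _ _ fun j k => by
    rw [← sq_abs]; exact pow_le_pow_left₀ (abs_nonneg _) (bc j k y) 2
  have BU : BC fun y : G n => ∑ j, ∑ k, pdxx j k u y ^ 2 := BC.sum _ fun j => BC.sum _ fun k => (hu.pdxx j k).bc.sq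
  set U : Fu n := Q.indicator fun y => ∑ j, ∑ k, pdxx j k u y ^ 2 with hU
  have U0' : ∀ y, 0 ≤ ∑ j, ∑ k, pdxx j k u y ^ 2 := fun y => SN fun j _ => SN fun k _ => sq_nonneg _
  have U0 : ∀ y, 0 ≤ U y := fun y => Set.indicator_nonneg (fun y _ => U0' y) y
  obtain ⟨⟨mU', K', hK'⟩, _⟩ := BU
  have mU : Measurable U := mU'.indicator mQ
  have UK : ∀ y, U y ≤ K' := fun y => (Set.indicator_le_self' (fun y _ => U0' y) y).trans ((le_abs_self _).trans (hK' y))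
  have US : ∀ y, y ∉ S → U y = 0 := fun y hy => by
    by_cases h : y ∈ Q
    · rw [hU, Set.indicator_of_mem h]
      exact Finset.sum_eq_zero fun j _ => Finset.sum_eq_zero fun k _ => by rw [hout y h hy j k]; simp
    · rw [hU, Set.indicator_of_notMem h]
  have hDS : ∫ y in S, D y ∂(volume.restrict Q) ≤ E * Vv * aSharp a R := by
    have i1 : ∀ j k, Integrable (fun y => |c j k y|) (volume.restrict S) := fun j k =>
      intb (mc j k).abs (K := 2 * δ⁻¹) fun y => by rw [abs_abs]; exact bc j k y
    calc ∫ y in S, D y ∂(volume.restrict Q) ≤ ∫ y in S, D y := by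
          rw [Measure.restrict_restrict mS]
          refine setIntegral_mono_set ?_ (evf D0) (evf fun y hy => hy.1)
          exact intb mD (K := K) fun y => by rw [abs_of_nonneg (D0 y)]; exact DK y
      _ ≤ ∫ y in S, ∑ j, ∑ k, 2 * δ⁻¹ * |c j k y| := by
          refine integral_mono_of_nonneg (evf D0)
            (integrable_finsetSum _ fun j _ => integrable_finsetSum _ fun k _ => (i1 j k).const_mul _)
            (evf fun y => Finset.sum_le_sum fun j _ => Finset.sum_le_sum fun k _ => ?_)
          rw [← sq_abs, sq]
          exact mlr (bc j k y) (abs_nonneg _)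
      _ = ∑ j, ∑ k, 2 * δ⁻¹ * ∫ y in S, |c j k y| := by
          rw [integral_finsetSum _ fun j _ => integrable_finsetSum _ fun k _ => (i1 j k).const_mul _]
          refine SC fun j _ => ?_
          rw [integral_finsetSum _ fun k _ => (i1 j k).const_mul _]
          exact SC fun k _ => integral_const_mul _ _
      _ ≤ ((n:ℝ)+1)*((n+1)*(2 * δ⁻¹ * (P ^ (n+3) * vQ n * aSharp a R))) := by
          refine s2 _ _ fun j k => mll ((frz_osc hδ ha hR hρ hρR ζ j k).trans ?_) (by positivity)
          gcongr
      _ = _ := by rw [hE, eV]; field_simp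
  have key := hold (m := volume.restrict Q) hμ hν hμν (D := D) (U := U)
    (H := Q.indicator fun y => (∑ j, ∑ k, c j k y * pdxx j k u y) ^ 2) mD mU D0 U0 hK DK UK mS US
    (fun y => Set.indicator_nonneg (fun y _ => sq_nonneg _) y) (fun y => by
      by_cases h : y ∈ Q
      · rw [hU, Set.indicator_of_mem h, Set.indicator_of_mem h]
        exact cs2 _ _
      · rw [hU, Set.indicator_of_notMem h, Set.indicator_of_notMem h]; simp) hV (by positivity) A0 hDS
  have e1 : ∫ y, Q.indicator (fun y => (∑ j, ∑ k, c j k y * pdxx j k u y) ^ 2) y ∂(volume.restrict Q) =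
      ∫ y in Q, (∑ j, ∑ k, c j k y * pdxx j k u y) ^ 2 :=
    setIntegral_congr_fun mQ fun y hy => Set.indicator_of_mem hy _
  have e2 : ∫ y, U y ^ μ ∂(volume.restrict Q) = ∫ y in Q, (∑ j, ∑ k, pdxx j k u y ^ 2) ^ μ :=
    setIntegral_congr_fun mQ fun y hy => by simp only [hU, Set.indicator_of_mem hy]
  rw [e1, e2] at key
  exact key
end holder
end KK
namespace KK
section final
theorem opt {A B m X : ℝ} (hA : 0 ≤ A) (hB : 0 ≤ B) (hm : 0 < m) (h : ∀ κ : ℝ, 4 ≤ κ → X ≤ κ⁻¹ * B + κ ^ m * A) :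
    X ≤ 2 * (A ^ (1/(1+m)) * B ^ (m/(1+m))) + 2 * 4 ^ m * A := by
  rcases hA.eq_or_lt with h0 | h0
  · subst h0
    rw [Real.zero_rpow (by positivity)]
    simp only [mul_zero, zero_mul, add_zero] at h ⊢
    have t : Filter.Tendsto (fun κ : ℝ => κ⁻¹ * B) Filter.atTop (nhds (0 * B)) := tendsto_inv_atTop_zero.mul_const B
    rw [zero_mul] at t
    exact ge_of_tendsto t ((Filter.eventually_ge_atTop 4).mono h)
  · have m1 : 0 < 1 + m := by linarith
    set κ := (B/A) ^ (1/(1+m)) with hκ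
    have p0 : 0 ≤ A ^ (1/(1+m)) * B ^ (m/(1+m)) := by positivity
    rcases le_total 4 κ with h4 | h4
    · have κ0 : 0 < κ := by linarith
      have hBA : 0 < B / A := by
        rcases (div_nonneg hB hA).eq_or_lt with h' | h'
        · rw [hκ, ← h', Real.zero_rpow (by positivity)] at κ0; exact absurd κ0 (lt_irrefl _)
        · exact h'
      have hB0 : 0 < B := by
        have := mul_pos hBA h0; rwa [div_mul_cancel₀ _ h0.ne'] at this
      have e1 : κ ^ m * A = A ^ (1/(1+m)) * B ^ (m/(1+m)) := by
        rw [hκ, ← Real.rpow_mul hBA.le, Real.div_rpow hB hA, show 1/(1+m)*m = m/(1+m) by ring]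
        have : A = A ^ (1/(1+m)) * A ^ (m/(1+m)) := by
          rw [← Real.rpow_add h0, show 1/(1+m) + m/(1+m) = 1 by field_simp, Real.rpow_one]
        have h5 : 0 < A ^ (m/(1+m)) := by positivity
        nth_rewrite 2 [this]; field_simp
      have e2 : κ⁻¹ * B = A ^ (1/(1+m)) * B ^ (m/(1+m)) := by
        rw [hκ, Real.div_rpow hB hA]
        have : B = B ^ (1/(1+m)) * B ^ (m/(1+m)) := by
          rw [← Real.rpow_add hB0, show 1/(1+m) + m/(1+m) = 1 by field_simp, Real.rpow_one]
        have h5 : 0 < B ^ (1/(1+m)) := by positivity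
        have h6 : 0 < A ^ (1/(1+m)) := by positivity
        nth_rewrite 2 [this]; field_simp
      have := h κ h4
      rw [e1, e2] at this
      have : 0 ≤ 2 * 4 ^ m * A := by positivity
      linarith
    · have hB4 : B ≤ 4 * 4 ^ m * A := by
        have := Real.rpow_le_rpow (by positivity) h4 m1.le
        rw [hκ, ← Real.rpow_mul (by positivity), show 1/(1+m)*(1+m) = 1 by field_simp, Real.rpow_one, Real.rpow_add (by norm_num), Real.rpow_one,
          div_le_iff₀ h0] at this
        exact this
      have := h 4 le_rfl
      linarith
theorem comb (n : ℕ) {N H0 C0 : ℝ} (hN : 0 < N) (hH : 0 < H0) (hC0 : 0 < C0) : ∃ C : ℝ, 0 < C ∧ ∀ X MF MU MM h : ℝ, 0 ≤ MF → 0 ≤ MU → MU ≤ MM →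
    0 ≤ h → h ≤ H0 → (∀ κ : ℝ, 4 ≤ κ → X ≤ C0 * (κ⁻¹ * √MU + √(κ ^ (n+3)) * √(2 * MF + 2 * (N * h * MM)))) →
    X ≤ C * h ^ (1/((n:ℝ)+5)) * MM ^ ((1:ℝ)/2) + C * MF ^ (1/((n:ℝ)+5)) * MU ^ (((n:ℝ)+3)/(2*(n:ℝ)+10)) + C * MF ^ ((1:ℝ)/2) := by
  set α : ℝ := 1/((n:ℝ)+5) with hα
  set β : ℝ := ((n:ℝ)+3)/(2*(n:ℝ)+10) with hβ
  set m : ℝ := ((n:ℝ)+3)/2 with hm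
  have α0 : 0 < α := by positivity
  have β0 : 0 < β := by positivity
  have m0 : 0 < m := by positivity
  have α2 : α ≤ 1/2 := by
    rw [hα]; refine one_div_le_one_div_of_le (by norm_num) ?_
    have : (0:ℝ) ≤ n := by positivity
    linarith
  have αβ : α + β = 1/2 := by
    rw [hα, hβ, show 2*(n:ℝ)+10 = 2*((n:ℝ)+5) by ring]; field_simp; ring
  have e1 : 1/(1+m) = 2*α := by rw [hα, hm]; field_simp; ring
  have e2 : m/(1+m) = 2*β := by
    rw [hβ, hm, show 2*(n:ℝ)+10 = 2*((n:ℝ)+5) by ring]; field_simp; ring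
  set T : ℝ := (2*N) ^ ((1:ℝ)/2) * H0 ^ (1/2 - α) with hT
  have T0 : 0 < T := by positivity
  set c1 : ℝ := 2 * 2 ^ α with hc1
  set c2 : ℝ := 2 * (2*N) ^ α with hc2
  set c3 : ℝ := 2 * 4 ^ m with hc3
  set c4 : ℝ := 2 ^ ((1:ℝ)/2) with hc4
  have c10 : 0 < c1 := by positivity
  have c20 : 0 < c2 := by positivity
  have c30 : 0 < c3 := by positivity
  have c40 : 0 < c4 := by positivity
  refine ⟨C0 * (c1 + c2 + c3 * c4 + c3 * T), by positivity, fun X MF MU MM h hMF hMU hM h0 h1 H => ?_⟩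
  have hMM : 0 ≤ MM := hMU.trans hM
  set Y := 2 * MF + 2 * (N * h * MM) with hY
  have Y0 : 0 ≤ Y := by positivity
  have hX : X / C0 ≤ 2 * ((√Y) ^ (1/(1+m)) * (√MU) ^ (m/(1+m))) + 2 * 4 ^ m * √Y := by
    refine opt (Real.sqrt_nonneg _) (Real.sqrt_nonneg _) m0 fun κ hκ => ?_
    have κ0 : 0 < κ := by linarith
    rw [div_le_iff₀ hC0]
    have := H κ hκ
    have e : √(κ ^ (n+3)) = κ ^ m := by
      rw [Real.sqrt_eq_rpow, ← Real.rpow_natCast, ← Real.rpow_mul κ0.le, hm]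
      congr 1; push_cast; ring
    rw [e] at this
    linarith
  have s1 : (√Y) ^ (1/(1+m)) = Y ^ α := by
    rw [Real.sqrt_eq_rpow, ← Real.rpow_mul Y0, e1]; congr 1; ring
  have s2 : (√MU) ^ (m/(1+m)) = MU ^ β := by
    rw [Real.sqrt_eq_rpow, ← Real.rpow_mul hMU, e2]; congr 1; ring
  rw [s1, s2, Real.sqrt_eq_rpow] at hX
  have sub : ∀ γ : ℝ, 0 ≤ γ → γ ≤ 1 → Y ^ γ ≤ 2 ^ γ * MF ^ γ + (2*N) ^ γ * (h ^ γ * MM ^ γ) := fun γ g0 g1 => by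
    refine (Real.rpow_add_le_add_rpow (by positivity) (by positivity) g0 g1).trans (le_of_eq ?_)
    rw [Real.mul_rpow (by norm_num) hMF, show 2 * (N * h * MM) = (2*N) * (h * MM) by ring, Real.mul_rpow (by positivity) (by positivity),
      Real.mul_rpow h0 hMM]
  have y1 := sub α α0.le (by linarith)
  have y2 := sub (1/2) (by norm_num) (by norm_num)
  set P := h ^ α * MM ^ ((1:ℝ)/2) with hP
  have P0 : 0 ≤ P := by positivity
  have k1 : h ^ α * MM ^ α * MU ^ β ≤ P := by
    rw [mul_assoc]
    refine mll ?_ (by positivity)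
    calc MM ^ α * MU ^ β ≤ MM ^ α * MM ^ β := mll (Real.rpow_le_rpow hMU hM β0.le) (by positivity)
      _ = _ := by rw [← Real.rpow_add_of_nonneg hMM α0.le β0.le, αβ]
  have k2 : h ^ ((1:ℝ)/2) ≤ H0 ^ (1/2 - α) * h ^ α := by
    calc h ^ ((1:ℝ)/2) = h ^ (1/2 - α) * h ^ α := by
          rw [← Real.rpow_add_of_nonneg h0 (by linarith) α0.le]; congr 1; ring
      _ ≤ _ := mlr (Real.rpow_le_rpow h0 h1 (by linarith)) (by positivity)
  have k3 : (2*N) ^ ((1:ℝ)/2) * (h ^ ((1:ℝ)/2) * MM ^ ((1:ℝ)/2)) ≤ T * P := by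
    calc _ ≤ (2*N) ^ ((1:ℝ)/2) * ((H0 ^ (1/2 - α) * h ^ α) * MM ^ ((1:ℝ)/2)) := by gcongr
      _ = _ := by rw [hT, hP]; ring
  set F2 := MF ^ ((1:ℝ)/2) with hF2
  set Fa := MF ^ α * MU ^ β with hFa
  have F20 : 0 ≤ F2 := by positivity
  have Fa0 : 0 ≤ Fa := by positivity
  have z1 : 2 * (Y ^ α * MU ^ β) ≤ c1 * Fa + c2 * P := by
    have b0 : 0 ≤ MU ^ β := by positivity
    calc 2 * (Y ^ α * MU ^ β) ≤ 2 * ((2 ^ α * MF ^ α + (2*N) ^ α * (h ^ α * MM ^ α)) * MU ^ β) := by gcongr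
      _ = c1 * Fa + c2 * (h ^ α * MM ^ α * MU ^ β) := by rw [hc1, hc2, hFa]; ring
      _ ≤ _ := by gcongr
  have z2 : 2 * 4 ^ m * Y ^ ((1:ℝ)/2) ≤ c3 * (c4 * F2 + T * P) := by
    refine mll (y2.trans ?_) c30.le
    rw [hc4, hF2]; exact add_le_add_right k3 _
  rw [div_le_iff₀ hC0] at hX
  have z3 : X ≤ (c1 * Fa + c2 * P + c3 * (c4 * F2 + T * P)) * C0 := hX.trans (mlr (add_le_add z1 z2) hC0.le)
  refine z3.trans ?_
  have g1 : C0 * (c1 + c2 + c3 * c4 + c3 * T) * h ^ α * MM ^ ((1:ℝ)/2) = C0 * (c1 + c2 + c3 * c4 + c3 * T) * P := by rw [hP]; ring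
  have g2 : C0 * (c1 + c2 + c3 * c4 + c3 * T) * MF ^ α * MU ^ β = C0 * (c1 + c2 + c3 * c4 + c3 * T) * Fa := by rw [hFa]; ring
  rw [g1, g2]
  have w1 : 0 ≤ C0 * (c1 + c3 * c4) * P := by positivity
  have w2 : 0 ≤ C0 * (c2 + c3 * c4 + c3 * T) * Fa := by positivity
  have w3 : 0 ≤ C0 * (c1 + c2 + c3 * T) * F2 := by positivity
  linarith only [w1, w2, w3]
theorem max_nonneg' {d : ℕ} (g : ℝ × (Fin d → ℝ) → ℝ) (p : ℝ × (Fin d → ℝ)) : 0 ≤ maxFn g p :=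
  Real.iSup_nonneg fun q => mul_nonneg (by positivity) (integral_nonneg fun y => abs_nonneg _)
theorem le_max' {d : ℕ} {g : ℝ × (Fin d → ℝ) → ℝ} {K : ℝ} (h : ∀ y, |g y| ≤ K) {p : ℝ × (Fin d → ℝ)} {r : ℝ} (hr : 0 < r)
    {z : ℝ × (Fin d → ℝ)} (hp : p ∈ Qcyl r z) : avg (Qcyl r z) (fun y => |g y|) ≤ maxFn g p := by
  have K0 : 0 ≤ K := (abs_nonneg _).trans (h 0)
  refine le_ciSup (f := fun q : {q : ℝ × (ℝ × (Fin d → ℝ)) // 0 < q.1 ∧ p ∈ Qcyl q.1 q.2} => avg (Qcyl q.val.1 q.val.2) fun y => |g y|)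
    ⟨K, ?_⟩ ⟨(r, z), hr, hp⟩
  rintro _ ⟨⟨⟨s, w⟩, hs, hw⟩, rfl⟩
  simp only at hs
  have : IsFiniteMeasure (volume.restrict (Qcyl s w)) := ⟨by simpa using vol_Q_fin hs w⟩
  have h1 := int_bd (volume.restrict (Qcyl s w)) (f := fun y => |g y|) fun y => by rw [abs_abs]; exact h y
  rw [measureReal_restrict_apply_univ] at h1
  have v0 : 0 < (volume (Qcyl s w)).toReal := by
    rw [vol_Q hs]; have := vQ_pos d; positivity
  simp only [avg]
  rw [inv_mul_le_iff₀ v0, mul_comm]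
  exact (le_abs_self _).trans h1
end final
end KK
namespace KK
section last
variable {n : ℕ}
theorem Qs_mem {r P : ℝ} (hr : 0 < r) (hP : 2 * r ≤ P) {z p : G n} (hp : p ∈ Qcyl r z) : p ∈ Qs P z := by
  obtain ⟨⟨h1, h2⟩, h3⟩ := hp
  have hq : (2*r)^2 ≤ P^2 := pow_le_pow_left₀ (by positivity) hP 2
  have r2 : 0 < r^2 := by positivity
  refine ⟨⟨?_, ?_⟩, ?_⟩
  · simp only; linarith
  · simp only; linarith
  · have h4 : ∑ j, (p.2 j - z.2 j) ^ 2 < r ^ 2 := h3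
    show ∑ j, (p.2 j - z.2 j) ^ 2 < P ^ 2
    linarith
theorem jens {μ ν : ℝ} (hμ : 1 < μ) (hν : 1 < ν) (hμν : 1 / μ + 1 / ν = 1) {U : Fu n} (mU : Measurable U) {K : ℝ}
    (U0 : ∀ y, 0 ≤ U y) (hK : ∀ y, U y ≤ K) (p : G n) : maxFn U p ≤ (maxFn (fun y => U y ^ μ) p) ^ (1/μ) := by
  refine Real.iSup_le ?_ (Real.rpow_nonneg (max_nonneg' _ _) _)
  rintro ⟨⟨r, z⟩, hr, hp⟩
  simp only at hr hp ⊢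
  have fin : IsFiniteMeasure (volume.restrict (Qcyl r z)) := ⟨by simpa using vol_Q_fin hr z⟩
  have v0 : 0 < (volume (Qcyl r z)).toReal := by
    rw [vol_Q hr]; have := vQ_pos (n+1); positivity
  have h := hold (m := volume.restrict (Qcyl r z)) hμ hν hμν (D := fun _ => 1) (U := U) (H := U) measurable_const mU (fun _ => zero_le_one)
    U0 one_pos (fun _ => le_rfl) hK MeasurableSet.univ (fun y hy => absurd (Set.mem_univ y) hy) U0 (fun y => by rw [one_mul]) v0 zero_le_one zero_le_one
    (by simp [Measure.real])
  simp only [Real.one_rpow, one_mul] at h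
  have hb : ∀ y, |U y ^ μ| ≤ K ^ μ := fun y => by
    rw [abs_of_nonneg (Real.rpow_nonneg (U0 y) _)]
    exact Real.rpow_le_rpow (U0 y) (hK y) (by linarith)
  have h2 := le_max' hb hr hp
  simp only [abs_of_nonneg (U0 _), abs_of_nonneg (Real.rpow_nonneg (U0 _) μ)] at h2 ⊢
  exact h.trans (Real.rpow_le_rpow (mul_nonneg (by positivity) (integral_nonneg fun y => Real.rpow_nonneg (U0 y) _)) h2 (by positivity))
theorem mainW (n : ℕ) {δ : ℝ} (hδ : 0 < δ) (hδ1 : δ ≤ 1) {μ ν : ℝ} (hμ : 1 < μ) (hν : 1 < ν) (hμν : 1 / μ + 1 / ν = 1) :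
    ∃ N : ℝ, 0 < N ∧ ∀ a : G n → Mx n, AC δ a → ∀ R, 0 < R → ∀ u : Fu n, Cc u →
      Function.support u ⊆ Qcyl R (0 : G n) → ∀ p i, sharpFn (W i u) p ≤ N * (aSharp a R) ^ ((1 / ((n : ℝ) + 5)) / ν) *
                    (maxFn (fun y => (∑ j, ∑ k, (pdxx j k u y) ^ 2) ^ μ) p)
                      ^ (1 / (2 * μ))
                  + N * (maxFn (fun y =>
                        (pdt u y + ∑ j, ∑ k, a y j k * pdxx j k u y) ^ 2) p)
                      ^ (1 / ((n : ℝ) + 5)) *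
                    (maxFn (fun y => ∑ j, ∑ k, (pdxx j k u y) ^ 2) p)
                      ^ (((n : ℝ) + 3) / (2 * (n : ℝ) + 10))
                  + N * (maxFn (fun y =>
                        (pdt u y + ∑ j, ∑ k, a y j k * pdxx j k u y) ^ 2) p)
                      ^ ((1 : ℝ) / 2) := by
  obtain ⟨C0, hC0, HS⟩ := scaled n hδ hδ1
  obtain ⟨N0, hN0, HF⟩ := froz (n := n) hδ hμ hν hμν
  obtain ⟨C, hC, HC⟩ := comb n hN0 (by positivity : 0 < (4 * δ⁻¹) ^ (1/ν)) hC0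
  refine ⟨C, hC, fun a ha R hR u hu hs p i => ?_⟩
  obtain ⟨A1, A0, -⟩ := asharp_abs hδ ha hR
  set U : Fu n := fun y => ∑ j, ∑ k, (pdxx j k u y) ^ 2 with hU
  have U0 : ∀ y, 0 ≤ U y := fun y => SN fun j _ => SN fun k _ => sq_nonneg _
  have BU : BC U := BC.sum _ fun j => BC.sum _ fun k => (hu.pdxx j k).bc.sq
  obtain ⟨K, hK⟩ := BU.1.2
  have UK : ∀ y, U y ≤ K := fun y => (le_abs_self _).trans (hK y)
  set f : Fu n := fun y => pdt u y + ∑ j, ∑ k, a y j k * pdxx j k u y with hf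
  have Bf : BC f := hu.pdt.bc.add (BC.sum _ fun j => BC.sum _ fun k =>
    BM.mulBC ⟨ha.meas j k, δ⁻¹, fun y => ha.abs hδ y j k⟩ (hu.pdxx j k).bc)
  obtain ⟨Kf, hKf⟩ := Bf.sq.1.2
  set MF := maxFn (fun y => f y ^ 2) p with hMF
  set MU := maxFn U p with hMU
  set MP := maxFn (fun y => U y ^ μ) p with hMP
  have MF0 : 0 ≤ MF := max_nonneg' _ _
  have MU0 : 0 ≤ MU := max_nonneg' _ _
  have MP0 : 0 ≤ MP := max_nonneg' _ _
  have hJ : MU ≤ MP ^ (1/μ) := jens hμ hν hμν BU.1.1 U0 UK p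
  have hb : ∀ y, |U y ^ μ| ≤ K ^ μ := fun y => by
    rw [abs_of_nonneg (Real.rpow_nonneg (U0 y) _)]
    exact Real.rpow_le_rpow (U0 y) (UK y) (by linarith)
  refine Real.iSup_le ?_ (by positivity)
  rintro ⟨⟨r, z⟩, hr, hp⟩
  simp only at hr hp ⊢
  have fin := HC (avg (Qcyl r z) fun y => |W i u y - avg (Qcyl r z) (W i u)|) MF MU (MP ^ (1/μ)) ((aSharp a R) ^ (1/ν)) MF0 MU0 hJ
    (by positivity) (Real.rpow_le_rpow A0 A1 (by positivity)) ?_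
  · rw [← Real.rpow_mul A0, ← Real.rpow_mul MP0, show 1/ν * (1/((n:ℝ)+5)) = (1/((n:ℝ)+5))/ν by ring, show 1/μ * (1/2) = 1/(2*μ) by field_simp] at fin
    exact fin
  · intro κ hκ
    have κ0 : 0 < κ := by linarith
    set P := ((n:ℝ)+2) * (κ * r) with hP
    have P0 : 0 < P := by positivity
    have hPr : 2 * r ≤ P := by
      have h1 : r ≤ κ * r := by nlinarith
      have h2 : (0:ℝ) ≤ n * (κ * r) := by positivity
      rw [hP]; linarith
    have pQ : p ∈ Qs P z := Qs_mem hr hPr hp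
    obtain ⟨b, hbE, hbb⟩ := HF a ha R hR u hu hs P P0 (z.1 - P^2/2, z.2)
    refine (HS b hbE u hu r hr z κ hκ i).trans (mll (add_le_add ?_ ?_) hC0.le)
    · refine mll (Real.sqrt_le_sqrt ?_) (by positivity)
      have := le_max' hK P0 pQ
      simp only [abs_of_nonneg (U0 _)] at this
      exact this
    · refine mll (Real.sqrt_le_sqrt ?_) (by positivity)
      set e : Fu n := fun y => ∑ j, ∑ k, (b (y.2 0) j k - a y j k) * pdxx j k u y with he
      have dec : ∀ y, Lb 1 b u y = f y + e y := fun y => by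
        simp only [Lb, hf, he, sub_mul, Finset.sum_sub_distrib]; ring
      have Be : BC e := by
        have := (Lb_BC hδ hbE 1 hu).sub Bf
        have h' : (fun y => Lb 1 b u y - f y) = e := by funext y; rw [dec]; ring
        rwa [h'] at this
      have v0 : 0 ≤ ((volume (Qs P z)).toReal)⁻¹ := by positivity
      have i1 : IntegrableOn (fun y => 2 * f y ^ 2) (Qs P z) := ((Bf.sq.cmul 2).integrable (m := volume)).integrableOn
      have i2 : IntegrableOn (fun y => 2 * e y ^ 2) (Qs P z) := ((Be.sq.cmul 2).integrable (m := volume)).integrableOn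
      have m1 : avg (Qs P z) (fun y => Lb 1 b u y ^ 2) ≤ 2 * avg (Qs P z) (fun y => f y ^ 2) + 2 * avg (Qs P z) (fun y => e y ^ 2) := by
        have : ∫ y in Qs P z, Lb 1 b u y ^ 2 ≤ ∫ y in Qs P z, (2 * f y ^ 2 + 2 * e y ^ 2) := by
          refine integral_mono ((Lb_BC hδ hbE 1 hu).sq.integrable (m := volume)).integrableOn (i1.add i2) fun y => ?_
          simp only [dec]
          linarith [sq_nonneg (f y - e y)]
        rw [integral_add i1 i2, integral_const_mul, integral_const_mul] at this
        have := mll this v0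
        unfold avg
        linarith
      refine m1.trans (add_le_add (mll ?_ zero_le_two) (mll ?_ zero_le_two))
      · have := le_max' hKf P0 pQ
        simp only [abs_of_nonneg (sq_nonneg (f _))] at this
        exact this
      · refine hbb.trans (mll ?_ (by positivity))
        have := le_max' hb P0 pQ
        simp only [abs_of_nonneg (Real.rpow_nonneg (U0 _) μ)] at this
        exact Real.rpow_le_rpow (mul_nonneg (by positivity) (integral_nonneg fun y => Real.rpow_nonneg (U0 y) _)) this (by positivity)
end last
end KK

theorem stmt14 (n : ℕ) (hn : 1 ≤ n) (δ : ℝ) (hδ : δ ∈ Set.Ioo (0 : ℝ) 1)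
    (μ ν : ℝ) (hμ : 1 < μ) (hν : 1 < ν) (hμν : 1 / μ + 1 / ν = 1)
    (R : ℝ) (hR : 0 < R) :
    ∃ N : ℝ, 0 < N ∧
      ∀ a : ℝ × (Fin (n + 1) → ℝ) → Fin (n + 1) → Fin (n + 1) → ℝ,
        (∀ j k, Measurable fun q => a q j k) →
        (∀ q j k, a q j k = a q k j) →
        (∀ (q : ℝ × (Fin (n + 1) → ℝ)) (θ : Fin (n + 1) → ℝ),
          δ * ∑ j, (θ j) ^ 2 ≤ ∑ j, ∑ k, a q j k * θ j * θ k ∧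
          ∑ j, ∑ k, a q j k * θ j * θ k ≤ δ⁻¹ * ∑ j, (θ j) ^ 2) →
        ∀ u : ℝ × (Fin (n + 1) → ℝ) → ℝ, ContDiff ℝ (⊤ : ℕ∞) u →
          Function.support u ⊆ Qcyl R (0 : ℝ × (Fin (n + 1) → ℝ)) →
          ∀ p : ℝ × (Fin (n + 1) → ℝ),
            (sharpFn (pdt u) p
                ≤ N * (aSharp a R) ^ ((1 / ((n : ℝ) + 5)) / ν) *
                    (maxFn (fun y => (∑ j, ∑ k, (pdxx j k u y) ^ 2) ^ μ) p)
                      ^ (1 / (2 * μ))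
                  + N * (maxFn (fun y =>
                        (pdt u y + ∑ j, ∑ k, a y j k * pdxx j k u y) ^ 2) p)
                      ^ (1 / ((n : ℝ) + 5)) *
                    (maxFn (fun y => ∑ j, ∑ k, (pdxx j k u y) ^ 2) p)
                      ^ (((n : ℝ) + 3) / (2 * (n : ℝ) + 10))
                  + N * (maxFn (fun y =>
                        (pdt u y + ∑ j, ∑ k, a y j k * pdxx j k u y) ^ 2) p)
                      ^ ((1 : ℝ) / 2)) ∧
            ∀ j k : Fin (n + 1), k.val ≠ 0 →
              sharpFn (pdxx j k u) p
                ≤ N * (aSharp a R) ^ ((1 / ((n : ℝ) + 5)) / ν) *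
                    (maxFn (fun y => (∑ j', ∑ k', (pdxx j' k' u y) ^ 2) ^ μ) p)
                      ^ (1 / (2 * μ))
                  + N * (maxFn (fun y =>
                        (pdt u y + ∑ j', ∑ k', a y j' k' * pdxx j' k' u y) ^ 2) p)
                      ^ (1 / ((n : ℝ) + 5)) *
                    (maxFn (fun y => ∑ j', ∑ k', (pdxx j' k' u y) ^ 2) p)
                      ^ (((n : ℝ) + 3) / (2 * (n : ℝ) + 10))
                  + N * (maxFn (fun y =>
                        (pdt u y + ∑ j', ∑ k', a y j' k' * pdxx j' k' u y) ^ 2) p)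
                      ^ ((1 : ℝ) / 2) := by
  obtain ⟨N, hN, H⟩ := KK.mainW n hδ.1 hδ.2.le hμ hν hμν
  refine ⟨N, hN, fun a h1 h2 h3 u hu hs p => ?_⟩
  have hc : KK.Cc u := by
    refine ⟨hu, HasCompactSupport.intro' (K := closure (Qcyl R (0 : ℝ × (Fin (n + 1) → ℝ)))) ?_ isClosed_closure ?_⟩
    · refine Bornology.IsBounded.isCompact_closure ?_
      exact (Metric.isBounded_Ioo _ _).prod (Metric.isBounded_ball.subset (KK.ballC_bdd hR _))
    · intro x hx
      by_contra h
      exact hx (subset_closure (hs h))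
  have H' := H a ⟨h1, h2, h3⟩ R hR u hc hs p
  refine ⟨H' none, fun j k hk => ?_⟩
  obtain ⟨k', rfl⟩ := Fin.exists_succ_eq.2 (fun h : k = 0 => hk (by rw [h]; rfl))
  exact H' (some (j, k'))
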